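/- arXiv:1906.00301 — 6 statements merged into one kernel-verified Lean document; each statement's English description precedes it below -/
import Mathlib

section
/- Let $(A,\mathfrak m_A) \to (B,\mathfrak m_B)$ be a local homomorphism of Noetherian local rings, let $F = A/\mathfrak m_A$ be the residue field of $A$, let $M$ be a nonzero finitely generated $A$-module, and let $N$ be a nonzero finitely generated $B$-module that is flat over $A$. Then the Krull dimension of the $B$-module $N \otimes_A M$ equals the Krull dimension of the $B \otimes_A F$-module $N \otimes_A F$ plus the Krull dimension of $M$. -/
open TensorProduct IsLocalRing

/-- The (Krull) dimension of a module: the Krull dimension of its support,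
i.e. of `A ⧸ Ann M`. -/
noncomputable def moduleDim (A : Type*) [CommRing A] (M : Type*) [AddCommGroup M]
    [Module A M] : WithBot (WithTop ℕ) :=
  ringKrullDim (A ⧸ Module.annihilator A M)


namespace DimTensor

open Module Pointwise

section
variable {A B : Type*} [CommRing A] [CommRing B] [Algebra A B]
    (M : Type*) [AddCommGroup M] [Module A M]
    (N : Type*) [AddCommGroup N] [Module A N] [Module B N] [IsScalarTower A B N]

theorem finite_tensor [Module.Finite A M] [Module.Finite B N] : Module.Finite B (N ⊗[A] M) := by
  obtain ⟨n, f, hf⟩ := Module.Finite.exists_fin' A M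
  have h1 : Module.Finite B (N ⊗[A] (Fin n → A)) := by
    have h2 : Module.Finite B (N ⊗[A] A) :=
      Module.Finite.equiv (AlgebraTensorModule.rid A B N).symm
    exact Module.Finite.equiv (TensorProduct.piRight A B N (fun _ : Fin n => A)).symm
  exact Module.Finite.of_surjective (AlgebraTensorModule.lTensor B N f)
    (LinearMap.lTensor_surjective N hf)

theorem ann_eq [Module.Finite A M] [Module.Flat A N] :
    annihilator B (N ⊗[A] M) = annihilator B (N ⊗[A] (A ⧸ annihilator A M)) := by
  classical
  have key : ∀ m : M, ∃ g : (A ⧸ annihilator A M) →ₗ[A] M,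
      ∀ a : A, g (Ideal.Quotient.mk _ a) = a • m := by
    intro m
    refine ⟨Submodule.liftQ _ (LinearMap.toSpanSingleton A M m) ?_, fun a => ?_⟩
    · intro a ha
      simpa using Module.mem_annihilator.mp ha m
    · rfl
  choose g hg using key
  apply le_antisymm
  · intro b hb
    rw [Module.mem_annihilator] at hb ⊢
    obtain ⟨n, s, hs⟩ := Module.Finite.exists_fin (R := A) (M := M)
    let G : (A ⧸ annihilator A M) →ₗ[A] (Fin n → M) := LinearMap.pi fun i => g (s i)
    have hG : Function.Injective G := by
      rw [← LinearMap.ker_eq_bot, eq_bot_iff]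
      intro y hy
      obtain ⟨a, rfl⟩ := Ideal.Quotient.mk_surjective y
      have h1 : ∀ i, a • s i = 0 := fun i => by
        rw [← hg]; exact congrFun hy i
      rw [Submodule.mem_bot, Ideal.Quotient.eq_zero_iff_mem, Module.mem_annihilator]
      intro m
      have : m ∈ Submodule.span A (Set.range s) := hs ▸ Submodule.mem_top
      have h2 : Submodule.span A (Set.range s) ≤ LinearMap.ker (LinearMap.lsmul A M a) := by
        rw [Submodule.span_le]
        rintro _ ⟨i, rfl⟩
        exact h1 i
      exact h2 this
    intro t
    have hinj : Function.Injective (AlgebraTensorModule.lTensor B N G) :=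
      Module.Flat.lTensor_preserves_injective_linearMap G hG
    apply hinj
    apply (TensorProduct.piRight A B N (fun _ : Fin n => M)).injective
    rw [map_smul, map_smul, map_zero, map_zero]
    funext i
    exact hb _
  · intro b hb
    rw [Module.mem_annihilator] at hb ⊢
    intro t
    induction t with
    | zero => simp
    | add x y hx hy => rw [smul_add, hx, hy, add_zero]
    | tmul n m =>
      have h := congrArg (AlgebraTensorModule.lTensor B N (g m))
        (hb (n ⊗ₜ Ideal.Quotient.mk _ 1))
      rw [map_smul, map_zero, AlgebraTensorModule.lTensor_tmul, hg, one_smul] at h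
      exact h

theorem mem_ann_iff (I : Ideal A) (b : B) :
    b ∈ annihilator B (N ⊗[A] (A ⧸ I)) ↔ ∀ n : N, b • n ∈ (I • ⊤ : Submodule A N) := by
  have h0 : ∀ n : N, b • (n ⊗ₜ[A] (Ideal.Quotient.mk I 1)) = 0 ↔
      b • n ∈ (I • ⊤ : Submodule A N) := by
    intro n
    rw [TensorProduct.smul_tmul', ← (TensorProduct.tensorQuotEquivQuotSMul N I).map_eq_zero_iff,
      TensorProduct.tensorQuotEquivQuotSMul_tmul_mk, one_smul, Submodule.Quotient.mk_eq_zero]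
  rw [Module.mem_annihilator]
  constructor
  · intro h n
    exact (h0 n).mp (h _)
  · intro h t
    induction t with
    | zero => simp
    | add x y hx hy => rw [smul_add, hx, hy, add_zero]
    | tmul n m =>
      obtain ⟨a, rfl⟩ := Ideal.Quotient.mk_surjective m
      have : n ⊗ₜ[A] (Ideal.Quotient.mk I a) = (a • n) ⊗ₜ[A] (Ideal.Quotient.mk I 1) := by
        rw [TensorProduct.smul_tmul, ← Ideal.Quotient.mk_eq_mk, ← Ideal.Quotient.mk_eq_mk,
          ← Submodule.Quotient.mk_smul, smul_eq_mul, mul_one]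
      rw [this]
      exact (h0 _).mpr (h _)

theorem ann_radical [IsNoetherianRing A] (I : Ideal A) :
    (annihilator B (N ⊗[A] (A ⧸ I))).radical =
      (annihilator B (N ⊗[A] (A ⧸ I.radical))).radical := by
  apply le_antisymm
  · apply Ideal.radical_mono
    intro b hb
    rw [mem_ann_iff] at hb ⊢
    exact fun n => Submodule.smul_mono_left Ideal.le_radical (hb n)
  · rw [Ideal.radical_le_radical_iff]
    intro b hb
    rw [mem_ann_iff] at hb
    obtain ⟨k, hk⟩ := I.exists_radical_pow_le_of_fg (IsNoetherian.noetherian _)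
    refine ⟨k, ?_⟩
    rw [mem_ann_iff]
    have h : ∀ k : ℕ, ∀ n : N, b ^ k • n ∈ (I.radical ^ k • ⊤ : Submodule A N) := by
      intro k
      induction k with
      | zero => intro n; simp
      | succ k ih =>
        intro n
        rw [pow_succ b, mul_smul]
        have h1 := hb n
        generalize b • n = z at h1
        refine Submodule.smul_induction_on (p := fun z => b ^ k • z ∈ (I.radical ^ (k + 1) • ⊤ : Submodule A N)) h1 ?_ ?_
        · intro r hr m _
          rw [smul_comm, pow_succ', mul_smul]
          exact Submodule.smul_mem_smul hr (ih m)
        · intro x y hx hy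
          rw [smul_add]
          exact add_mem hx hy
    exact fun n => Submodule.smul_mono_left hk (h k n)

theorem supportDim_radical [Module.Finite A M] :
    supportDim A M = supportDim A (A ⧸ (annihilator A M).radical) := by
  rw [supportDim_quotient_eq_ringKrullDim, supportDim_eq_ringKrullDim_quotient_annihilator,
    ringKrullDim_quotient, ringKrullDim_quotient, PrimeSpectrum.zeroLocus_radical]

theorem supportDim_tensor [IsNoetherianRing A] [Module.Finite A M] [Module.Finite B N]
    [Module.Flat A N] :
    supportDim B (N ⊗[A] M) = supportDim B (N ⊗[A] (A ⧸ (annihilator A M).radical)) := by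
  have := finite_tensor (A := A) (B := B) M N
  have := finite_tensor (A := A) (B := B) (A ⧸ (annihilator A M).radical) N
  rw [supportDim_radical (A := B), ann_eq, ann_radical, ← supportDim_radical]

theorem supportDim_quot (x : A) :
    supportDim B (N ⊗[A] QuotSMulTop x M) =
      supportDim B (QuotSMulTop (algebraMap A B x) (N ⊗[A] M)) := by
  let q : M →ₗ[A] QuotSMulTop x M := Submodule.mkQ _
  have hq : Function.Surjective q := Submodule.mkQ_surjective _
  have hex : Function.Exact (LinearMap.lsmul A M x) q := by
    rw [LinearMap.exact_iff, Submodule.ker_mkQ]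
    ext m
    simp [Submodule.mem_smul_pointwise_iff_exists]
  have hex2 := lTensor_exact N hex hq
  let Q := AlgebraTensorModule.lTensor B N q
  have hQ : Function.Surjective Q := LinearMap.lTensor_surjective N hq
  have hker : LinearMap.ker Q = (algebraMap A B x • ⊤ : Submodule B (N ⊗[A] M)) := by
    ext t
    rw [LinearMap.mem_ker, Submodule.mem_smul_pointwise_iff_exists]
    have h1 := hex2 t
    have h2 : ∀ s : N ⊗[A] M, LinearMap.lTensor N (LinearMap.lsmul A M x) s =
        algebraMap A B x • s := by
      intro s
      rw [algebraMap_smul]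
      induction s with
      | zero => simp
      | add x y hx hy => rw [smul_add, map_add, hx, hy]
      | tmul n m => simp
    refine h1.trans ?_
    simp [h2]
  exact supportDim_eq_of_equiv
    ((Submodule.quotEquivOfEq _ _ hker).symm.trans (Q.quotKerEquivOfSurjective hQ)).symm

end

section
variable {A B : Type*} [CommRing A] [CommRing B] [IsNoetherianRing A] [IsNoetherianRing B]
    [IsLocalRing A] [IsLocalRing B] [Algebra A B] [IsLocalHom (algebraMap A B)]
    (N : Type*) [AddCommGroup N] [Module A N] [Module B N] [IsScalarTower A B N]
    [Module.Finite B N] [Module.Flat A N]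

theorem exists_regular (J : Ideal A) (hJ : J.IsRadical) (hJt : J ≠ ⊤)
    (hJm : J ≠ maximalIdeal A) :
    ∃ x ∈ maximalIdeal A, x ∉ J ∧ IsSMulRegular (A ⧸ J) x := by
  have hfin := Ideal.finite_minimalPrimes_of_isNoetherianRing A J
  have hsInf : sInf J.minimalPrimes = J := by rw [Ideal.sInf_minimalPrimes, hJ.radical]
  have hno : ¬ ((maximalIdeal A : Set A) ⊆ ⋃ p ∈ (hfin.toFinset : Set (Ideal A)), (p : Set A)) := by
    intro h
    have := (Ideal.subset_union_prime (f := fun p : Ideal A => p) ⊥ ⊥ (fun p hp _ _ =>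
      (hfin.mem_toFinset.mp hp).1.1)).mp h
    obtain ⟨p, hp, hmp⟩ := this
    have hp := hfin.mem_toFinset.mp hp
    have hpm : p = maximalIdeal A := le_antisymm (le_maximalIdeal hp.1.1.ne_top) hmp
    apply hJm
    apply le_antisymm (le_maximalIdeal hJt)
    rw [← hsInf]
    refine le_sInf fun q hq => ?_
    rw [← hpm]
    exact hp.2 hq.1 (hpm ▸ le_maximalIdeal hq.1.1.ne_top)
  obtain ⟨x, hxm, hx⟩ := Set.not_subset.mp hno
  have hx : ∀ p ∈ J.minimalPrimes, x ∉ p := by simpa using hx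
  refine ⟨x, hxm, ?_, ?_⟩
  · intro hxJ
    obtain ⟨p, hp, _⟩ := Ideal.exists_minimalPrimes_le (le_maximalIdeal hJt)
    exact hx p hp (hp.1.2 hxJ)
  · rw [isSMulRegular_iff_right_eq_zero_of_smul]
    intro y hy
    obtain ⟨a, rfl⟩ := Ideal.Quotient.mk_surjective y
    rw [← Ideal.Quotient.mk_eq_mk, ← Submodule.Quotient.mk_smul, Ideal.Quotient.mk_eq_mk,
      Ideal.Quotient.eq_zero_iff_mem] at hy
    rw [Ideal.Quotient.eq_zero_iff_mem, ← hsInf, Submodule.mem_sInf]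
    intro p hp
    exact (hp.1.1.mem_or_mem (hp.1.2 hy)).resolve_left (hx p hp)

theorem main_ideal (J : Ideal A) : J.IsRadical → J ≠ ⊤ →
    supportDim B (N ⊗[A] (A ⧸ J)) =
      supportDim B (N ⊗[A] (A ⧸ maximalIdeal A)) + supportDim A (A ⧸ J) := by
  induction J using WellFoundedGT.induction with
  | ind J ih =>
  intro hJ hJt
  by_cases hJm : J = maximalIdeal A
  · subst hJm
    have : supportDim A (A ⧸ maximalIdeal A) = 0 := by
      rw [supportDim_quotient_eq_ringKrullDim]
      exact ringKrullDim_eq_zero_of_field (ResidueField A)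
    rw [this, add_zero]
  obtain ⟨x, hxm, hxJ, hreg⟩ := exists_regular J hJ hJt hJm
  have hnt : Nontrivial (A ⧸ J) := Ideal.Quotient.nontrivial_iff.mpr hJt
  have hdim := supportDim_quotSMulTop_succ_eq_supportDim hreg hxm
  have hfin := finite_tensor (A := A) (B := B) (A ⧸ J) N
  have hregB : IsSMulRegular (N ⊗[A] (A ⧸ J)) (algebraMap A B x) := by
    have h1 : Function.Injective (LinearMap.lTensor N (LinearMap.lsmul A (A ⧸ J) x)) :=
      Module.Flat.lTensor_preserves_injective_linearMap _ hreg
    intro s t hst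
    apply h1
    have h2 : ∀ s : N ⊗[A] (A ⧸ J), LinearMap.lTensor N (LinearMap.lsmul A (A ⧸ J) x) s =
        algebraMap A B x • s := by
      intro s
      rw [algebraMap_smul]
      induction s with
      | zero => simp
      | add x y hx hy => rw [smul_add, map_add, hx, hy]
      | tmul n m => simp
    rw [h2, h2]
    exact hst
  have hxB : algebraMap A B x ∈ maximalIdeal B := by
    rw [mem_maximalIdeal, mem_nonunits_iff] at hxm ⊢
    exact fun h => hxm (isUnit_of_map_unit (algebraMap A B) x h)
  have hdimB := supportDim_quotSMulTop_succ_eq_supportDim hregB hxB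
  have hM' : Nontrivial (QuotSMulTop x (A ⧸ J)) := by
    rw [← supportDim_ne_bot_iff_nontrivial A]
    intro hbot
    rw [hbot] at hdim
    exact supportDim_ne_bot_of_nontrivial A (A ⧸ J) hdim.symm
  have hne : (annihilator A (QuotSMulTop x (A ⧸ J))).radical ≠ ⊤ := by
    rw [Ne, Ideal.radical_eq_top, Module.annihilator_eq_top_iff, not_subsingleton_iff_nontrivial]
    exact hM'
  have hxa : x ∈ annihilator A (QuotSMulTop x (A ⧸ J)) := QuotSMulTop.mem_annihilator _ x
  have hlt : J < (annihilator A (QuotSMulTop x (A ⧸ J))).radical := by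
    refine lt_of_le_of_ne ?_ ?_
    · refine le_trans ?_ Ideal.le_radical
      refine le_trans (Ideal.annihilator_quotient (I := J)).ge ?_
      exact LinearMap.annihilator_le_of_surjective (Submodule.mkQ _) (Submodule.mkQ_surjective _)
    · intro h
      exact hxJ (h ▸ Ideal.le_radical hxa)
  have := ih _ hlt (Ideal.radical_isRadical _) hne
  rw [← supportDim_radical, ← supportDim_tensor, supportDim_quot] at this
  rw [← hdim, ← hdimB, this, add_assoc]

end

end DimTensor

/-- Let `A → B` be a local homomorphism of Noetherian local rings, `F` the residue
field of `A`, `M` a nonzero finitely generated `A`-module and `N` a nonzero finitely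
generated `B`-module flat over `A`.  Then
`dim (N ⊗[A] M) = dim (N ⊗[A] F) + dim M`. -/
theorem dim_tensor_eq_dim_fiber_add_dim
    {A B : Type*} [CommRing A] [CommRing B] [IsNoetherianRing A] [IsNoetherianRing B]
    [IsLocalRing A] [IsLocalRing B] [Algebra A B] [IsLocalHom (algebraMap A B)]
    (M : Type*) [AddCommGroup M] [Module A M] [Module.Finite A M] [Nontrivial M]
    (N : Type*) [AddCommGroup N] [Module A N] [Module B N] [IsScalarTower A B N]
    [Module.Finite B N] [Nontrivial N] [Module.Flat A N] :
    moduleDim B (N ⊗[A] M) = moduleDim B (N ⊗[A] ResidueField A) + moduleDim A M := by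
  have h1 := DimTensor.finite_tensor (A := A) (B := B) M N
  have h2 := DimTensor.finite_tensor (A := A) (B := B) (ResidueField A) N
  unfold moduleDim
  rw [← Module.supportDim_eq_ringKrullDim_quotient_annihilator,
    ← Module.supportDim_eq_ringKrullDim_quotient_annihilator,
    ← Module.supportDim_eq_ringKrullDim_quotient_annihilator,
    DimTensor.supportDim_tensor, DimTensor.supportDim_radical (A := A) M]
  refine DimTensor.main_ideal N _ (Ideal.radical_isRadical _) ?_
  rw [Ne, Ideal.radical_eq_top, Module.annihilator_eq_top_iff, not_subsingleton_iff_nontrivial]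
  infer_instance
end

section
/- Let $(A,\mathfrak m_A) \to (B,\mathfrak m_B)$ be a local homomorphism of Noetherian local rings, let $F$ be the residue field of $A$, let $M$ be a nonzero finitely generated $A$-module, and let $N$ be a nonzero finitely generated $B$-module that is flat over $A$. Then $\operatorname{depth}_B(N \otimes_A M) = \operatorname{depth}_{B}(N \otimes_A F) + \operatorname{depth}_A(M)$. -/
open TensorProduct IsLocalRing

/-- The depth of a module over a Noetherian local ring: the supremum of the lengths of
regular sequences on `M` contained in the maximal ideal. -/
noncomputable def moduleDepth (A : Type*) [CommRing A] [IsLocalRing A]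
    (M : Type*) [AddCommGroup M] [Module A M] : WithTop ℕ :=
  sSup {n : WithTop ℕ | ∃ rs : List A, (∀ r ∈ rs, r ∈ maximalIdeal A) ∧
    RingTheory.Sequence.IsRegular M rs ∧ (rs.length : WithTop ℕ) = n}


open RingTheory.Sequence CategoryTheory Abelian Limits

universe u v w
set_option linter.unusedSectionVars false

/-- `M` admits a regular sequence of length `n` in the maximal ideal. -/
def HasReg (A : Type*) [CommRing A] [IsLocalRing A]
    (M : Type*) [AddCommGroup M] [Module A M] (n : ℕ) : Prop :=
  ∃ rs : List A, rs.length = n ∧ (∀ r ∈ rs, r ∈ maximalIdeal A) ∧ IsRegular M rs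

section
variable {R : Type u} [CommRing R] [IsLocalRing R]
  {M : Type v} [AddCommGroup M] [Module R M]
  {M' : Type w} [AddCommGroup M'] [Module R M']

lemma HasReg.congr (e : M ≃ₗ[R] M') {n : ℕ} : HasReg R M n ↔ HasReg R M' n := by
  simp only [HasReg, e.isRegular_congr]

lemma hasReg_zero [Nontrivial M] : HasReg R M 0 :=
  ⟨[], rfl, by simp, IsRegular.nil R M⟩

lemma HasReg.cons {x : R} (hx : x ∈ maximalIdeal R) (h : IsSMulRegular M x) {n : ℕ}
    (h' : HasReg R (QuotSMulTop x M) n) : HasReg R M (n + 1) := by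
  obtain ⟨rs, h1, h2, h3⟩ := h'
  exact ⟨x :: rs, by simp [h1], by
    intro r hr
    rcases List.mem_cons.mp hr with rfl | hr
    exacts [hx, h2 r hr], h3.cons h⟩

lemma HasReg.exists_of_succ {n : ℕ} (h : HasReg R M (n + 1)) :
    ∃ x ∈ maximalIdeal R, IsSMulRegular M x ∧ HasReg R (QuotSMulTop x M) n := by
  obtain ⟨rs, h1, h2, h3⟩ := h
  match rs with
  | [] => simp at h1
  | a :: rs =>
    rw [isRegular_cons_iff] at h3
    refine ⟨a, h2 a (by simp), h3.1, rs, by simpa using h1, fun r hr => h2 r (by simp [hr]), h3.2⟩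

lemma HasReg.mono_succ [Module.Finite R M] {n : ℕ} (h : HasReg R M (n+1)) : HasReg R M n := by
  induction n generalizing M with
  | zero =>
    obtain ⟨rs, h1, h2, h3⟩ := h
    have := h3.nontrivial
    exact hasReg_zero
  | succ n ih =>
    obtain ⟨x, hx, h1, h2⟩ := h.exists_of_succ
    exact HasReg.cons hx h1 (ih h2)

lemma HasReg.mono [Module.Finite R M] {n m : ℕ} (hnm : n ≤ m) (h : HasReg R M m) :
    HasReg R M n := by
  induction hnm with
  | refl => exact h
  | step _ ih => exact ih h.mono_succ

lemma le_moduleDepth_iff [Module.Finite R M] [Nontrivial M] (n : ℕ) :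
    (n : WithTop ℕ) ≤ moduleDepth R M ↔ HasReg R M n := by
  constructor
  · intro h
    cases n with
    | zero => exact hasReg_zero
    | succ n =>
      have h' : (n : WithTop ℕ) < moduleDepth R M :=
        lt_of_lt_of_le (by exact_mod_cast Nat.lt_succ_self n) h
      obtain ⟨a, ⟨rs, h1, h2, rfl⟩, ha⟩ := lt_sSup_iff.mp h'
      have : n + 1 ≤ rs.length := by exact_mod_cast ha
      exact HasReg.mono this ⟨rs, rfl, h1, h2⟩
  · rintro ⟨rs, h1, h2, h3⟩
    exact le_sSup ⟨rs, h2, h3, by rw [h1]⟩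

lemma hasReg_quot_of_ulift [IsNoetherianRing R] [Small.{v} R] [Module.Finite R M] [Nontrivial M]
    {x : R} (hx : x ∈ maximalIdeal R)
    (h : IsSMulRegular M x) {n : ℕ} (h' : HasReg R M (n + 1)) : HasReg R (QuotSMulTop x M) n := by
  have lt (P : Type v) [AddCommGroup P] [Module R P] [Module.Finite R P] [Nontrivial P] :
      maximalIdeal R • (⊤ : Submodule R P) < ⊤ :=
    lt_top_iff_ne_top.mpr (Ne.symm (Submodule.top_ne_ideal_smul_of_le_jacobson_annihilator
      (IsLocalRing.maximalIdeal_le_jacobson _)))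
  have := nontrivial_quotSMulTop_of_mem_maximalIdeal M hx
  have h1 := ((ModuleCat.exists_isRegular_tfae (maximalIdeal R) (n+1) (ModuleCat.of R M)
    (lt M)).out 1 3).mpr h'
  refine ((ModuleCat.exists_isRegular_tfae (maximalIdeal R) n (ModuleCat.of R (QuotSMulTop x M))
    (lt _)).out 1 3).mp ?_
  intro i hi
  have zero1 := AddCommGrpCat.isZero_of_iff_subsingleton.mpr (h1 i (by omega))
  have zero2 := AddCommGrpCat.isZero_of_iff_subsingleton.mpr (h1 (i + 1) (by omega))
  have h2 : IsSMulRegular (ModuleCat.of R M) x := h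
  exact AddCommGrpCat.subsingleton_of_isZero <| ShortComplex.Exact.isZero_of_both_zeros
        ((Ext.covariant_sequence_exact₃' _ h2.smulShortComplex_shortExact) i (i + 1) rfl)
        (zero1.eq_zero_of_src _) (zero2.eq_zero_of_tgt _)

lemma HasReg.quot [IsNoetherianRing R] [Module.Finite R M] [Nontrivial M]
    {x : R} (hx : x ∈ maximalIdeal R)
    (h : IsSMulRegular M x) {n : ℕ} (h' : HasReg R M (n + 1)) : HasReg R (QuotSMulTop x M) n := by
  let e : M ≃ₗ[R] ULift.{u} M := ULift.moduleEquiv.symm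
  rw [HasReg.congr e] at h'
  rw [HasReg.congr (QuotSMulTop.congr x e)]
  exact hasReg_quot_of_ulift hx ((e.isSMulRegular_congr x).mp h) h'

lemma moduleDepth_quot [IsNoetherianRing R] [Module.Finite R M] [Nontrivial M]
    {x : R} (hx : x ∈ maximalIdeal R) (h : IsSMulRegular M x) :
    moduleDepth R M = moduleDepth R (QuotSMulTop x M) + 1 := by
  have := nontrivial_quotSMulTop_of_mem_maximalIdeal M hx
  refine ENat.eq_of_forall_natCast_le_iff fun n => ?_
  refine (le_moduleDepth_iff n).trans ?_
  cases n with
  | zero => exact ⟨fun _ => zero_le (a := (_ : ℕ∞)), fun _ => hasReg_zero⟩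
  | succ n =>
    have key (d : ℕ∞) : ((n + 1 : ℕ) : ℕ∞) ≤ d + 1 ↔ (n : ℕ∞) ≤ d := by
      push_cast
      exact ENat.add_le_add_iff_right (by simp)
    refine Iff.trans ?_ (key (moduleDepth R (QuotSMulTop x M))).symm
    exact ⟨fun h' => (le_moduleDepth_iff n).mpr (h'.quot hx h),
      fun h' => ((le_moduleDepth_iff n).mp h').cons hx h⟩

lemma moduleDepth_congr (e : M ≃ₗ[R] M') :
    moduleDepth R M = moduleDepth R M' := by
  simp only [moduleDepth, e.isRegular_congr]

lemma moduleDepth_eq_zero_iff [IsNoetherianRing R] [Module.Finite R M] [Nontrivial M] :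
    moduleDepth R M = 0 ↔ ∃ f : ResidueField R →ₗ[R] M, f ≠ 0 := by
  have h1 : moduleDepth R M = 0 ↔ ¬ HasReg R M 1 := by
    rw [← le_moduleDepth_iff, not_le]
    have key (d : ℕ∞) : d = 0 ↔ d < ((1 : ℕ) : ℕ∞) := by simp [Order.lt_one_iff]
    exact key _
  have h2 : HasReg R M 1 ↔ ∃ x ∈ maximalIdeal R, IsSMulRegular M x := by
    constructor
    · intro h
      obtain ⟨x, hx, h, -⟩ := h.exists_of_succ
      exact ⟨x, hx, h⟩
    · rintro ⟨x, hx, h⟩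
      have := nontrivial_quotSMulTop_of_mem_maximalIdeal M hx
      exact HasReg.cons hx h hasReg_zero
  have h3 : Module.annihilator R (ResidueField R) = maximalIdeal R := Ideal.annihilator_quotient
  rw [h1, h2, ← h3, ← IsSMulRegular.subsingleton_linearMap_iff, not_subsingleton_iff_nontrivial]
  exact ⟨fun h => exists_ne 0, fun ⟨f, hf⟩ => ⟨f, 0, hf⟩⟩

end

section
open Pointwise
variable {A : Type*} {B : Type*} [CommRing A] [CommRing B] [Algebra A B]
    (M : Type*) [AddCommGroup M] [Module A M]
    (N : Type*) [AddCommGroup N] [Module A N] [Module B N] [IsScalarTower A B N]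

lemma finite_tensor_aux [Module.Finite A M] [Module.Finite B N] : Module.Finite B (N ⊗[A] M) :=
  Module.Finite.equiv (TensorProduct.AlgebraTensorModule.cancelBaseChange A B B N M)

/-- tensor with quotient on the right -/
noncomputable def tensorQuotRight (x : A) :
    QuotSMulTop (algebraMap A B x) (N ⊗[A] M) ≃ₗ[B] N ⊗[A] QuotSMulTop x M :=
  let f : N ⊗[A] M →ₗ[B] N ⊗[A] QuotSMulTop x M :=
    TensorProduct.AlgebraTensorModule.lTensor B N (Submodule.mkQ (x • (⊤ : Submodule A M)))
  have hf : Function.Surjective f := LinearMap.lTensor_surjective N (Submodule.mkQ_surjective _)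
  have hk : (algebraMap A B x • (⊤ : Submodule B (N ⊗[A] M))) = LinearMap.ker f := by
    have hex : Function.Exact (LinearMap.lsmul A M x) (Submodule.mkQ (x • (⊤ : Submodule A M))) := by
      rw [LinearMap.exact_iff, Submodule.ker_mkQ, ← Submodule.map_top]
      rfl
    have h := lTensor_exact N hex (Submodule.mkQ_surjective _)
    ext y
    rw [LinearMap.mem_ker, Submodule.mem_smul_pointwise_iff_exists]
    refine Iff.trans ?_ (h y).symm
    have : ∀ z, (LinearMap.lTensor N (LinearMap.lsmul A M x)) z = algebraMap A B x • z := by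
      intro z
      induction z with
      | zero => simp
      | tmul n m => simp [TensorProduct.smul_tmul']
      | add a b ha hb => rw [map_add, ha, hb, smul_add]
    simp [this]
  (Submodule.quotEquivOfEq _ _ hk).trans (f.quotKerEquivOfSurjective hf)

lemma rTensor_surj_ker {Q : Type*} [AddCommGroup Q] [Module A Q] [Module B Q] [IsScalarTower A B Q]
    (b : B) (g : N →ₗ[B] Q) (hg : Function.Surjective g)
    (hk : ∀ y, g y = 0 ↔ ∃ z, b • z = y) :
    Function.Surjective (TensorProduct.AlgebraTensorModule.rTensor A M g) ∧
    (b • (⊤ : Submodule B (N ⊗[A] M))) =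
      LinearMap.ker (TensorProduct.AlgebraTensorModule.rTensor A M g) := by
  have hr : ∀ z, TensorProduct.AlgebraTensorModule.rTensor A M g z =
      LinearMap.rTensor M (g.restrictScalars A) z := fun z => by
    induction z with
    | zero => simp
    | tmul n m => simp
    | add a b ha hb => rw [map_add, ha, hb, map_add]
  refine ⟨fun y => ?_, ?_⟩
  · obtain ⟨x, hx⟩ := LinearMap.rTensor_surjective M (g := g.restrictScalars A) hg y
    exact ⟨x, (hr x).trans hx⟩
  · have hex : Function.Exact ((LinearMap.lsmul B N b).restrictScalars A)
        (g.restrictScalars A) := by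
      intro y
      simpa using hk y
    have h := rTensor_exact M hex hg
    ext y
    rw [LinearMap.mem_ker, Submodule.mem_smul_pointwise_iff_exists, hr]
    refine Iff.trans ?_ (h y).symm
    have : ∀ z, (LinearMap.rTensor M ((LinearMap.lsmul B N b).restrictScalars A)) z = b • z := by
      intro z
      induction z with
      | zero => simp
      | tmul n m => simp [TensorProduct.smul_tmul']
      | add a b ha hb => rw [map_add, ha, hb, smul_add]
    simp [this]

/-- tensor with quotient on the left -/
noncomputable def tensorQuotLeft (b : B) :
    QuotSMulTop b (N ⊗[A] M) ≃ₗ[B] (QuotSMulTop b N) ⊗[A] M :=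
  have h := rTensor_surj_ker (A := A) M N b (Submodule.mkQ (b • (⊤ : Submodule B N)))
    (Submodule.mkQ_surjective _) (by simp [Submodule.mem_smul_pointwise_iff_exists])
  (Submodule.quotEquivOfEq _ _ h.2).trans (LinearMap.quotKerEquivOfSurjective _ h.1)

@[simp] lemma tensorQuotLeft_mk_tmul (b : B) (n : N) (m : M) :
    tensorQuotLeft M N b (Submodule.Quotient.mk (n ⊗ₜ[A] m)) =
      (Submodule.Quotient.mk n : QuotSMulTop b N) ⊗ₜ[A] m := rfl

end

section
variable {A : Type u} {B : Type*} [CommRing A] [CommRing B] [IsNoetherianRing A]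
    [IsNoetherianRing B]
    [IsLocalRing A] [IsLocalRing B] [Algebra A B] [IsLocalHom (algebraMap A B)]
    (N : Type*) [AddCommGroup N] [Module A N] [Module B N] [IsScalarTower A B N]

lemma regular_tensor_vectorSpace {b : B} (hb : IsSMulRegular (N ⊗[A] ResidueField A) b)
    (V : Type*) [AddCommGroup V] [Module A V] [Module (ResidueField A) V]
    [IsScalarTower A (ResidueField A) V] : IsSMulRegular (N ⊗[A] V) b := by
  classical
  let e1 := ((Module.Basis.ofVectorSpace (ResidueField A) V).repr).restrictScalars A
  let e2 := (TensorProduct.AlgebraTensorModule.congr (LinearEquiv.refl B N) e1).trans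
    (TensorProduct.finsuppRight A B N (ResidueField A) _)
  rw [e2.isSMulRegular_congr]
  intro x y hxy
  ext i
  exact hb (DFunLike.congr_fun hxy i)

variable [Module.Flat A N]

lemma regular_tensor_of_pow {b : B} (hb : IsSMulRegular (N ⊗[A] ResidueField A) b) (k : ℕ)
    (M : Type*) [AddCommGroup M] [Module A M]
    (hM : (maximalIdeal A) ^ k • (⊤ : Submodule A M) = ⊥) : IsSMulRegular (N ⊗[A] M) b := by
  induction k generalizing M with
  | zero =>
    have : Subsingleton M := by
      rw [pow_zero, Ideal.one_eq_top, Submodule.top_smul] at hM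
      exact (Submodule.subsingleton_iff A).mp (subsingleton_of_bot_eq_top hM.symm)
    exact fun x y _ => Subsingleton.elim _ _
  | succ k ih =>
    let M' : Submodule A M := maximalIdeal A • ⊤
    have h1 : IsSMulRegular (N ⊗[A] M') b := by
      apply ih
      rw [← (Submodule.map_injective_of_injective M'.injective_subtype).eq_iff]
      rw [Submodule.map_smul'', Submodule.map_top, Submodule.range_subtype, Submodule.map_bot,
        ← hM, pow_succ, Submodule.mul_smul]
    have h2 : IsSMulRegular (N ⊗[A] (M ⧸ M')) b := by
      let _ : Module (ResidueField A) (M ⧸ M') :=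
        Module.instQuotientIdealSubmoduleHSMulTop M (maximalIdeal A)
      have : IsScalarTower A (ResidueField A) (M ⧸ M') :=
        inferInstanceAs (IsScalarTower A (A ⧸ maximalIdeal A)
          (M ⧸ (maximalIdeal A • ⊤ : Submodule A M)))
      exact regular_tensor_vectorSpace N hb _
    refine isSMulRegular_of_range_eq_ker
      (f := TensorProduct.AlgebraTensorModule.lTensor B N M'.subtype)
      (g := TensorProduct.AlgebraTensorModule.lTensor B N M'.mkQ) ?_ ?_ h1 h2
    · exact Module.Flat.lTensor_preserves_injective_linearMap _ M'.injective_subtype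
    · ext y
      exact (lTensor_exact N (LinearMap.exact_subtype_mkQ M') M'.mkQ_surjective y).symm

variable [Module.Finite B N]

lemma regular_tensor {b : B} (hb : IsSMulRegular (N ⊗[A] ResidueField A) b)
    (M : Type*) [AddCommGroup M] [Module A M] [Module.Finite A M] :
    IsSMulRegular (N ⊗[A] M) b := by
  have := finite_tensor_aux (A := A) (B := B) M N
  refine IsSMulRegular.of_right_eq_zero_of_smul fun y hy => ?_
  rw [← Submodule.mem_bot B, ← Ideal.iInf_pow_smul_eq_bot_of_isLocalRing (M := N ⊗[A] M)
    (maximalIdeal B) (Ideal.IsPrime.ne_top'), Submodule.mem_iInf]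
  intro k
  let M' : Submodule A M := maximalIdeal A ^ k • ⊤
  have h1 : IsSMulRegular (N ⊗[A] (M ⧸ M')) b := by
    apply regular_tensor_of_pow N hb k
    rw [← Submodule.range_mkQ M', ← Submodule.map_top, ← Submodule.map_smul'']
    exact Submodule.mkQ_map_self M'
  have h2 : TensorProduct.AlgebraTensorModule.lTensor B N M'.mkQ y = 0 := by
    apply h1.right_eq_zero_of_smul
    rw [← map_smul, hy, map_zero]
  obtain ⟨z, rfl⟩ := (lTensor_exact N (LinearMap.exact_subtype_mkQ M') M'.mkQ_surjective y).mp h2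
  have h3 : ((maximalIdeal A) ^ k).map (algebraMap A B) ≤ maximalIdeal B ^ k := by
    rw [Ideal.map_pow]
    exact Ideal.pow_right_mono (((local_hom_TFAE (algebraMap A B)).out 0 2).mp
      (inferInstance : IsLocalHom (algebraMap A B))) k
  clear hy h2
  induction z with
  | zero => simp
  | add a b ha hb =>
    rw [map_add]
    exact add_mem ha hb
  | tmul n m => 
    obtain ⟨m, hm⟩ := m
    simp only [LinearMap.lTensor_tmul, Submodule.subtype_apply]
    induction hm using Submodule.smul_induction_on' with
    | smul r hr m _ => 
      rw [TensorProduct.tmul_smul, ← algebraMap_smul B r (n ⊗ₜ[A] m)]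
      exact Submodule.smul_mem_smul (h3 (Ideal.mem_map_of_mem _ hr)) Submodule.mem_top
    | add a _ c _ ha hc =>
      rw [TensorProduct.tmul_add]
      exact add_mem ha hc

lemma flat_quot {b : B} (hb : IsSMulRegular (N ⊗[A] ResidueField A) b) :
    Module.Flat A (QuotSMulTop b N) := by
  rw [Module.Flat.iff_lTensor_injective]
  intro I _
  have h1 : IsSMulRegular (N ⊗[A] (A ⧸ I)) b := regular_tensor N hb _
  let f : N ⊗[A] I →ₗ[B] N ⊗[A] A := TensorProduct.AlgebraTensorModule.lTensor B N I.subtype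
  let g : N ⊗[A] A →ₗ[B] N ⊗[A] (A ⧸ I) :=
    TensorProduct.AlgebraTensorModule.lTensor B N I.mkQ
  have hf : Function.Injective f :=
    Module.Flat.lTensor_preserves_injective_linearMap _ I.injective_subtype
  have hfg : Function.Exact f g := lTensor_exact N (LinearMap.exact_subtype_mkQ I) I.mkQ_surjective
  have h0 : Function.Exact (0 : Unit →ₗ[B] N ⊗[A] I) f := by
    rw [LinearMap.exact_zero_iff_injective]
    exact hf
  have h2 := QuotSMulTop.map_first_exact_on_four_term_exact_of_isSMulRegular_last (r := b) h0 hfg h1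
  rw [map_zero, LinearMap.exact_zero_iff_injective] at h2
  have h3 : ∀ z, (LinearMap.lTensor (QuotSMulTop b N) I.subtype) (tensorQuotLeft I N b z) =
      tensorQuotLeft A N b (QuotSMulTop.map b f z) := by
    intro z
    obtain ⟨z, rfl⟩ := Submodule.Quotient.mk_surjective _ z
    induction z with
    | zero => simp
    | tmul n m => rfl
    | add x y hx hy => 
      rw [Submodule.Quotient.mk_add, map_add, map_add, map_add, map_add, hx, hy]
  intro x y hxy
  obtain ⟨x, rfl⟩ := (tensorQuotLeft I N b).surjective x
  obtain ⟨y, rfl⟩ := (tensorQuotLeft I N b).surjective y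
  rw [h3, h3] at hxy
  rw [h2 ((tensorQuotLeft A N b).injective hxy)]

end

section
variable {A : Type*} {B : Type*} [CommRing A] [CommRing B] [IsNoetherianRing A]
    [IsNoetherianRing B]
    [IsLocalRing A] [IsLocalRing B] [Algebra A B] [IsLocalHom (algebraMap A B)]
    (N : Type*) [AddCommGroup N] [Module A N] [Module B N] [IsScalarTower A B N]
    [Module.Flat A N] [Module.Finite B N] [Nontrivial N]

lemma nontrivial_tensor_aux {A : Type*} {B : Type*} [CommRing A] [CommRing B]
    [IsLocalRing A] [IsLocalRing B] [Algebra A B] [IsLocalHom (algebraMap A B)]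
    (N : Type*) [AddCommGroup N] [Module A N] [Module B N] [IsScalarTower A B N]
    [Module.Flat A N] [Module.Finite B N] [Nontrivial N]
    (M : Type*) [AddCommGroup M] [Module A M] [Nontrivial M] :
    Nontrivial (N ⊗[A] M) := by
  have : Module.FaithfullyFlat A N := by
    refine ⟨fun m hm h => ?_⟩
    rw [IsLocalRing.eq_maximalIdeal hm] at h
    have hle : (maximalIdeal A).map (algebraMap A B) ≤ maximalIdeal B :=
      ((local_hom_TFAE (algebraMap A B)).out 0 2).mp (inferInstance : IsLocalHom (algebraMap A B))
    refine Submodule.top_ne_ideal_smul_of_le_jacobson_annihilator (R := B) (M := N)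
      (IsLocalRing.maximalIdeal_le_jacobson _) (top_le_iff.mp ?_).symm
    intro x _
    have hx : x ∈ maximalIdeal A • (⊤ : Submodule A N) := by
      rw [h]
      exact Submodule.mem_top
    induction hx using Submodule.smul_induction_on' with
    | smul r hr n _ =>
      rw [← algebraMap_smul B r n]
      exact Submodule.smul_mem_smul (hle (Ideal.mem_map_of_mem _ hr)) Submodule.mem_top
    | add a _ c _ ha hc => exact add_mem (ha trivial) (hc trivial)
  infer_instance

lemma regular_tensor_right {M : Type*} [AddCommGroup M] [Module A M] {x : A}
    (hx : IsSMulRegular M x) : IsSMulRegular (N ⊗[A] M) (algebraMap A B x) := by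
  have h := IsSMulRegular.lTensor (M := N) hx
  intro y z hyz
  exact h (by simpa using hyz)

lemma algebraMap_mem_aux {x : A} (hx : x ∈ maximalIdeal A) : algebraMap A B x ∈ maximalIdeal B :=
  map_nonunit (algebraMap A B) x hx

lemma hasReg_tensor_left (p : ℕ) (h : HasReg B (N ⊗[A] ResidueField A) p)
    (M : Type*) [AddCommGroup M] [Module A M] [Module.Finite A M] [Nontrivial M] :
    HasReg B (N ⊗[A] M) p := by
  induction p generalizing N with
  | zero =>
    have := nontrivial_tensor_aux (A := A) (B := B) N M
    exact hasReg_zero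
  | succ p ih =>
    obtain ⟨b, hb, h1, h2⟩ := h.exists_of_succ
    have := flat_quot (A := A) (B := B) N h1
    have := nontrivial_quotSMulTop_of_mem_maximalIdeal N hb
    refine HasReg.cons hb (regular_tensor N h1 M) ?_
    rw [HasReg.congr (tensorQuotLeft _ _ _)] at h2 ⊢
    exact ih _ h2

lemma hasReg_tensor (p q : ℕ) (h : HasReg B (N ⊗[A] ResidueField A) p)
    (M : Type*) [AddCommGroup M] [Module A M] [Module.Finite A M] [Nontrivial M]
    (hM : HasReg A M q) :
    HasReg B (N ⊗[A] M) (p + q) := by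
  induction q generalizing M with
  | zero => exact hasReg_tensor_left N p h M
  | succ q ih =>
    obtain ⟨x, hx, h1, h2⟩ := hM.exists_of_succ
    have := nontrivial_quotSMulTop_of_mem_maximalIdeal M hx
    refine HasReg.cons (algebraMap_mem_aux hx) (regular_tensor_right N h1) ?_
    rw [HasReg.congr (tensorQuotRight _ _ _)]
    exact ih _ h2

/-- a residue field map that is nonzero is injective -/
lemma residue_inj {R : Type*} [CommRing R] [IsLocalRing R] {P : Type*} [AddCommGroup P]
    [Module R P] (f : ResidueField R →ₗ[R] P) (hf : f ≠ 0) : Function.Injective f := by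
  rw [injective_iff_map_eq_zero]
  intro a ha
  by_contra hne
  apply hf
  ext y
  obtain ⟨c, hc⟩ := IsLocalRing.residue_surjective (y * a⁻¹)
  have : y = c • a := by
    rw [Algebra.smul_def, ResidueField.algebraMap_eq, hc, mul_assoc, inv_mul_cancel₀ hne, mul_one]
  simp [this, ha]

lemma depth_zero_zero (M : Type*) [AddCommGroup M] [Module A M] [Module.Finite A M] [Nontrivial M]
    (h1 : moduleDepth B (N ⊗[A] ResidueField A) = 0) (h2 : moduleDepth A M = 0) :
    moduleDepth B (N ⊗[A] M) = 0 := by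
  have := nontrivial_tensor_aux (A := A) (B := B) N M
  have := nontrivial_tensor_aux (A := A) (B := B) N (ResidueField A)
  have := finite_tensor_aux (A := A) (B := B) M N
  have := finite_tensor_aux (A := A) (B := B) (ResidueField A) N
  rw [moduleDepth_eq_zero_iff] at h1 h2 ⊢
  obtain ⟨f, hf⟩ := h1
  obtain ⟨g, hg⟩ := h2
  let g' : N ⊗[A] ResidueField A →ₗ[B] N ⊗[A] M := TensorProduct.AlgebraTensorModule.lTensor B N g
  have hg' : Function.Injective g' :=
    Module.Flat.lTensor_preserves_injective_linearMap _ (residue_inj g hg)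
  refine ⟨g' ∘ₗ f, fun h => hf ?_⟩
  ext y
  apply hg'
  simpa using LinearMap.congr_fun h y

lemma depth_finite (M : Type*) [AddCommGroup M] [Module A M] [Module.Finite A M] [Nontrivial M]
    (p q : ℕ) (h1 : moduleDepth B (N ⊗[A] ResidueField A) = p) (h2 : moduleDepth A M = q) :
    moduleDepth B (N ⊗[A] M) = p + q := by
  have cancel (d : ℕ∞) (n : ℕ) (h : d + 1 = ((n + 1 : ℕ) : ℕ∞)) : d = n := by
    push_cast at h
    exact ENat.add_left_injective_of_ne_top (n := 1) (by simp) h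
  induction q generalizing M with
  | zero =>
    induction p generalizing N with
    | zero =>
      rw [depth_zero_zero N M (by simpa using h1) (by simpa using h2)]
      simp
    | succ p ih =>
      have := finite_tensor_aux (A := A) (B := B) M N
      have := finite_tensor_aux (A := A) (B := B) (ResidueField A) N
      have := nontrivial_tensor_aux (A := A) (B := B) N M
      have := nontrivial_tensor_aux (A := A) (B := B) N (ResidueField A)
      obtain ⟨b, hb, h3, h4⟩ := ((le_moduleDepth_iff (p + 1)).mp h1.ge).exists_of_succ
      have := flat_quot (A := A) (B := B) N h3
      have := nontrivial_quotSMulTop_of_mem_maximalIdeal N hb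
      rw [moduleDepth_quot hb h3, moduleDepth_congr (tensorQuotLeft _ _ _)] at h1
      rw [moduleDepth_quot hb (regular_tensor N h3 M), moduleDepth_congr (tensorQuotLeft _ _ _),
        ih _ (cancel _ _ h1)]
      push_cast
      ring
  | succ q ih =>
    have := finite_tensor_aux (A := A) (B := B) M N
    have := nontrivial_tensor_aux (A := A) (B := B) N M
    obtain ⟨x, hx, h3, h4⟩ := ((le_moduleDepth_iff (q + 1)).mp h2.ge).exists_of_succ
    have := nontrivial_quotSMulTop_of_mem_maximalIdeal M hx
    rw [moduleDepth_quot hx h3] at h2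
    rw [moduleDepth_quot (algebraMap_mem_aux hx) (regular_tensor_right N h3),
      moduleDepth_congr (tensorQuotRight _ _ _), ih _ (cancel _ _ h2)]
    push_cast
    ring
end

/-- Let `A → B` be a local homomorphism of Noetherian local rings, `F` the residue field
of `A`, `M` a nonzero finitely generated `A`-module and `N` a nonzero finitely generated
`B`-module flat over `A`.  Then
`depth_B (N ⊗[A] M) = depth_B (N ⊗[A] F) + depth_A M`. -/
theorem depth_tensor_eq_depth_fiber_add_depth
    {A B : Type*} [CommRing A] [CommRing B] [IsNoetherianRing A] [IsNoetherianRing B]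
    [IsLocalRing A] [IsLocalRing B] [Algebra A B] [IsLocalHom (algebraMap A B)]
    (M : Type*) [AddCommGroup M] [Module A M] [Module.Finite A M] [Nontrivial M]
    (N : Type*) [AddCommGroup N] [Module A N] [Module B N] [IsScalarTower A B N]
    [Module.Finite B N] [Nontrivial N] [Module.Flat A N] :
    moduleDepth B (N ⊗[A] M) =
      moduleDepth B (N ⊗[A] ResidueField A) + moduleDepth A M := by
  have := finite_tensor_aux (A := A) (B := B) M N
  have := finite_tensor_aux (A := A) (B := B) (ResidueField A) N
  have := nontrivial_tensor_aux (A := A) (B := B) N M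
  have := nontrivial_tensor_aux (A := A) (B := B) N (ResidueField A)
  have top_of (d : ℕ∞) (h : ∀ n : ℕ, (n : ℕ∞) ≤ d) : d = ⊤ :=
    ENat.eq_top_iff_forall_ge.mpr h
  by_cases h1 : moduleDepth B (N ⊗[A] ResidueField A) = ⊤
  · rw [h1, WithTop.top_add]
    refine top_of _ fun n => (le_moduleDepth_iff n).mpr ?_
    exact hasReg_tensor N n 0 ((le_moduleDepth_iff n).mp (h1 ▸ le_top)) M hasReg_zero
  by_cases h2 : moduleDepth A M = ⊤
  · rw [h2, WithTop.add_top]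
    refine top_of _ fun n => (le_moduleDepth_iff n).mpr ?_
    rw [← zero_add n]
    exact hasReg_tensor N 0 n hasReg_zero M ((le_moduleDepth_iff n).mp (h2 ▸ le_top))
  obtain ⟨p, hp⟩ := WithTop.ne_top_iff_exists.mp h1
  obtain ⟨q, hq⟩ := WithTop.ne_top_iff_exists.mp h2
  rw [← hp, ← hq]
  exact depth_finite N M p q hp.symm hq.symm
end

section
/- Let $A \to B$ be a flat local homomorphism of Noetherian local rings such that the closed fiber $B \otimes_A F$ (where $F$ is the residue field of $A$) is Cohen–Macaulay, and let $M$ be a nonzero finitely generated $A$-module. Then $\operatorname{depth}_B(B \otimes_A M) = 0$ if and only if $\operatorname{depth}_A(M) = 0$ and $\dim B = \dim A$. -/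
open TensorProduct IsLocalRing

theorem aux_map_le (A B : Type*) [CommRing A] [CommRing B]
    [IsLocalRing A] [IsLocalRing B] [Algebra A B] [IsLocalHom (algebraMap A B)] :
    (maximalIdeal A).map (algebraMap A B) ≤ maximalIdeal B := by
  have h : IsLocalHom (algebraMap A B) := inferInstance
  exact ((local_hom_TFAE (algebraMap A B)).out 0 2 rfl rfl).1 h

theorem aux_depth_zero_iff {A : Type*} [CommRing A] [IsLocalRing A]
    (M : Type*) [AddCommGroup M] [Module A M] [Module.Finite A M] [Nontrivial M] :
    moduleDepth A M = 0 ↔ ∀ x ∈ maximalIdeal A, ¬ IsSMulRegular M x := by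
  unfold moduleDepth
  constructor
  · intro h x hx hr
    have h1 : ((1 : ℕ) : WithTop ℕ) ≤ 0 := by
      rw [← h]
      apply le_sSup
      refine ⟨[x], by simpa using hx, ?_, rfl⟩
      exact RingTheory.Sequence.IsRegular.of_isWeaklyRegular_of_mem_maximalIdeal M
        (by simpa using hx) ((RingTheory.Sequence.isWeaklyRegular_singleton_iff M x).2 hr)
    norm_num at h1
  · intro h
    rw [← nonpos_iff_eq_zero]
    apply sSup_le
    rintro n ⟨rs, hm, hr, rfl⟩
    cases rs with
    | nil => simp
    | cons r rs =>
      exact absurd ((RingTheory.Sequence.isRegular_cons_iff M r rs).1 hr).1 (h r (hm r (by simp)))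

theorem aux_exists_socle {A : Type*} [CommRing A] [IsNoetherianRing A] [IsLocalRing A]
    (M : Type*) [AddCommGroup M] [Module A M] [Module.Finite A M] [Nontrivial M]
    (h : ∀ x ∈ maximalIdeal A, ¬ IsSMulRegular M x) :
    ∃ v : M, v ≠ 0 ∧ ∀ x ∈ maximalIdeal A, x • v = 0 := by
  have h1 : ¬ Subsingleton ((A ⧸ maximalIdeal A) →ₗ[A] M) := by
    rw [IsSMulRegular.subsingleton_linearMap_iff]
    rintro ⟨r, hr, hreg⟩
    rw [Ideal.annihilator_quotient] at hr
    exact h r hr hreg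
  rw [not_subsingleton_iff_nontrivial] at h1
  obtain ⟨f, hf⟩ := exists_ne (0 : (A ⧸ maximalIdeal A) →ₗ[A] M)
  refine ⟨f 1, ?_, ?_⟩
  · intro h0
    apply hf
    ext
    simpa using h0
  · intro x hx
    rw [← map_smul]
    have : x • (1 : A ⧸ maximalIdeal A) = 0 := by
      rw [Algebra.smul_def, mul_one]
      exact Ideal.Quotient.eq_zero_iff_mem.2 hx
    rw [this, map_zero]

theorem aux_reg_vs {A B : Type*} [CommRing A] [CommRing B] [IsLocalRing A] [Algebra A B] (y : B)
    (hy : IsSMulRegular (B ⊗[A] ResidueField A) y)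
    (N : Type*) [AddCommGroup N] [Module A N]
    (hN : Module.IsTorsionBySet A N (maximalIdeal A)) :
    IsSMulRegular (B ⊗[A] N) y := by
  let : Module (ResidueField A) N := hN.module
  have : IsScalarTower A (ResidueField A) N := hN.isScalarTower
  let b := Module.Free.chooseBasis (ResidueField A) N
  let e := (b.repr.restrictScalars A).baseChange A B _ _
  let e' := TensorProduct.finsuppRight A B B (ResidueField A)
    (Module.Free.ChooseBasisIndex (ResidueField A) N)
  let e'' := e.trans e'
  refine (e''.isSMulRegular_congr y).2 ?_
  intro u v huv
  ext i : 1
  apply hy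
  exact DFunLike.congr_fun huv i

theorem aux_reg_pow {A B : Type*} [CommRing A] [CommRing B] [IsLocalRing A] [Algebra A B]
    [Module.Flat A B] (y : B)
    (hy : IsSMulRegular (B ⊗[A] ResidueField A) y) (k : ℕ) :
    ∀ (N : Type*) [AddCommGroup N] [Module A N]
    (_ : (maximalIdeal A ^ k) • (⊤ : Submodule A N) = ⊥),
    IsSMulRegular (B ⊗[A] N) y := by
  induction k with
  | zero =>
    intro N _ _ hN
    rw [pow_zero, Ideal.one_eq_top, Submodule.top_smul] at hN
    have : Subsingleton N := by
      rw [← Submodule.subsingleton_iff A]; exact subsingleton_of_bot_eq_top hN.symm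
    have : Subsingleton (B ⊗[A] N) := inferInstance
    intro u v _
    exact Subsingleton.elim _ _
  | succ k ih =>
    intro N _ _ hN
    let P : Submodule A N := maximalIdeal A • ⊤
    have h1 : IsSMulRegular (B ⊗[A] P) y := by
      apply ih
      apply Submodule.map_injective_of_injective P.injective_subtype
      rw [Submodule.map_smul'', Submodule.map_top, Submodule.range_subtype, Submodule.map_bot,
        ← hN, pow_succ, Submodule.mul_smul]
    have h2 : IsSMulRegular (B ⊗[A] (N ⧸ P)) y := by
      apply aux_reg_vs y hy
      rintro x ⟨a, ha⟩
      obtain ⟨x, rfl⟩ := P.mkQ_surjective x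
      change a • P.mkQ x = 0
      rw [← map_smul]
      exact (Submodule.Quotient.mk_eq_zero P).2 (Submodule.smul_mem_smul ha trivial)
    refine isSMulRegular_of_range_eq_ker (f := P.subtype.baseChange B) (g := P.mkQ.baseChange B)
      ?_ ?_ h1 h2
    · exact Module.Flat.lTensor_preserves_injective_linearMap _ P.injective_subtype
    · have := Module.Flat.lTensor_exact B (LinearMap.exact_subtype_mkQ P)
      ext z
      exact (this z).symm

theorem aux_reg {A B : Type*} [CommRing A] [CommRing B] [IsNoetherianRing B]
    [IsLocalRing A] [IsLocalRing B] [Algebra A B] [IsLocalHom (algebraMap A B)]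
    [Module.Flat A B] (y : B)
    (hy : IsSMulRegular (B ⊗[A] ResidueField A) y)
    (M : Type*) [AddCommGroup M] [Module A M] [Module.Finite A M] :
    IsSMulRegular (B ⊗[A] M) y := by
  rw [isSMulRegular_iff_right_eq_zero_of_smul (R := B) (M := B ⊗[A] M)]
  intro z hz
  have hne : (maximalIdeal A).map (algebraMap A B) ≠ ⊤ :=
    ne_top_of_le_ne_top (Ideal.IsPrime.ne_top inferInstance)
      (aux_map_le A B)
  rw [← Submodule.mem_bot B, ← Ideal.iInf_pow_smul_eq_bot_of_isLocalRing (M := B ⊗[A] M) _ hne,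
    Submodule.mem_iInf]
  intro k
  rw [← Ideal.map_pow]
  refine (isSMulRegular_quotient_iff_mem_of_smul_mem _ y).1 ?_ z (by rw [hz]; exact zero_mem _)
  refine ((TensorProduct.tensorQuotMapSMulEquivTensorQuot M B _).isSMulRegular_congr y).2 ?_
  apply aux_reg_pow y hy k
  rw [eq_bot_iff, Submodule.smul_le]
  rintro r hr x -
  obtain ⟨x, rfl⟩ := Submodule.mkQ_surjective _ x
  rw [Submodule.mem_bot, ← map_smul]
  exact (Submodule.Quotient.mk_eq_zero _).2 (Submodule.smul_mem_smul hr trivial)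

theorem aux_dim {A B : Type*} [CommRing A] [CommRing B] [IsNoetherianRing A] [IsNoetherianRing B]
    [IsLocalRing A] [IsLocalRing B] [Algebra A B] [IsLocalHom (algebraMap A B)]
    [Module.Flat A B] :
    ringKrullDim B = ringKrullDim A ↔
      ringKrullDim (B ⧸ (maximalIdeal A).map (algebraMap A B)) = 0 := by
  have hne : (maximalIdeal A).map (algebraMap A B) ≠ ⊤ :=
    ne_top_of_le_ne_top (Ideal.IsPrime.ne_top inferInstance)
      (aux_map_le A B)
  have : Nontrivial (B ⧸ (maximalIdeal A).map (algebraMap A B)) :=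
    Ideal.Quotient.nontrivial_iff.2 hne
  have : IsLocalRing (B ⧸ (maximalIdeal A).map (algebraMap A B)) :=
    IsLocalRing.of_surjective' _ Ideal.Quotient.mk_surjective
  have hmap : (maximalIdeal B).map (Ideal.Quotient.mk ((maximalIdeal A).map (algebraMap A B)))
      = maximalIdeal _ := 
    IsLocalRing.map_maximalIdeal_of_surjective _ Ideal.Quotient.mk_surjective
  have key := Ideal.height_eq_height_add_of_liesOver_of_hasGoingDown (maximalIdeal A)
    (maximalIdeal B)
  rw [hmap] at key
  rw [← maximalIdeal_height_eq_ringKrullDim, ← maximalIdeal_height_eq_ringKrullDim,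
    ← maximalIdeal_height_eq_ringKrullDim, key]
  have hfin : (maximalIdeal A).height ≠ ⊤ := Ideal.height_ne_top (Ideal.IsPrime.ne_top inferInstance)
  generalize (maximalIdeal A).height = a at *
  generalize (maximalIdeal (B ⧸ (maximalIdeal A).map (algebraMap A B))).height = b at *
  norm_cast
  lift a to ℕ using hfin
  constructor
  · intro h
    cases b with
    | top => simp at h
    | coe b => norm_cast at h ⊢; omega
  · rintro rfl; simp

theorem depth_baseChange_zero_iff_of_CM_fiber
    {A B : Type*} [CommRing A] [CommRing B] [IsNoetherianRing A] [IsNoetherianRing B]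
    [IsLocalRing A] [IsLocalRing B] [Algebra A B] [IsLocalHom (algebraMap A B)]
    [Module.Flat A B]
    (hCM : (moduleDepth B (B ⊗[A] ResidueField A) : WithBot (WithTop ℕ)) =
      moduleDim B (B ⊗[A] ResidueField A))
    (M : Type*) [AddCommGroup M] [Module A M] [Module.Finite A M] [Nontrivial M] :
    moduleDepth B (B ⊗[A] M) = 0 ↔
      moduleDepth A M = 0 ∧ ringKrullDim B = ringKrullDim A := by
  have : Module.FaithfullyFlat A B := Module.FaithfullyFlat.of_flat_of_isLocalHom
  have hann : Module.annihilator B (B ⊗[A] ResidueField A) =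
      (maximalIdeal A).map (algebraMap A B) := by
    refine (Algebra.TensorProduct.quotIdealMapEquivTensorQuot B
      (maximalIdeal A)).toLinearEquiv.annihilator_eq.symm.trans ?_
    rw [Ideal.annihilator_quotient]
  have hfA : Module.Finite A (ResidueField A) := 
    inferInstanceAs (Module.Finite A (A ⧸ maximalIdeal A))
  rw [aux_depth_zero_iff, aux_depth_zero_iff, aux_dim]
  constructor
  · intro h
    constructor
    · intro x hx hreg
      refine h (algebraMap A B x)
        (aux_map_le A B
          (Ideal.mem_map_of_mem _ hx)) ?_
      have := hreg.lTensor B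
      intro u v huv
      apply this
      simpa [algebraMap_smul] using huv
    · have hz : moduleDepth B (B ⊗[A] ResidueField A) = 0 := by
        rw [aux_depth_zero_iff]
        intro y hy hreg
        exact h y hy (aux_reg y hreg M)
      rw [hz, moduleDim, hann] at hCM
      exact hCM.symm
  · rintro ⟨h, hd⟩ y hy hreg
    obtain ⟨v, hv, hmv⟩ := aux_exists_socle M h
    have hle : (maximalIdeal A).map (algebraMap A B) ≤
        Ideal.torsionOf B (B ⊗[A] M) ((1 : B) ⊗ₜ[A] v) := by
      rw [Ideal.map_le_iff_le_comap]
      intro x hx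
      rw [Ideal.mem_comap, Ideal.mem_torsionOf_iff, algebraMap_smul, ← TensorProduct.tmul_smul,
        hmv x hx, TensorProduct.tmul_zero]
    have hne : (maximalIdeal A).map (algebraMap A B) ≠ ⊤ :=
      ne_top_of_le_ne_top (Ideal.IsPrime.ne_top inferInstance)
        (aux_map_le A B)
    have : Nontrivial (B ⧸ (maximalIdeal A).map (algebraMap A B)) :=
      Ideal.Quotient.nontrivial_iff.2 hne
    have : IsLocalRing (B ⧸ (maximalIdeal A).map (algebraMap A B)) :=
      IsLocalRing.of_surjective' _ Ideal.Quotient.mk_surjective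
    have h0 : Ring.KrullDimLE 0 (B ⧸ (maximalIdeal A).map (algebraMap A B)) :=
      ringKrullDimZero_iff_ringKrullDim_eq_zero.2 hd
    have hnil := ((Ring.krullDimLE_zero_and_isLocalRing_tfae
      (B ⧸ (maximalIdeal A).map (algebraMap A B))).out 0 2 rfl rfl).1 ⟨h0, this⟩ (Ideal.Quotient.mk _ y)
    have hnu : ¬ IsUnit (Ideal.Quotient.mk ((maximalIdeal A).map (algebraMap A B)) y) := by
      rw [← mem_nonunits_iff, ← mem_maximalIdeal,
        ← IsLocalRing.map_maximalIdeal_of_surjective _ Ideal.Quotient.mk_surjective]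
      exact Ideal.mem_map_of_mem _ hy
    obtain ⟨n, hn⟩ := hnil.2 hnu
    rw [← map_pow, Ideal.Quotient.eq_zero_iff_mem] at hn
    have h1 : y ^ n • ((1 : B) ⊗ₜ[A] v) = 0 := (Ideal.mem_torsionOf_iff _ _).1 (hle hn)
    have h2 := (hreg.pow n).right_eq_zero_of_smul h1
    apply hv
    apply Module.FaithfullyFlat.tensorProduct_mk_injective (A := A) (B := B) M
    simpa using h2
end

section
/- Let $A \to B$ be a smooth ring homomorphism such that every fiber of $\operatorname{Spec} B \to \operatorname{Spec} A$ is geometrically irreducible of the same dimension $n$. Then $B$ is free as an $A$-module. -/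
namespace RG
universe u
open TensorProduct
def Dom {A P : Type u} [CommRing A] [AddCommGroup P] [Module A P] {n k : ℕ}
    (v : (Fin n → A) →ₗ[A] (Fin k → A)) (w : (Fin k → A) →ₗ[A] P) : Prop :=
  ∀ (k' : ℕ) (t : (Fin k → A) →ₗ[A] (Fin k' → A)) (w' : (Fin k' → A) →ₗ[A] P),
    w = w' ∘ₗ t → ∀ φ : (Fin k → A) →ₗ[A] A, ∃ φ' : (Fin k' → A) →ₗ[A] A, φ' ∘ₗ t ∘ₗ v = φ ∘ₗ v

theorem dom_step {A P : Type u} [CommRing A] [AddCommGroup P] [Module A P] [IsNoetherianRing A]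
    [Module.Flat A P]
    (hdom : ∀ (n : ℕ) (u : (Fin n → A) →ₗ[A] P), ∃ (k : ℕ) (v : (Fin n → A) →ₗ[A] (Fin k → A))
      (w : (Fin k → A) →ₗ[A] P), u = w ∘ₗ v ∧ Dom v w)
    (x : P) (n : ℕ) (u : (Fin n → A) →ₗ[A] P) :
    ∃ (k : ℕ) (v : (Fin n → A) →ₗ[A] (Fin k → A))
      (w : (Fin k → A) →ₗ[A] P), u = w ∘ₗ v ∧ Dom v w ∧ x ∈ LinearMap.range w ∧
        LinearMap.ker u ≤ LinearMap.ker v := by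
  let u' : (Fin (n+1) → A) →ₗ[A] P :=
    u ∘ₗ (LinearMap.funLeft A A Fin.castSucc) + (LinearMap.toSpanSingleton A P x) ∘ₗ (LinearMap.proj (Fin.last n))
  let inc : (Fin n → A) →ₗ[A] (Fin (n+1) → A) :=
    LinearMap.pi (Fin.lastCases 0 (fun i => LinearMap.proj i))
  have hinc : u' ∘ₗ inc = u := by
    ext i
    simp [u', inc]
    congr 1
    ext j
    simp
  obtain ⟨k, v', w', h1, h2⟩ := hdom (n+1) u'
  obtain ⟨K, hK1, hK2, hK3, hK4⟩ : ∃ (k' : ℕ) (t : (Fin k → A) →ₗ[A] (Fin k' → A)) (w : (Fin k' → A) →ₗ[A] P),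
      w' = w ∘ₗ t ∧ LinearMap.ker w' ≤ LinearMap.ker t := by
    obtain ⟨κ, a, y, h3, h4⟩ := Module.Flat.exists_factorization_of_comp_eq_zero_of_free (R := A)
      (f := (LinearMap.ker w').subtype) (x := w') (by ext z; simp)
    refine ⟨κ, (Finsupp.linearEquivFunOnFinite A A (Fin κ)).toLinearMap ∘ₗ a, y ∘ₗ (Finsupp.linearEquivFunOnFinite A A (Fin κ)).symm.toLinearMap, ?_, ?_⟩
    · rw [h3]; ext; simp
    · intro z hz
      have := LinearMap.congr_fun h4 ⟨z, hz⟩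
      simpa using this
  refine ⟨K, hK1 ∘ₗ v' ∘ₗ inc, hK2, ?_, ?_, ?_, ?_⟩
  · rw [← hinc, h1, hK3]; rfl
  · intro k'' t'' w'' h φ
    obtain ⟨φ', h'⟩ := h2 k'' (t'' ∘ₗ hK1) w'' (by rw [hK3, h]; rfl) (φ ∘ₗ hK1)
    refine ⟨φ', ?_⟩
    ext z
    exact LinearMap.congr_fun h' (inc (LinearMap.single A (fun _ => A) z 1))
  · have : x = u' (Pi.single (Fin.last n) 1) := by
      simp [u']
      have : (LinearMap.funLeft A A (Fin.castSucc (n := n))) (Pi.single (Fin.last n) 1) = 0 := by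
        ext i
        simp [LinearMap.funLeft_apply]
      rw [this]; simp
    rw [this, h1, hK3]
    exact ⟨_, rfl⟩
  · intro z hz
    have : w' (v' (inc z)) = 0 := by
      rw [← hinc, h1] at hz; exact hz
    exact hK4 this

theorem lift_step {A P N : Type u} [CommRing A] [AddCommGroup P] [Module A P] [AddCommGroup N] [Module A N]
    (π : N →ₗ[A] P) (hπ : Function.Surjective π) {a b c : ℕ}
    (v : (Fin a → A) →ₗ[A] (Fin b → A)) (w : (Fin b → A) →ₗ[A] P) (hd : Dom v w)
    (v2 : (Fin b → A) →ₗ[A] (Fin c → A)) (w2 : (Fin c → A) →ₗ[A] P) (hw : w = w2 ∘ₗ v2)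
    (h : (Fin b → A) →ₗ[A] N) (hh : π ∘ₗ h = w) :
    ∃ h2 : (Fin c → A) →ₗ[A] N, π ∘ₗ h2 = w2 ∧ h2 ∘ₗ v2 ∘ₗ v = h ∘ₗ v := by
  obtain ⟨h0, hh0⟩ := Module.projective_lifting_property π w2 hπ
  let δ0 := h0 ∘ₗ v2 - h
  have hδ0 : ∀ z, π (δ0 z) = 0 := by
    intro z
    have e1 := LinearMap.congr_fun hh0 (v2 z)
    have e2 := LinearMap.congr_fun hh z
    have e3 := LinearMap.congr_fun hw z
    simp [δ0] at *
    rw [e1, e2, e3]; simp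
  choose φ' hφ' using fun j : Fin b => hd c v2 w2 hw (LinearMap.proj j)
  let δ : (Fin c → A) →ₗ[A] N := ∑ j, (LinearMap.toSpanSingleton A N (δ0 (Pi.single j 1))) ∘ₗ (φ' j)
  refine ⟨h0 - δ, ?_, ?_⟩
  · rw [LinearMap.comp_sub, hh0]
    ext z
    simp [δ, hδ0]
  · have : δ ∘ₗ v2 ∘ₗ v = δ0 ∘ₗ v := by
      apply LinearMap.ext
      intro z
      have : δ0 (v z) = ∑ j, (v z j) • δ0 (Pi.single j 1) := by
        conv_lhs => rw [pi_eq_sum_univ' (v z)]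
        rw [map_sum]
        refine Finset.sum_congr rfl fun j _ => ?_
        rw [map_smul]
      simp only [LinearMap.comp_apply, this, δ, LinearMap.sum_apply, LinearMap.toSpanSingleton_apply]
      refine Finset.sum_congr rfl fun j _ => ?_
      have := LinearMap.congr_fun (hφ' j) z
      simp at this
      rw [this]
    rw [LinearMap.sub_comp, this]
    ext z
    simp [δ0]

theorem proj_of_dom {A P : Type u} [CommRing A] [AddCommGroup P] [Module A P] [IsNoetherianRing A]
    [Module.Flat A P] (x : ℕ → P) (hx : Submodule.span A (Set.range x) = ⊤)
    (hdom : ∀ (n : ℕ) (u : (Fin n → A) →ₗ[A] P), ∃ (k : ℕ) (v : (Fin n → A) →ₗ[A] (Fin k → A))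
      (w : (Fin k → A) →ₗ[A] P), u = w ∘ₗ v ∧ Dom v w) : Module.Projective A P := by
  choose K V W h1 h2 h3 h4 using dom_step hdom
  let St := Σ n : ℕ, ((Fin n → A) →ₗ[A] P)
  let st : ℕ → St := fun i => Nat.rec (motive := fun _ => St) ⟨0, 0⟩ (fun i s => ⟨K (x i) s.1 s.2, W (x i) s.1 s.2⟩) i
  let v : ∀ i, (Fin (st i).1 → A) →ₗ[A] (Fin (st (i+1)).1 → A) := fun i => V (x i) (st i).1 (st i).2
  have g1 : ∀ i, (st i).2 = (st (i+1)).2 ∘ₗ v i := fun i => h1 (x i) (st i).1 (st i).2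
  have g2 : ∀ i, Dom (v i) (st (i+1)).2 := fun i => h2 (x i) (st i).1 (st i).2
  have g3 : ∀ i, x i ∈ LinearMap.range (st (i+1)).2 := fun i => h3 (x i) (st i).1 (st i).2
  have g4 : ∀ i, LinearMap.ker (st i).2 ≤ LinearMap.ker (v i) := fun i => h4 (x i) (st i).1 (st i).2
  obtain ⟨N, _, _, _, π, hπ⟩ : ∃ (N : Type u) (_ : AddCommGroup N) (_ : Module A N)
      (_ : Module.Free A N) (π : N →ₗ[A] P), Function.Surjective π :=
    ⟨P →₀ A, inferInstance, inferInstance, inferInstance, Finsupp.linearCombination A id,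
      Finsupp.linearCombination_id_surjective A P⟩
  have hl := fun i (h : {h : (Fin (st (i+1)).1 → A) →ₗ[A] N // π ∘ₗ h = (st (i+1)).2}) =>
    lift_step π hπ (v i) _ (g2 i) (v (i+1)) _ (g1 (i+1)) h.1 h.2
  choose nh nh1 nh2 using hl
  obtain ⟨h0, hh0⟩ := Module.projective_lifting_property π (st 1).2 hπ
  let h : ∀ i, {h : (Fin (st (i+1)).1 → A) →ₗ[A] N // π ∘ₗ h = (st (i+1)).2} := fun i =>
    Nat.rec (motive := fun i => {h : (Fin (st (i+1)).1 → A) →ₗ[A] N // π ∘ₗ h = (st (i+1)).2})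
      ⟨h0, hh0⟩ (fun i h => ⟨nh i h, nh1 i h⟩) i
  have hh : ∀ i, (h (i+1)).1 ∘ₗ v (i+1) ∘ₗ v i = (h i).1 ∘ₗ v i := fun i => nh2 i (h i)
  let g : ∀ i, (Fin (st i).1 → A) →ₗ[A] N := fun i => (h i).1 ∘ₗ v i
  have hg : ∀ i, g (i+1) ∘ₗ v i = g i := fun i => hh i
  have hg2 : ∀ i, π ∘ₗ g i = (st i).2 := fun i => by
    rw [g1 i, ← (h i).2]; rfl
  let Γ : ℕ → Submodule A (P × N) := fun i => LinearMap.range ((st i).2.prod (g i))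
  have hmono : Monotone Γ := by
    apply monotone_nat_of_le_succ
    rintro i _ ⟨z, rfl⟩
    refine ⟨v i z, ?_⟩
    have e1 := LinearMap.congr_fun (g1 i) z
    have e2 := LinearMap.congr_fun (hg i) z
    simp at e1 e2 ⊢
    exact ⟨e1.symm, e2⟩
  have hmem : ∀ q, q ∈ (⨆ i, Γ i) → ∃ i, q ∈ Γ i := fun q hq =>
    (Submodule.mem_iSup_of_directed _ hmono.directed_le).1 hq
  let G := ⨆ i, Γ i
  let f : G →ₗ[A] P := LinearMap.fst A P N ∘ₗ G.subtype
  have fbij : Function.Bijective f := by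
    constructor
    · rw [← LinearMap.ker_eq_bot, LinearMap.ker_eq_bot']
      rintro ⟨q, hq⟩ h0
      obtain ⟨i, z, rfl⟩ := hmem q hq
      have h4' : (st i).2 z = 0 := h0
      have h5 : v i z = 0 := g4 i h4'
      have h6 : g i z = 0 := by simp [g, h5]
      exact Subtype.ext (Prod.ext h4' h6)
    · rw [← LinearMap.range_eq_top, eq_top_iff, ← hx, Submodule.span_le]
      rintro _ ⟨i, rfl⟩
      obtain ⟨z, hz⟩ := g3 i
      refine ⟨⟨((st (i+1)).2.prod (g (i+1))) z, ?_⟩, ?_⟩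
      · exact Submodule.mem_iSup_of_mem (i+1) ⟨z, rfl⟩
      · simpa [f] using hz
  let e := LinearEquiv.ofBijective f fbij
  refine Module.Projective.of_split (M := N) (LinearMap.snd A P N ∘ₗ G.subtype ∘ₗ e.symm.toLinearMap) π ?_
  apply LinearMap.ext
  intro p
  obtain ⟨q, rfl⟩ := e.surjective p
  obtain ⟨q, hq⟩ := q
  obtain ⟨i, z, rfl⟩ := hmem q hq
  have := LinearMap.congr_fun (hg2 i) z
  simp only [LinearMap.comp_apply, LinearEquiv.coe_coe, LinearEquiv.symm_apply_apply]
  exact this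

end RG

namespace RG
universe u
open TensorProduct
theorem dom_of_ops {A B : Type u} [CommRing A] [CommRing B] [Algebra A B] [Module.FaithfullyFlat A B]
    (Θ : Set (B →ₗ[A] B))
    (U : ∀ (M : Type u) [AddCommGroup M] [Module B M] [Module A M] [IsScalarTower A B M]
      [Module.Finite B M] (n : ℕ) (m : Fin n → M) (b : Fin n → B),
      (∀ θ ∈ Θ, ∑ l, θ (b l) • m l = 0) → ∑ l, m l ⊗ₜ[A] b l = 0)
    (n : ℕ) (u : (Fin n → A) →ₗ[A] B) : ∃ (k : ℕ) (v : (Fin n → A) →ₗ[A] (Fin k → A))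
      (w : (Fin k → A) →ₗ[A] B), u = w ∘ₗ v ∧ Dom v w := by
  classical
  let p : Fin n → B := fun j => u (Pi.single j 1)
  let S : Submodule B (Fin n → B) := Submodule.span B ((fun θ : B →ₗ[A] B => fun j => θ (p j)) '' Θ)
  have hsum : ∀ b : Fin n → B, ∑ j, b j • S.mkQ (Pi.single j 1) = S.mkQ b := by
    intro b
    simp_rw [← map_smul]
    rw [← map_sum]
    congr 1
    conv_rhs => rw [pi_eq_sum_univ' b]
  have hz := U ((Fin n → B) ⧸ S) n (fun j => S.mkQ (Pi.single j 1)) p (by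
    intro θ hθ
    rw [hsum]
    simp only [Submodule.mkQ_apply, Submodule.Quotient.mk_eq_zero]
    exact Submodule.subset_span ⟨θ, hθ, rfl⟩)
  have hv := TensorProduct.vanishesTrivially_of_sum_tmul_eq_zero_of_rTensor_injective A
    (Module.Flat.rTensor_preserves_injective_linearMap _ (Submodule.subtype_injective _)) hz
  obtain ⟨k, a, y, h1, h2⟩ := hv
  let v : (Fin n → A) →ₗ[A] (Fin k → A) := LinearMap.pi (fun c => ∑ j, a j c • LinearMap.proj j)
  let w : (Fin k → A) →ₗ[A] B := ∑ c, (LinearMap.toSpanSingleton A B (y c)) ∘ₗ LinearMap.proj c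
  have hva : ∀ j c, v (Pi.single j 1) c = a j c := by
    intro j c
    simp [v, Pi.single_apply]
  refine ⟨k, v, w, ?_, ?_⟩
  · ext j
    have := h1 j
    simp only [LinearMap.comp_apply, LinearMap.single_apply]
    change p j = _
    rw [this]
    simp only [w, LinearMap.sum_apply, LinearMap.comp_apply, LinearMap.proj_apply, hva, LinearMap.toSpanSingleton_apply]
  intro k' t w' hw φ
  let N : Submodule A (Fin n → A) := LinearMap.range
    (LinearMap.pi (fun j => LinearMap.applyₗ (R := A) (M₂ := A) ((t ∘ₗ v) (Pi.single j 1))))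
  let xφ : Fin n → A := fun j => φ (v (Pi.single j 1))
  let Ψ : (Fin n → B) →ₗ[B] (B ⊗[A] ((Fin n → A) ⧸ N)) :=
    ∑ j, (LinearMap.toSpanSingleton B _ (1 ⊗ₜ N.mkQ (Pi.single j 1))) ∘ₗ LinearMap.proj j
  have hΨ : ∀ x : Fin n → A, Ψ (fun j => algebraMap A B (x j)) = 1 ⊗ₜ N.mkQ x := by
    intro x
    have : N.mkQ x = ∑ j, x j • N.mkQ (Pi.single j 1) := by
      simp_rw [← map_smul]
      rw [← map_sum]
      congr 1
      conv_lhs => rw [pi_eq_sum_univ' x]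
    rw [this, TensorProduct.tmul_sum]
    simp only [Ψ, LinearMap.sum_apply, LinearMap.comp_apply, LinearMap.proj_apply, LinearMap.toSpanSingleton_apply]
    refine Finset.sum_congr rfl fun j _ => ?_
    rw [TensorProduct.tmul_smul, algebraMap_smul]
  have hS : S ≤ LinearMap.ker Ψ := by
    rw [Submodule.span_le]
    rintro _ ⟨θ, hθ, rfl⟩
    have : (fun j => θ (p j)) = ∑ d : Fin k', θ (w' (Pi.single d 1)) •
        (fun j => algebraMap A B ((t (v (Pi.single j 1))) d)) := by
      ext j
      have hp : p j = w' (t (v (Pi.single j 1))) := by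
        have := h1 j
        change _ = (w' ∘ₗ t) _
        rw [← hw, this]
        simp only [w, LinearMap.sum_apply, LinearMap.comp_apply, LinearMap.proj_apply, hva, LinearMap.toSpanSingleton_apply]
      rw [hp]
      conv_lhs => rw [pi_eq_sum_univ' (t (v (Pi.single j 1)))]
      simp only [map_sum, map_smul, Finset.sum_apply, Pi.smul_apply, smul_eq_mul]
      exact Finset.sum_congr rfl fun c _ => by rw [Algebra.smul_def, mul_comm]
    simp only [SetLike.mem_coe, LinearMap.mem_ker]
    rw [this, map_sum]
    refine Finset.sum_eq_zero fun d _ => ?_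
    rw [map_smul, hΨ (fun j => (t (v (Pi.single j 1))) d)]
    have : N.mkQ (fun j => (t (v (Pi.single j 1))) d) = 0 := by
      simp only [Submodule.mkQ_apply, Submodule.Quotient.mk_eq_zero]
      exact ⟨LinearMap.proj d, by ext j; simp⟩
    rw [this]; simp
  have hxS : (fun j => algebraMap A B (xφ j)) ∈ S := by
    have : (fun j => algebraMap A B (xφ j)) = ∑ c, (algebraMap A B (φ (Pi.single c 1))) •
        (fun j => algebraMap A B (a j c)) := by
      ext j
      simp only [xφ]
      conv_lhs => rw [pi_eq_sum_univ' (v (Pi.single j 1))]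
      simp only [hva, map_sum, map_smul, Finset.sum_apply, Pi.smul_apply, smul_eq_mul, map_mul]
      exact Finset.sum_congr rfl fun c _ => by rw [mul_comm]
    rw [this]
    refine Submodule.sum_mem _ fun c _ => Submodule.smul_mem _ _ ?_
    have := h2 c
    rw [← Submodule.Quotient.mk_eq_zero, ← Submodule.mkQ_apply, ← hsum]
    rw [← this]
    simp
  have h0 := hS hxS
  rw [LinearMap.mem_ker, hΨ] at h0
  have h3 : N.mkQ xφ = 0 := Module.FaithfullyFlat.tensorProduct_mk_injective (A := A) (B := B) _ (by simpa using h0)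
  simp only [Submodule.mkQ_apply, Submodule.Quotient.mk_eq_zero] at h3
  obtain ⟨φ', h4⟩ := h3
  refine ⟨φ', ?_⟩
  ext j
  exact congrFun h4 j

end RG

namespace RG
universe u
open TensorProduct
theorem unip_bij {B Q : Type u} [CommRing B] [CommRing Q] [Algebra B Q] (J : Ideal Q) (k : ℕ) (hJ : J ^ k = ⊥)
    (τ : Q →ₐ[B] Q) (hτ : ∀ q, τ q - q ∈ J ^ 2) : Function.Bijective τ := by
  have hJJ : ∀ q ∈ J, τ q ∈ J := fun q hq => by
    have := J.add_mem (Ideal.pow_le_self two_ne_zero (hτ q)) hq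
    simpa using this
  have key : ∀ j, ∀ q ∈ J ^ j, τ q - q ∈ J ^ (j+1) := by
    intro j
    induction j with
    | zero => intro q _; simpa using Ideal.pow_le_self two_ne_zero (hτ q)
    | succ j ih =>
      intro q hq
      rw [pow_succ] at hq
      refine Submodule.mul_induction_on hq ?_ ?_
      · intro a ha b hb
        have : τ (a * b) - a * b = (τ a - a) * τ b + a * (τ b - b) := by rw [map_mul]; ring
        rw [this]
        refine Ideal.add_mem _ ?_ ?_
        · rw [pow_succ]
          exact Ideal.mul_mem_mul (ih a ha) (hJJ b hb)
        · have := Ideal.mul_mem_mul ha (hτ b)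
          rwa [← pow_add] at this
      · intro x y hx hy
        have : τ (x + y) - (x + y) = (τ x - x) + (τ y - y) := by rw [map_add]; ring
        rw [this]; exact Ideal.add_mem _ hx hy
  let ν : Module.End B Q := τ.toLinearMap - 1
  have hν : ∀ j q, (ν ^ j) q ∈ J ^ j := by
    intro j
    induction j with
    | zero => intro q; simp
    | succ j ih =>
      intro q
      rw [pow_succ' ν]
      exact key j _ (ih q)
  have hnil : IsNilpotent ν := ⟨k, by ext q; have := hν k q; rw [hJ] at this; simpa using this⟩
  have hu := hnil.isUnit_add_one
  have : ν + 1 = τ.toLinearMap := by simp [ν]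
  rw [this, Module.End.isUnit_iff] at hu
  exact hu

theorem trunc {B : Type u} [CommRing B] (r k : ℕ) : ∃ (ι : Type) (_ : Fintype ι)
    (co : ι → (MvPolynomial (Fin r) B ⧸ (MvPolynomial.idealOfVars (Fin r) B)^k) →ₗ[B] B)
    (m : ι → (MvPolynomial (Fin r) B ⧸ (MvPolynomial.idealOfVars (Fin r) B)^k)),
    ∀ q, q = ∑ i, co i q • m i := by
  classical
  let S : Set (Fin r →₀ ℕ) := {m | m.degree < k}
  have : Finite S := (Finsupp.finite_of_degree_le (σ := Fin r) k).subset (fun m hm => le_of_lt (show m.degree < k from hm))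
  have : Fintype S := Fintype.ofFinite S
  let Ik : Ideal (MvPolynomial (Fin r) B) := (MvPolynomial.idealOfVars (Fin r) B)^k
  refine ⟨S, this, fun i => (Ik.restrictScalars B).liftQ (MvPolynomial.lcoeff B i.1) ?_, fun i => Ideal.Quotient.mk _ (MvPolynomial.monomial i.1 1), ?_⟩
  · intro p hp
    have := (MvPolynomial.mem_pow_idealOfVars_iff' k p).1 hp
    exact this _ i.2
  · intro q
    obtain ⟨p, rfl⟩ := Ideal.Quotient.mk_surjective q
    have h1 : p - ∑ i : S, (p.coeff i.1) • MvPolynomial.monomial i.1 (1:B) ∈ Ik := by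
      rw [MvPolynomial.mem_pow_idealOfVars_iff']
      intro x hx
      rw [MvPolynomial.coeff_sub, MvPolynomial.coeff_sum, Finset.sum_eq_single (⟨x, hx⟩ : S)]
      · simp
      · intro b _ hb
        have : b.1 ≠ x := fun h => hb (Subtype.ext h)
        simp [MvPolynomial.coeff_monomial, this]
      · simp
    have h2 := Ideal.Quotient.eq.2 h1
    refine h2.trans ?_
    rw [map_sum]
    refine Finset.sum_congr rfl fun i _ => ?_
    rw [← Ideal.Quotient.mkₐ_eq_mk B, map_smul]
    rfl

theorem sq_hom {A B Q : Type u} [CommRing A] [CommRing B] [Algebra A B] [CommRing Q] [Algebra B Q]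
    [Algebra A Q] [IsScalarTower A B Q] {r : ℕ} (x : Fin r → Q) (hx : ∀ i j, x i * x j = 0)
    (D : Fin r → Derivation A B B) :
    ∃ σ : B →ₐ[A] Q, ∀ z, σ z = algebraMap B Q z + ∑ i, algebraMap B Q (D i z) * x i := by
  let l : B →ₗ[A] Q := (Algebra.linearMap B Q).restrictScalars A + ∑ i,
      (LinearMap.toSpanSingleton B Q (x i)).restrictScalars A ∘ₗ (D i).toLinearMap
  have e : ∀ z, l z = algebraMap B Q z + ∑ i, algebraMap B Q (D i z) * x i := by
    intro z; simp [l, Algebra.smul_def]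
  refine ⟨AlgHom.ofLinearMap l ?_ ?_, e⟩
  · rw [e]; simp
  intro y z
  rw [e, e, e]
  have : (∑ i, algebraMap B Q (D i y) * x i) * (∑ i, algebraMap B Q (D i z) * x i) = 0 := by
    rw [Finset.sum_mul_sum]
    refine Finset.sum_eq_zero fun i _ => Finset.sum_eq_zero fun j _ => ?_
    rw [mul_mul_mul_comm, hx, mul_zero]
  rw [add_mul, mul_add, mul_add, this]
  simp only [Derivation.leibniz, map_add, map_mul, smul_eq_mul, add_mul, Finset.sum_add_distrib, Finset.mul_sum, Finset.sum_mul]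
  rw [add_zero, add_assoc]
  congr 2
  · exact Finset.sum_congr rfl fun i _ => by ring
  · exact Finset.sum_congr rfl fun i _ => by ring

set_option maxHeartbeats 1000000 in
theorem exists_ops {A B : Type u} [CommRing A] [CommRing B] [Algebra A B] [Algebra.Smooth A B] (k : ℕ) (hk : 2 ≤ k) :
    ∃ (ι : Type) (_ : Fintype ι) (θ : ι → (B →ₗ[A] B)) (c : ι → B ⊗[A] B),
      ∀ b : B, (1 : B) ⊗ₜ[A] b - ∑ i, (θ i b ⊗ₜ[A] (1:B)) * c i ∈ (KaehlerDifferential.ideal A B) ^ k := by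
  classical
  let I := KaehlerDifferential.ideal A B
  obtain ⟨r, f, hf⟩ := Module.Finite.exists_fin' B (Ω[B⁄A])
  obtain ⟨s, hs⟩ := Module.projective_lifting_property f LinearMap.id hf
  choose g hg using fun i : Fin r => I.toCotangent_surjective (f (Pi.single i 1))
  let D : Fin r → Derivation A B B := fun i => ((LinearMap.proj i) ∘ₗ s).compDer (KaehlerDifferential.D A B)
  let X : Ideal (MvPolynomial (Fin r) B) := MvPolynomial.idealOfVars (Fin r) B
  have hX : ∀ i, MvPolynomial.X i ∈ X := fun i => Ideal.subset_span ⟨i, rfl⟩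
  have hD : ∀ b : B, (1 : B) ⊗ₜ[A] b - b ⊗ₜ[A] 1 - ∑ i, (D i b ⊗ₜ[A] 1) * (g i : (B ⊗[A] B)) ∈ I ^ 2 := by
    intro b
    have h1 : KaehlerDifferential.D A B b = f (s (KaehlerDifferential.D A B b)) :=
      (LinearMap.congr_fun hs _).symm
    have h2 : f (s (KaehlerDifferential.D A B b)) = I.toCotangent (∑ i, (D i b ⊗ₜ[A] (1:B)) • g i) := by
      conv_lhs => rw [pi_eq_sum_univ' (s (KaehlerDifferential.D A B b))]
      rw [map_sum, map_sum]
      refine Finset.sum_congr rfl fun i _ => ?_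
      rw [map_smul, map_smul, hg]
      exact (algebraMap_smul (B ⊗[A] B) (D i b) (f (Pi.single i 1))).symm
    rw [h2, KaehlerDifferential.D_apply] at h1
    have h3 := (Ideal.toCotangent_eq _).1 h1
    simpa using h3
  have hXX : ∀ i j, (Ideal.Quotient.mk (X ^ 2) (MvPolynomial.X i)) * (Ideal.Quotient.mk (X ^ 2) (MvPolynomial.X j)) = 0 := by
    intro i j
    rw [← map_mul, Ideal.Quotient.eq_zero_iff_mem, pow_two]
    exact Ideal.mul_mem_mul (hX i) (hX j)
  obtain ⟨σ2, hσ2⟩ := sq_hom (A := A) (Q := (MvPolynomial (Fin r) B) ⧸ X^2) _ hXX D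
  let fac : ((MvPolynomial (Fin r) B) ⧸ X ^ k) →ₐ[A] ((MvPolynomial (Fin r) B) ⧸ X ^ 2) := Ideal.Quotient.factorₐ A (Ideal.pow_le_pow_right hk)
  have hfs : Function.Surjective fac := Ideal.Quotient.factor_surjective (Ideal.pow_le_pow_right hk)
  have hfn : IsNilpotent (RingHom.ker (fac : ((MvPolynomial (Fin r) B) ⧸ X ^ k) →+* ((MvPolynomial (Fin r) B) ⧸ X ^ 2))) := by
    refine ⟨k, ?_⟩
    have : RingHom.ker (fac : ((MvPolynomial (Fin r) B) ⧸ X ^ k) →+* ((MvPolynomial (Fin r) B) ⧸ X ^ 2)) = (X ^ 2).map (Ideal.Quotient.mk (X ^ k)) :=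
      Ideal.Quotient.factor_ker (Ideal.pow_le_pow_right hk)
    rw [this, ← Ideal.map_pow, Submodule.zero_eq_bot, ← le_bot_iff, Ideal.map_le_iff_le_comap]
    refine le_trans ?_ (le_of_eq (Ideal.mk_ker (I := X ^ k)).symm)
    rw [← pow_mul]
    exact Ideal.pow_le_pow_right (by omega)
  let σ : B →ₐ[A] (MvPolynomial (Fin r) B) ⧸ X ^ k := Algebra.FormallySmooth.liftOfSurjective σ2 fac hfs hfn
  have hσ : ∀ z, fac (σ z) = σ2 z := Algebra.FormallySmooth.liftOfSurjective_apply σ2 fac hfs hfn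
  let π : (MvPolynomial (Fin r) B) →ₐ[B] (B ⊗[A] B) := MvPolynomial.aeval (fun i => (g i : (B ⊗[A] B)))
  have hπX : X ≤ I.comap π := by
    rw [Ideal.span_le]
    rintro _ ⟨i, rfl⟩
    simp [π]
  have hπn : ∀ n, X ^ n ≤ (I ^ n).comap π := fun n =>
    (Ideal.pow_right_mono hπX n).trans (Ideal.le_comap_pow _ _)
  let πk : ((MvPolynomial (Fin r) B) ⧸ X ^ k) →ₐ[B] ((B ⊗[A] B) ⧸ I ^ k) := Ideal.quotientMapₐ (I ^ k) π (hπn k)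
  let τ0 : (B ⊗[A] B) →ₐ[B] ((B ⊗[A] B) ⧸ I ^ k) := Algebra.TensorProduct.lift (Algebra.ofId B ((B ⊗[A] B) ⧸ I ^ k)) ((πk.restrictScalars A).comp σ) (fun _ _ => Commute.all _ _)
  let J : Ideal ((B ⊗[A] B) ⧸ I ^ k) := I.map (Ideal.Quotient.mk (I ^ k))
  have hJk : J ^ k = ⊥ := by
    rw [← Ideal.map_pow, ← le_bot_iff, Ideal.map_le_iff_le_comap]
    exact (le_of_eq (Ideal.mk_ker (I := I ^ k)).symm)
  have hτ0 : ∀ c : (B ⊗[A] B), τ0 c - Ideal.Quotient.mk (I ^ k) c ∈ J ^ 2 := by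
    have key : ((Ideal.Quotient.mkₐ B (J ^ 2)).comp τ0) =
        ((Ideal.Quotient.mkₐ B (J ^ 2)).comp (Ideal.Quotient.mkₐ B (I ^ k))) := by
      apply Algebra.TensorProduct.ext (Subsingleton.elim _ _)
      apply AlgHom.ext
      intro b
      have h0 : τ0 ((1 : B) ⊗ₜ[A] b) = πk (σ b) := by simp [τ0]
      change Ideal.Quotient.mk (J ^ 2) (τ0 ((1 : B) ⊗ₜ[A] b)) = Ideal.Quotient.mk (J ^ 2) (Ideal.Quotient.mk (I ^ k) ((1 : B) ⊗ₜ[A] b))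
      obtain ⟨p, hp⟩ := Ideal.Quotient.mk_surjective (σ b)
      have h1 : Ideal.Quotient.mk (X ^ 2) p = σ2 b := by rw [← hσ, ← hp]; rfl
      rw [hσ2] at h1
      have h2 : Ideal.Quotient.mk (X ^ 2) p = Ideal.Quotient.mk (X^2) (MvPolynomial.C b + ∑ i, MvPolynomial.C (D i b) * MvPolynomial.X i) := by
        rw [h1, map_add, map_sum]
        rfl
      have h3 := hπn 2 (Ideal.Quotient.eq.1 h2)
      have h4 : π p - (b ⊗ₜ[A] 1 + ∑ i, (D i b ⊗ₜ[A] 1) * (g i : (B ⊗[A] B))) ∈ I ^ 2 := by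
        have : π (p - (MvPolynomial.C b + ∑ i, MvPolynomial.C (D i b) * MvPolynomial.X i)) =
          π p - (b ⊗ₜ[A] 1 + ∑ i, (D i b ⊗ₜ[A] 1) * (g i : (B ⊗[A] B))) := by
          simp [π]
        rw [← this]; exact h3
      have h5 : π p - (1 : B) ⊗ₜ[A] b ∈ I ^ 2 := by
        have := Ideal.sub_mem _ h4 (hD b)
        convert! this using 1
        ring
      rw [h0, Ideal.Quotient.eq, ← hp]
      have h6 := Ideal.mem_map_of_mem (Ideal.Quotient.mk (I ^ k)) h5
      rw [Ideal.map_pow, map_sub] at h6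
      exact h6
    intro c
    exact Ideal.Quotient.eq.1 (DFunLike.congr_fun key c)
  have hτ0k : ∀ c ∈ I ^ k, τ0 c = 0 := by
    have h1 : I ≤ J.comap τ0 := by
      intro c hc
      have := J.add_mem (Ideal.pow_le_self two_ne_zero (hτ0 c)) (Ideal.mem_map_of_mem (Ideal.Quotient.mk (I ^ k)) hc)
      simpa using this
    intro c hc
    have h2 : c ∈ (J ^ k).comap τ0 := Ideal.le_comap_pow τ0 k (Ideal.pow_right_mono h1 k hc)
    rw [hJk] at h2
    simpa using h2
  let τ : ((B ⊗[A] B) ⧸ I ^ k) →ₐ[B] ((B ⊗[A] B) ⧸ I ^ k) := Ideal.Quotient.liftₐ (I ^ k) τ0 hτ0k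
  have hτ := unip_bij J k hJk τ (by
    intro q
    obtain ⟨c, rfl⟩ := Ideal.Quotient.mk_surjective q
    exact hτ0 c)
  let e := AlgEquiv.ofBijective τ hτ
  obtain ⟨ι, _, co, m, hm⟩ := trunc (B := B) r k
  choose c hc using fun i => Ideal.Quotient.mk_surjective (I := I ^ k) (e.symm (πk (m i)))
  refine ⟨ι, inferInstance, fun i => ((co i).restrictScalars A) ∘ₗ σ.toLinearMap, c, fun b => ?_⟩
  rw [← Ideal.Quotient.eq]
  apply e.injective
  have h1 : e (Ideal.Quotient.mk (I ^ k) ((1 : B) ⊗ₜ[A] b)) = πk (σ b) := by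
    change τ0 ((1 : B) ⊗ₜ[A] b) = _
    simp [τ0]
  refine h1.trans ?_
  rw [map_sum, map_sum]
  conv_lhs => rw [hm (σ b)]
  rw [map_sum]
  refine Finset.sum_congr rfl fun i _ => ?_
  rw [map_mul, hc, map_mul, AlgEquiv.apply_symm_apply, map_smul, Algebra.smul_def]
  congr 1
  exact (e.commutes _).symm

end RG

namespace RG
universe u
open TensorProduct
theorem inj_fg {B C : Type u} [CommRing B] [CommRing C] [Algebra B C] [Module.Flat B C] [IsNoetherianRing B]
    (s : C) (h : ∀ (p : Ideal B) [p.IsPrime] (z : C ⊗[B] p.ResidueField), s • z = 0 → z = 0)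
    (M : Type u) [AddCommGroup M] [Module B M] (hM : Module.Finite B M) :
    ∀ z : C ⊗[B] M, s • z = 0 → z = 0 := by
  induction hM using IsNoetherianRing.induction_on_isQuotientEquivQuotientPrime B with
  | subsingleton N => intro z _; exact Subsingleton.elim _ _
  | quotient N p f =>
    have := p.2
    intro z hz
    let g : N →ₗ[B] p.1.ResidueField := (Algebra.linearMap (B ⧸ p.1) p.1.ResidueField).restrictScalars B ∘ₗ f.toLinearMap
    have hg : Function.Injective g := 
      (Ideal.injective_algebraMap_quotient_residueField p.1).comp f.injective
    have h1 : Function.Injective (g.baseChange C) := by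
      rw [LinearMap.baseChange_eq_ltensor]
      exact Module.Flat.lTensor_preserves_injective_linearMap g hg
    apply h1
    rw [map_zero]
    apply h
    rw [← map_smul, hz, map_zero]
  | exact N₁ N₂ N₃ f g hf hg hfg h₁ h₃ =>
    intro z hz
    have e1 : (g.baseChange C) z = 0 := h₃ _ (by rw [← map_smul, hz, map_zero])
    have hex : Function.Exact (f.lTensor C) (g.lTensor C) := lTensor_exact C hfg hg
    have hinj : Function.Injective (f.baseChange C) := by
      rw [LinearMap.baseChange_eq_ltensor]
      exact Module.Flat.lTensor_preserves_injective_linearMap f hf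
    obtain ⟨y, hy⟩ := (hex z).1 (by simpa [LinearMap.baseChange_eq_ltensor] using e1)
    have hy' : f.baseChange C y = z := by simpa [LinearMap.baseChange_eq_ltensor] using hy
    have : y = 0 := h₁ y (hinj (by rw [map_smul, hy', hz, map_zero]))
    rw [← hy', this, map_zero]

theorem inj_res {A B : Type u} [CommRing A] [CommRing B] [Algebra A B]
    (hG : ∀ (K : Type u) [Field K] [Algebra A K], IsDomain (K ⊗[A] B))
    (s : B ⊗[A] B) (hs : Algebra.TensorProduct.lmul' A (S := B) s = 1) (K : Type u) [Field K] [Algebra B K]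
    (z : (B ⊗[A] B) ⊗[B] K) (hz : s • z = 0) : z = 0 := by
  algebraize [(algebraMap B K).comp (algebraMap A B)]
  let e : (B ⊗[A] B) ⊗[B] K ≃ₐ[B] K ⊗[A] B :=
    (Algebra.TensorProduct.comm B (B ⊗[A] B) K).trans
    ((Algebra.TensorProduct.cancelBaseChange A B K K B).restrictScalars B)
  have := hG K
  have : IsDomain ((B ⊗[A] B) ⊗[B] K) := e.toMulEquiv.isDomain
  have hz' : algebraMap (B ⊗[A] B) ((B ⊗[A] B) ⊗[B] K) s * z = 0 := (Algebra.smul_def s z).symm.trans hz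
  rcases mul_eq_zero.1 hz' with h | h
  · exfalso
    let lm : B ⊗[A] B →ₐ[B] B := Algebra.TensorProduct.lmul'' A
    let f : (B ⊗[A] B) ⊗[B] K →ₐ[B] K := Algebra.TensorProduct.lift ((Algebra.ofId B K).comp lm) (AlgHom.id B K) (fun _ _ => Commute.all _ _)
    have h1 : f (algebraMap _ _ s) = 1 := by
      have : lm s = 1 := hs
      simp [f, this]
    rw [h, map_zero] at h1
    exact zero_ne_one h1
  · exact h

theorem one_sub_smul_eq_zero {C W : Type*} [CommRing C] [AddCommGroup W] [Module C W] (r : C) (X : W)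
    (h : r • X = X) : (1 - r) • X = 0 := by
  rw [sub_smul, h, one_smul, sub_self]

theorem ff_of_G {A B : Type u} [CommRing A] [CommRing B] [Algebra A B] [Module.Flat A B]
    (hG : ∀ (K : Type u) [Field K] [Algebra A K], Nontrivial (K ⊗[A] B)) : Module.FaithfullyFlat A B := by
  constructor
  intro m hm h
  letI := Ideal.Quotient.field m
  have := hG (A ⧸ m)
  have e := TensorProduct.quotTensorEquivQuotSMul B m
  have : Nontrivial (B ⧸ (m • ⊤ : Submodule A B)) := e.symm.toEquiv.nontrivial
  rw [h] at this
  exact not_subsingleton _ (inferInstance : Subsingleton (B ⧸ (⊤ : Submodule A B)))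

theorem proj_of_G {A B : Type u} [CommRing A] [CommRing B] [Algebra A B] [IsNoetherianRing A] [Algebra.Smooth A B]
    (hG : ∀ (K : Type u) [Field K] [Algebra A K], IsDomain (K ⊗[A] B))
    (x : ℕ → B) (hx : Submodule.span A (Set.range x) = ⊤) : Module.Projective A B := by
  have hft : Algebra.FiniteType A B := inferInstance
  have : IsNoetherianRing B := Algebra.FiniteType.isNoetherianRing A B
  have : IsNoetherianRing (B ⊗[A] B) := Algebra.FiniteType.isNoetherianRing B _
  have : Module.FaithfullyFlat A B := ff_of_G fun K _ _ => (hG K).toNontrivial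
  choose ι hι θ c hθ using fun k : ℕ => exists_ops (A := A) (B := B) (k + 2) (by omega)
  let Θ : Set (B →ₗ[A] B) := {t | ∃ k i, t = θ k i}
  refine proj_of_dom x hx (dom_of_ops Θ ?_)
  intro M _ _ _ _ _ n m b hb
  let I := KaehlerDifferential.ideal A B
  let e : M ⊗[A] B ≃ₗ[B] (B ⊗[A] B) ⊗[B] M :=
    (TensorProduct.AlgebraTensorModule.cancelBaseChange A B B M B).symm.trans (TensorProduct.comm B M (B ⊗[A] B))
  have he : ∀ m b, e (m ⊗ₜ b) = ((1:B) ⊗ₜ[A] b) ⊗ₜ[B] m := fun m b => by simp [e]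
  apply e.injective
  rw [map_zero, map_sum]
  simp_rw [he]
  set X := ∑ l, ((1:B) ⊗ₜ[A] (b l)) ⊗ₜ[B] (m l) with hX
  have h1 : ∀ k, X ∈ (I ^ (k + 2) • ⊤ : Submodule (B ⊗[A] B) ((B ⊗[A] B) ⊗[B] M)) := by
    intro k
    have h2 : X = ∑ l, ((1:B) ⊗ₜ[A] (b l) - ∑ i, (θ k i (b l) ⊗ₜ[A] (1:B)) * c k i) ⊗ₜ[B] (m l) := by
      simp only [TensorProduct.sub_tmul, TensorProduct.sum_tmul, Finset.sum_sub_distrib]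
      rw [Finset.sum_comm]
      have : ∀ i, ∑ l, ((θ k i (b l) ⊗ₜ[A] (1:B)) * c k i) ⊗ₜ[B] (m l) = 0 := by
        intro i
        have h3 : ∀ l, ((θ k i (b l) ⊗ₜ[A] (1:B)) * c k i) ⊗ₜ[B] (m l) = c k i ⊗ₜ[B] (θ k i (b l) • m l) := by
          intro l
          rw [← TensorProduct.smul_tmul, Algebra.smul_def]
          rfl
        simp_rw [h3]
        rw [← TensorProduct.tmul_sum, hb _ ⟨k, i, rfl⟩, TensorProduct.tmul_zero]
      simp [this, hX]
    rw [h2]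
    refine Submodule.sum_mem _ fun l _ => ?_
    have : ∀ (c : B ⊗[A] B) (m : M), c ⊗ₜ[B] m = c • ((1 : B ⊗[A] B) ⊗ₜ[B] m) := by
      intro c m
      rw [TensorProduct.smul_tmul', smul_eq_mul, mul_one]
    rw [this]
    exact Submodule.smul_mem_smul (hθ k (b l)) trivial
  have h2 : X ∈ (⨅ i : ℕ, I ^ i • ⊤ : Submodule (B ⊗[A] B) ((B ⊗[A] B) ⊗[B] M)) := by
    rw [Submodule.mem_iInf]
    intro k
    exact Submodule.smul_mono_left (Ideal.pow_le_pow_right (by omega)) (h1 k)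
  obtain ⟨r, hr⟩ := (Ideal.mem_iInf_smul_pow_eq_bot_iff I X).1 h2
  refine inj_fg (1 - (r : B ⊗[A] B)) (fun p _ z hz => inj_res hG _ ?_ _ z hz) M inferInstance X ?_
  · rw [map_sub, map_one]
    have : Algebra.TensorProduct.lmul' A (S := B) (r : B ⊗[A] B) = 0 := r.2
    rw [this, sub_zero]
  · exact one_sub_smul_eq_zero _ _ hr

end RG

namespace RG
universe u
open TensorProduct
def splitEquiv {A M P : Type*} [CommRing A] [AddCommGroup M] [Module A M] [AddCommGroup P] [Module A P]
    (f : M →ₗ[A] P) (g : P →ₗ[A] M) (h : f ∘ₗ g = LinearMap.id) : M ≃ₗ[A] (LinearMap.ker f × P) where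
  toFun m := (⟨m - g (f m), by
    have := LinearMap.congr_fun h (f m)
    simp at this; simp [this]⟩, f m)
  map_add' x y := by ext <;> simp; abel
  map_smul' r x := by ext <;> simp [smul_sub]
  invFun y := y.1.1 + g y.2
  left_inv x := by simp
  right_inv y := by
    have h1 : ∀ z, f (g z) = z := LinearMap.congr_fun h
    have := y.1.2
    rw [LinearMap.mem_ker] at this
    ext <;> simp [this, h1]

noncomputable def finsuppProd {A M P : Type*} [CommRing A] [AddCommMonoid M] [Module A M] [AddCommMonoid P] [Module A P] :
    (ℕ →₀ (M × P)) ≃ₗ[A] (ℕ →₀ M) × (ℕ →₀ P) :=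
  LinearEquiv.ofLinearMap
    ((Finsupp.mapRange.linearMap (LinearMap.fst A M P)).prod (Finsupp.mapRange.linearMap (LinearMap.snd A M P)))
    ((Finsupp.mapRange.linearMap (LinearMap.inl A M P)).coprod (Finsupp.mapRange.linearMap (LinearMap.inr A M P)))
    (by ext <;> simp) (by ext <;> simp)

theorem swindle {A B : Type u} [CommRing A] [AddCommGroup B] [Module A B] [Module.Projective A B]
    (x : ℕ → B) (hx : Submodule.span A (Set.range x) = ⊤)
    (s : B →ₗ[A] (ℕ →₀ A)) (hs : Function.Surjective s) : Module.Free A B := by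
  obtain ⟨t, ht⟩ := Module.projective_lifting_property s LinearMap.id hs
  let e1 := splitEquiv s t ht
  let q : (ℕ →₀ A) →ₗ[A] LinearMap.ker s := LinearMap.fst A _ _ ∘ₗ e1.toLinearMap ∘ₗ Finsupp.linearCombination A x
  have hq : Function.Surjective q := by
    refine Prod.fst_surjective.comp (e1.surjective.comp ?_)
    rw [← LinearMap.range_eq_top, Finsupp.range_linearCombination, hx]
  have : Module.Projective A (LinearMap.ker s) := by
    refine Module.Projective.of_split (LinearMap.ker s).subtype (LinearMap.fst A _ _ ∘ₗ e1.toLinearMap) ?_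
    ext y
    have := y.2
    rw [LinearMap.mem_ker] at this
    simp [e1, splitEquiv, this]
  obtain ⟨r, hr⟩ := Module.projective_lifting_property q LinearMap.id hq
  let e2 : (ℕ →₀ A) ≃ₗ[A] LinearMap.ker q × LinearMap.ker s := splitEquiv q r hr
  let e3 : (ℕ →₀ A) ≃ₗ[A] (ℕ →₀ LinearMap.ker q) × (ℕ →₀ LinearMap.ker s) :=
    (Finsupp.domLCongr (Nat.pairEquiv.symm)).trans <| (Finsupp.curryLinearEquiv A).trans <|
      (Finsupp.mapRange.linearEquiv e2).trans finsuppProd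
  let e4 : (LinearMap.ker s × (ℕ →₀ LinearMap.ker s)) ≃ₗ[A] (ℕ →₀ LinearMap.ker s) :=
    (((Finsupp.domLCongr (Equiv.natSumPUnitEquivNat.{0}).symm).trans (Finsupp.sumFinsuppLEquivProdFinsupp A)).trans
    ((LinearEquiv.refl A _).prodCongr (Finsupp.uniqueLinearEquiv A _ PUnit.unit))).symm |> (LinearEquiv.prodComm A _ _).trans
  let e5 : B ≃ₗ[A] (ℕ →₀ A) := e1.trans <| ((LinearEquiv.refl A _).prodCongr (e3.trans (LinearEquiv.prodComm A _ _))).trans <|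
    (LinearEquiv.prodAssoc A _ _ _).symm.trans <| (e4.prodCongr (LinearEquiv.refl A _)).trans <|
    (LinearEquiv.prodComm A _ _).trans e3.symm
  exact Module.Free.of_equiv e5.symm

theorem bass_claim {A₁ A P : Type u} [CommRing A₁] [CommRing A] [Algebra A₁ A] [IsNoetherianRing A₁]
    [AddCommGroup P] [Module A₁ P] (x : ℕ → P) (c : P →ₗ[A₁] (ℕ →₀ A₁))
    (hc : ∀ b, Finsupp.linearCombination A₁ x (c b) = b)
    (hinf : ∀ m : Ideal A, m.IsMaximal → ¬ Module.Finite (A ⧸ m) ((A ⧸ m) ⊗[A₁] P)) (N : ℕ) :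
    ∃ f : P, (∀ i < N, c f i = 0) ∧ Ideal.span (Set.range fun i => algebraMap A₁ A (c f i)) = ⊤ := by
  let ct : P → Ideal A₁ := fun f => Ideal.span (Set.range fun i => c f i)
  obtain ⟨J, ⟨f, hf, rfl⟩, hmax⟩ := set_has_maximal_iff_noetherian.2 (inferInstance : IsNoetherian A₁ A₁)
    {J | ∃ f : P, (∀ i < N, c f i = 0) ∧ ct f = J} ⟨_, 0, by simp, rfl⟩
  refine ⟨f, hf, ?_⟩
  by_contra hne
  obtain ⟨m, hm, hle⟩ := Ideal.exists_le_maximal _ hne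
  obtain ⟨M, hM⟩ : ∃ M, ∀ i, M ≤ i → c f i = 0 := by
    refine ⟨(c f).support.sup id + 1, fun i hi => ?_⟩
    by_contra h
    have := Finset.le_sup (f := id) (Finsupp.mem_support_iff.2 h)
    simp at this; omega
  have key : ∃ g : P, (∀ i < max M N, c g i = 0) ∧ ∃ i, algebraMap A₁ A (c g i) ∉ m := by
    by_contra! hcon
    apply hinf m hm
    let π : P →ₗ[A₁] (Fin (max M N) → A₁) := LinearMap.pi fun i => Finsupp.lapply (i : ℕ) ∘ₗ c
    have hfin : (LinearMap.range π).FG := IsNoetherian.noetherian _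
    rw [← Submodule.map_top] at hfin
    obtain ⟨S, hS⟩ : ∃ S : Submodule A₁ P, S.FG ∧ S ⊔ LinearMap.ker π = ⊤ := by
      obtain ⟨S, hS1, hS2⟩ := (Submodule.fg_def).1 hfin
      have : ∀ y ∈ S, ∃ z, π z = y := fun y hy => by
        have : y ∈ Submodule.map π ⊤ := hS2 ▸ Submodule.subset_span hy
        simpa using this
      choose! z hz using this
      refine ⟨Submodule.span A₁ (z '' S), Submodule.fg_span (hS1.image z), ?_⟩
      rw [← Submodule.comap_map_eq, Submodule.map_span, ← Set.image_comp]
      have : (π ∘ z) '' S = S := by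
        ext y; constructor
        · rintro ⟨w, hw, rfl⟩; simpa [hz w hw] using hw
        · intro hy; exact ⟨y, hy, hz y hy⟩
      rw [this, hS2]
      rw [Submodule.comap_map_eq]; simp
    obtain ⟨⟨T, hT⟩, hS2⟩ := hS
    classical
    refine ⟨⟨T.image fun t => (1 : A ⧸ m) ⊗ₜ[A₁] t, ?_⟩⟩
    rw [eq_top_iff]
    rintro z -
    set W := Submodule.span (A ⧸ m) ((T.image fun t => (1 : A ⧸ m) ⊗ₜ[A₁] t : Finset _) : Set ((A ⧸ m) ⊗[A₁] P)) with hW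
    have h1 : ∀ p : P, (1 : A ⧸ m) ⊗ₜ[A₁] p ∈ W := by
      intro p
      have hp : p ∈ S ⊔ LinearMap.ker π := hS2 ▸ trivial
      obtain ⟨y, hy, g, hg, rfl⟩ := Submodule.mem_sup.1 hp
      clear hp
      rw [← hT] at hy
      rw [TensorProduct.tmul_add]
      refine W.add_mem ?_ ?_
      · induction hy using Submodule.span_induction with
        | mem x hx => exact Submodule.subset_span (by simpa using ⟨x, hx, rfl⟩)
        | zero => simp
        | add a b _ _ ha hb => 
          rw [TensorProduct.tmul_add]; exact W.add_mem ha hb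
        | smul a b _ hb => 
          rw [TensorProduct.tmul_smul]; exact W.smul_of_tower_mem a hb
      · have : ∀ i, algebraMap A₁ A (c g i) ∈ m := hcon g (fun i hi => by
          have := congr_fun (LinearMap.mem_ker.1 hg) ⟨i, hi⟩
          simpa [π] using this)
        have h0 : (1 : A ⧸ m) ⊗ₜ[A₁] g = 0 := by
          conv_lhs => rw [← hc g, Finsupp.linearCombination_apply, Finsupp.sum, TensorProduct.tmul_sum]
          refine Finset.sum_eq_zero fun i _ => ?_
          rw [← TensorProduct.smul_tmul]
          have : c g i • (1 : A ⧸ m) = 0 := by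
            rw [Algebra.smul_def, mul_one, IsScalarTower.algebraMap_apply A₁ A (A ⧸ m)]
            exact Ideal.Quotient.eq_zero_iff_mem.2 (this i)
          rw [this, TensorProduct.zero_tmul]
        rw [h0]; exact W.zero_mem
    induction z using TensorProduct.induction_on with
    | zero => exact W.zero_mem
    | tmul a p => 
      have : a ⊗ₜ[A₁] p = a • ((1 : A ⧸ m) ⊗ₜ[A₁] p) := by rw [TensorProduct.smul_tmul', smul_eq_mul, mul_one]
      rw [this]; exact W.smul_mem _ (h1 p)
    | add a b ha hb => exact W.add_mem ha hb
  obtain ⟨g, hg, i, hi⟩ := key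
  have hiM : M ≤ i := by
    by_contra h
    exact hi (by rw [hg i (by omega)]; simp)
  have hle2 : ct f ≤ ct (f + g) := by
    refine Ideal.span_le.2 ?_
    rintro _ ⟨j, rfl⟩
    by_cases hj : j < M
    · refine Ideal.subset_span ⟨j, ?_⟩
      simp [hg j (by omega)]
    · simp only [SetLike.mem_coe]; rw [hM j (by omega)]; exact Ideal.zero_mem _
  have hnlt := hmax (ct (f + g)) ⟨f + g, fun i hi => by simp [hf i hi, hg i (by omega)], rfl⟩
  have heq : ct f = ct (f + g) := by
    by_contra h
    exact hnlt (lt_of_le_of_ne hle2 h)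
  have : c g i ∈ ct f := by
    rw [heq]
    refine Ideal.subset_span ⟨i, ?_⟩
    simp [hM i hiM]
  have h2 : ct f ≤ m.comap (algebraMap A₁ A) := by
    refine Ideal.span_le.2 ?_
    rintro _ ⟨j, rfl⟩
    exact hle (Ideal.subset_span ⟨j, rfl⟩)
  exact hi (h2 this)

theorem bass_surj {A₁ A P : Type u} [CommRing A₁] [CommRing A] [Algebra A₁ A] [IsNoetherianRing A₁]
    [AddCommGroup P] [Module A₁ P] [Module.Projective A₁ P] (x : ℕ → P) (hx : Submodule.span A₁ (Set.range x) = ⊤)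
    (hinf : ∀ m : Ideal A, m.IsMaximal → ¬ Module.Finite (A ⧸ m) ((A ⧸ m) ⊗[A₁] P)) :
    ∃ s : A ⊗[A₁] P →ₗ[A] (ℕ →₀ A), Function.Surjective s := by
  obtain ⟨c, hc⟩ := Module.projective_lifting_property (Finsupp.linearCombination A₁ x) LinearMap.id
    (by rw [← LinearMap.range_eq_top, Finsupp.range_linearCombination, hx])
  have hc' := LinearMap.congr_fun hc
  have hcl := bass_claim (A := A) x c hc' hinf
  obtain ⟨f, hf, hd⟩ := exists_seq_of_forall_finset_exists
    (fun f : P => Ideal.span (Set.range fun i => algebraMap A₁ A (c f i)) = ⊤)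
    (fun f g : P => ∀ i, c f i ≠ 0 → c g i = 0) (by
      intro s _
      obtain ⟨g, hg, hg2⟩ := hcl ((s.sup fun f => (c f).support.sup id) + 1)
      refine ⟨g, hg2, fun f hfs i hi => hg i ?_⟩
      have h1 := Finset.le_sup (f := id) (Finsupp.mem_support_iff.2 hi)
      have h2 := Finset.le_sup (f := fun f => (c f).support.sup id) hfs
      simp only [id] at h1 h2
      omega)
  have hd2 : ∀ k l i, c (f k) i ≠ 0 → c (f l) i ≠ 0 → k = l := by
    intro k l i h1 h2
    rcases lt_trichotomy k l with h | h | h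
    · exact absurd (hd _ _ h i h1) h2
    · exact h
    · exact absurd (hd _ _ h i h2) h1
  have ha : ∀ k, ∃ a : ℕ →₀ A, (a.sum fun i r => r * algebraMap A₁ A (c (f k) i)) = 1 := by
    intro k
    have : (1 : A) ∈ Ideal.span (Set.range fun i => algebraMap A₁ A (c (f k) i)) := by rw [hf k]; trivial
    exact Finsupp.mem_ideal_span_range_iff_exists_finsupp.1 this
  choose a ha using ha
  classical
  let w : ℕ → (ℕ →₀ A) := fun i => if h : ∃ k, c (f k) i ≠ 0 then Finsupp.single h.choose (a h.choose i) else 0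
  have hw : ∀ k i, c (f k) i ≠ 0 → w i = Finsupp.single k (a k i) := by
    intro k i h
    have hex : ∃ k, c (f k) i ≠ 0 := ⟨k, h⟩
    have : hex.choose = k := hd2 _ _ i hex.choose_spec h
    simp only [w, dif_pos hex, this]
  let Ψ : P →ₗ[A₁] (ℕ →₀ A) := Finsupp.linearCombination A₁ w ∘ₗ c
  have hΨ : ∀ k, Ψ (f k) = Finsupp.single k 1 := by
    intro k
    simp only [Ψ, LinearMap.comp_apply, Finsupp.linearCombination_apply, Finsupp.sum]
    rw [Finset.sum_congr rfl (fun i hi => by rw [hw k i (Finsupp.mem_support_iff.1 hi)])]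
    simp only [Finsupp.smul_single]
    rw [← Finsupp.single_finsetSum]
    congr 1
    rw [← ha k, Finsupp.sum]
    rw [Finset.sum_subset (s₁ := (c (f k)).support) (s₂ := (c (f k)).support ∪ (a k).support) Finset.subset_union_left,
      Finset.sum_subset (s₁ := (a k).support) (s₂ := (c (f k)).support ∪ (a k).support) Finset.subset_union_right]
    · refine Finset.sum_congr rfl fun i _ => ?_
      rw [Algebra.smul_def, mul_comm]
    · intro i _ h; rw [Finsupp.notMem_support_iff.1 h, zero_mul]
    · intro i _ h; rw [Finsupp.notMem_support_iff.1 h, zero_smul]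
  refine ⟨Ψ.liftBaseChange A, ?_⟩
  rw [← LinearMap.range_eq_top, eq_top_iff]
  rintro z -
  induction z using Finsupp.induction_linear with
  | zero => exact Submodule.zero_mem _
  | add a b ha hb => exact Submodule.add_mem _ ha hb
  | single k r => 
    refine ⟨r ⊗ₜ f k, ?_⟩
    simp [hΨ]

end RG

namespace RG
universe u
open TensorProduct Polynomial
noncomputable abbrev pm (n : ℕ) {D K : Type*} [CommRing D] [CommRing K] (φ : D →+* K) :
    (MvPolynomial (Fin n) D)[X] →+* (MvPolynomial (Fin n) K)[X] :=
  Polynomial.mapRingHom (MvPolynomial.map φ)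

theorem pm_comp (n : ℕ) {D K L : Type*} [CommRing D] [CommRing K] [CommRing L] (φ : D →+* K) (ψ : K →+* L)
    (f : (MvPolynomial (Fin n) D)[X]) : pm n ψ (pm n φ f) = pm n (ψ.comp φ) f := by
  simp only [pm, Polynomial.coe_mapRingHom, Polynomial.map_map]
  congr 1
  ext <;> simp

def NB {n : ℕ} {D : Type*} [CommRing D] (f g : (MvPolynomial (Fin n) D)[X]) {K : Type*} [Field K] (φ : D →+* K) : Prop :=
  ∀ P Q : (MvPolynomial (Fin n) K)[X], P.Monic → Q.Monic → P * Q = pm n φ f →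
    (∃ N : ℕ, P ∣ (pm n φ g) ^ N) ∨ (∃ N : ℕ, Q ∣ (pm n φ g) ^ N)

theorem deg_bound {n : ℕ} {D : Type*} [CommRing D] (f : (MvPolynomial (Fin n) D)[X]) :
    ∃ N : ℕ, ∀ (K : Type u) [Field K] (φ : D →+* K) (P Q : (MvPolynomial (Fin n) K)[X]),
      P.Monic → Q.Monic → P * Q = pm n φ f → ∀ i, (P.coeff i).totalDegree ≤ N := by
  let e := MvPolynomial.finSuccEquiv D n
  refine ⟨(e.symm f).totalDegree, ?_⟩
  intro K _ φ P Q hP hQ h i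
  let eK := MvPolynomial.finSuccEquiv K n
  have hcomm : ∀ z, pm n φ (e z) = eK (MvPolynomial.map φ z) := by
    intro z
    have : (pm n φ).comp e.toRingEquiv.toRingHom = eK.toRingEquiv.toRingHom.comp (MvPolynomial.map φ) := by
      refine MvPolynomial.ringHom_ext ?_ ?_
      · intro r; simp [e, eK, MvPolynomial.finSuccEquiv_eq]
      · intro i
        refine Fin.cases ?_ (fun i => ?_) i
        · simp [e, eK, MvPolynomial.finSuccEquiv_eq]
        · simp [e, eK, MvPolynomial.finSuccEquiv_eq]
    exact RingHom.congr_fun this z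
  have h2 : eK.symm P * eK.symm Q = MvPolynomial.map φ (e.symm f) := by
    rw [← map_mul, h]
    apply eK.injective
    rw [← hcomm]; simp
  have h3 : (eK.symm P).totalDegree ≤ (e.symm f).totalDegree := by
    have : (MvPolynomial.map φ (e.symm f)).totalDegree ≤ (e.symm f).totalDegree :=
      Finset.sup_mono (MvPolynomial.support_map_subset _ _)
    rw [← h2, MvPolynomial.totalDegree_mul_of_isDomain] at this
    · omega
    · simpa using hP.ne_zero
    · simpa using hQ.ne_zero
  by_cases h0 : P.coeff i = 0
  · rw [h0]; simp
  have := MvPolynomial.totalDegree_coeff_finSuccEquiv_add_le (eK.symm P) i (by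
    change (eK (eK.symm P)).coeff i ≠ 0
    simpa using h0)
  have h4 : (MvPolynomial.finSuccEquiv K n) (eK.symm P) = P := eK.apply_symm_apply P
  rw [h4] at this
  omega

theorem lift_mv {n : ℕ} {I : Type u} (k : I → Type u) [∀ d, Field (k d)] (N : ℕ)
    (p : ∀ d, MvPolynomial (Fin n) (k d)) (hp : ∀ d, (p d).totalDegree ≤ N) :
    ∃ p' : MvPolynomial (Fin n) (∀ d, k d), ∀ d, MvPolynomial.map (Pi.evalRingHom k d) p' = p d := by
  classical
  have hfin : {μ : Fin n →₀ ℕ | μ.degree ≤ N}.Finite := Finsupp.finite_of_degree_le N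
  refine ⟨∑ μ ∈ hfin.toFinset, MvPolynomial.monomial μ (fun d => (p d).coeff μ), fun d => ?_⟩
  ext ν
  rw [MvPolynomial.coeff_map, MvPolynomial.coeff_sum]
  simp only [MvPolynomial.coeff_monomial, Finset.sum_ite_eq', Set.Finite.mem_toFinset, Set.mem_ofPred_eq]
  split_ifs with h
  · rfl
  · simp only [map_zero]
    symm
    apply MvPolynomial.coeff_eq_zero_of_totalDegree_lt
    refine (hp d).trans_lt ?_
    rw [not_le] at h
    exact h

theorem lift_pm {n : ℕ} {I : Type u} (k : I → Type u) [∀ d, Field (k d)] (N e : ℕ)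
    (P : ∀ d, (MvPolynomial (Fin n) (k d))[X]) (hP : ∀ d, (P d).Monic) (he : ∀ d, (P d).natDegree = e)
    (hN : ∀ d i, ((P d).coeff i).totalDegree ≤ N) :
    ∃ P' : (MvPolynomial (Fin n) (∀ d, k d))[X], P'.Monic ∧ ∀ d, pm n (Pi.evalRingHom k d) P' = P d := by
  choose c hc using fun i => lift_mv k N (fun d => (P d).coeff i) (fun d => hN d i)
  refine ⟨X ^ e + ∑ i ∈ Finset.range e, C (c i) * X ^ i, ?_, fun d => ?_⟩
  · apply Polynomial.monic_X_pow_add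
    refine (Polynomial.degree_sum_le _ _).trans_lt ?_
    rw [Finset.sup_lt_iff (WithBot.bot_lt_coe _)]
    intro i hi
    exact (Polynomial.degree_C_mul_X_pow_le _ _).trans_lt (by simpa using hi)
  · conv_rhs => rw [(hP d).as_sum, he d]
    simp [hc, Polynomial.map_sum]

theorem pi_ext {n : ℕ} {I : Type u} (k : I → Type u) [∀ d, Field (k d)] (P Q : (MvPolynomial (Fin n) (∀ d, k d))[X])
    (h : ∀ d, pm n (Pi.evalRingHom k d) P = pm n (Pi.evalRingHom k d) Q) : P = Q := by
  ext i μ d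
  have := congr_arg (fun p => (p.coeff i).coeff μ) (h d)
  simpa [MvPolynomial.coeff_map] using this

theorem pi_unit {n : ℕ} {I : Type u} (k : I → Type u) [∀ d, Field (k d)] (P : (MvPolynomial (Fin n) (∀ d, k d))[X])
    (h : ∀ d, pm n (Pi.evalRingHom k d) P ≠ 0) {K : Type*} [Field K] (φ : (∀ d, k d) →+* K) : pm n φ P ≠ 0 := by
  classical
  intro h0
  have hc : ∀ i μ, φ ((P.coeff i).coeff μ) = 0 := by
    intro i μ
    have := congr_arg (fun p => (p.coeff i).coeff μ) h0
    simpa [MvPolynomial.coeff_map] using this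
  have hex : ∀ d, ∃ z : ℕ × (Fin n →₀ ℕ), ((P.coeff z.1).coeff z.2) d ≠ 0 := by
    intro d
    by_contra! hcon
    apply h d
    ext i μ
    have := hcon (i, μ)
    simpa [MvPolynomial.coeff_map] using this
  choose z hz using hex
  let T : Finset (ℕ × (Fin n →₀ ℕ)) := P.support.sigma (fun i => (P.coeff i).support) |>.image (fun s => (s.1, s.2))
  have hzT : ∀ d, z d ∈ T := by
    intro d
    have h1 : (P.coeff (z d).1).coeff (z d).2 ≠ 0 := fun h => hz d (by rw [h]; rfl)
    have h2 : P.coeff (z d).1 ≠ 0 := fun h => h1 (by rw [h]; simp)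
    simp only [T, Finset.mem_image, Finset.mem_sigma]
    exact ⟨⟨(z d).1, (z d).2⟩, ⟨by simpa using h2, by simpa using h1⟩, rfl⟩
  let v : ℕ × (Fin n →₀ ℕ) → (∀ d, k d) := fun s d => if s = z d then (((P.coeff s.1).coeff s.2) d)⁻¹ else 0
  have h1 : ∑ s ∈ T, v s * (P.coeff s.1).coeff s.2 = 1 := by
    funext d
    rw [Finset.sum_apply, Finset.sum_eq_single (z d)]
    · simp [v, hz d]
    · intro s _ hs; simp [v, hs]
    · intro h; exact absurd (hzT d) h
  have := congr_arg φ h1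
  rw [map_sum, map_one, Finset.sum_eq_zero] at this
  · exact zero_ne_one this
  · intro s _; rw [map_mul, hc, mul_zero]

theorem common_field {D Ω PP : Type u} [CommRing D] [IsDomain D] [Field Ω] [CommRing PP] [Algebra D Ω] [Algebra D PP]
    (hΩ : Function.Injective (algebraMap D Ω)) (hPP : ∀ d : D, d ≠ 0 → algebraMap D PP d ≠ 0) :
    ∃ (K : Type u) (_ : Field K) (_ : Algebra Ω K) (φ : PP →+* K),
      φ.comp (algebraMap D PP) = (algebraMap Ω K).comp (algebraMap D Ω) := by
  let M : Submonoid PP := (nonZeroDivisors D).map (algebraMap D PP)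
  obtain ⟨p, hp, -, hdis⟩ := Ideal.exists_le_prime_disjoint (⊥ : Ideal PP) M (by
    rw [Set.disjoint_left]
    rintro x hx ⟨d, hd, rfl⟩
    exact hPP d (nonZeroDivisors.ne_zero hd) hx)
  have hinj : Function.Injective (algebraMap D p.ResidueField) := by
    rw [injective_iff_map_eq_zero]
    intro d hd
    by_contra h
    rw [IsScalarTower.algebraMap_apply D PP, Ideal.algebraMap_residueField_eq_zero] at hd
    exact Set.disjoint_left.1 hdis hd ⟨d, mem_nonZeroDivisors_of_ne_zero h, rfl⟩
  have : Nontrivial (Ω ⊗[D] p.ResidueField) :=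
    Algebra.TensorProduct.nontrivial_of_algebraMap_injective_of_isDomain D Ω p.ResidueField hΩ hinj
  obtain ⟨m, hm⟩ := Ideal.exists_maximal (Ω ⊗[D] p.ResidueField)
  let := Ideal.Quotient.field m
  refine ⟨(Ω ⊗[D] p.ResidueField) ⧸ m, inferInstance, inferInstance,
    (((Ideal.Quotient.mkₐ D m).comp (Algebra.TensorProduct.includeRight)).toRingHom).comp (algebraMap PP p.ResidueField), ?_⟩
  ext d
  have h1 : algebraMap PP p.ResidueField (algebraMap D PP d) = algebraMap D _ d := (IsScalarTower.algebraMap_apply _ _ _ _).symm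
  simp only [RingHom.comp_apply, h1]
  have h2 : algebraMap Ω ((Ω ⊗[D] p.ResidueField) ⧸ m) (algebraMap D Ω d) = algebraMap D _ d := (IsScalarTower.algebraMap_apply _ _ _ _).symm
  rw [h2]
  exact AlgHom.commutes _ d

theorem BN_core {n : ℕ} {D Ω : Type u} [CommRing D] [IsDomain D] [Field Ω] [Algebra D Ω] (hΩ : Function.Injective (algebraMap D Ω))
    (f g : (MvPolynomial (Fin n) D)[X])
    (h : ∀ (K : Type u) [Field K] [Algebra Ω K], NB f g ((algebraMap Ω K).comp (algebraMap D Ω))) (e e' : ℕ)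
    {I : Type u} (k : I → Type u) [∀ d, Field (k d)] (φ : ∀ d : I, D →+* k d)
    (hφ : ∀ d : D, d ≠ 0 → ∃ i, φ i d ≠ 0)
    (P Q : ∀ d : I, (MvPolynomial (Fin n) (k d))[X]) (hP : ∀ d, (P d).Monic) (hQ : ∀ d, (Q d).Monic)
    (he : ∀ d, (P d).natDegree = e) (he' : ∀ d, (Q d).natDegree = e') (hPQ : ∀ d, P d * Q d = pm n (φ d) f)
    (hPg : ∀ d (N : ℕ), ¬ P d ∣ (pm n (φ d) g) ^ N) (hQg : ∀ d (N : ℕ), ¬ Q d ∣ (pm n (φ d) g) ^ N) : False := by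
  obtain ⟨N, hN⟩ := deg_bound.{u} f
  obtain ⟨P', hP', hP'2⟩ := lift_pm k N e P hP he
    (fun d i => hN (k d) (φ d) _ _ (hP d) (hQ d) (hPQ d) i)
  obtain ⟨Q', hQ', hQ'2⟩ := lift_pm k N e' Q hQ he'
    (fun d i => hN (k d) (φ d) _ _ (hQ d) (hP d) ((mul_comm _ _).trans (hPQ d)) i)
  obtain ⟨τ, hτ⟩ : ∃ τ : D →+* (∀ d, k d), ∀ d, (Pi.evalRingHom k d).comp τ = φ d := ⟨RingHom.pi φ, fun d => rfl⟩
  have hev : ∀ (d : I) (q : (MvPolynomial (Fin n) D)[X]), pm n (Pi.evalRingHom k d) (pm n τ q) = pm n (φ d) q := by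
    intro d q
    rw [pm_comp, hτ]
  have hmul : P' * Q' = pm n τ f := by
    apply pi_ext
    intro d
    rw [map_mul, hP'2, hQ'2, hev]
    exact hPQ d
  obtain ⟨L, _, _, ψ, hψ⟩ : ∃ (K : Type u) (_ : Field K) (_ : Algebra Ω K) (ψ : (∀ d, k d) →+* K),
      ψ.comp τ = (algebraMap Ω K).comp (algebraMap D Ω) := by
    let _ : Algebra D (∀ d, k d) := τ.toAlgebra
    refine common_field (PP := ∀ d, k d) hΩ ?_
    intro d hd h0
    obtain ⟨i, hi⟩ := hφ d hd
    apply hi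
    rw [← hτ i]
    exact congr_fun h0 i
  have hnd : ∀ (S : (MvPolynomial (Fin n) (∀ d, k d))[X]), S.Monic → (∀ (d : I) (N : ℕ), ¬ pm n (Pi.evalRingHom k d) S ∣ (pm n (φ d) g) ^ N) →
      ∀ N : ℕ, ¬ pm n ψ S ∣ (pm n ((algebraMap Ω L).comp (algebraMap D Ω)) g) ^ N := by
    intro S hS hd N hdvd
    have hpm : ∀ {R' : Type u} [CommRing R'] (σ : (∀ d, k d) →+* R'), pm n σ ((pm n τ g) ^ N %ₘ S) =
        (pm n (σ.comp τ) g) ^ N %ₘ pm n σ S := by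
      intro R' _ σ
      rw [← pm_comp, ← map_pow (pm n σ)]
      exact Polynomial.map_modByMonic (MvPolynomial.map σ) hS
    refine pi_unit k ((pm n τ g) ^ N %ₘ S) ?_ ψ ?_
    · intro d h0
      rw [hpm, hτ] at h0
      exact hd d N ((Polynomial.modByMonic_eq_zero_iff_dvd (hS.map _)).1 h0)
    · rw [hpm, hψ]
      exact (Polynomial.modByMonic_eq_zero_iff_dvd (hS.map _)).2 hdvd
  rcases h L (pm n ψ P') (pm n ψ Q') (hP'.map _) (hQ'.map _) (by rw [← map_mul, hmul, pm_comp, hψ]) with ⟨N, h1⟩ | ⟨N, h1⟩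
  · exact hnd P' hP' (fun d N => by rw [hP'2]; exact hPg d N) N h1
  · exact hnd Q' hQ' (fun d N => by rw [hQ'2]; exact hQg d N) N h1

theorem BN_e {n : ℕ} {D Ω : Type u} [CommRing D] [IsDomain D] [Field Ω] [Algebra D Ω] (hΩ : Function.Injective (algebraMap D Ω))
    (f g : (MvPolynomial (Fin n) D)[X])
    (h : ∀ (K : Type u) [Field K] [Algebra Ω K], NB f g ((algebraMap Ω K).comp (algebraMap D Ω))) (e e' : ℕ) :
    ∃ d : D, d ≠ 0 ∧ ∀ (K : Type u) [Field K] (φ : D →+* K), φ d ≠ 0 →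
      ∀ P Q : (MvPolynomial (Fin n) K)[X], P.Monic → Q.Monic → P.natDegree = e → Q.natDegree = e' → P * Q = pm n φ f →
    (∃ N : ℕ, P ∣ (pm n φ g) ^ N) ∨ (∃ N : ℕ, Q ∣ (pm n φ g) ^ N) := by
  by_contra! hcon
  have hcon' : ∀ d : {d : D // d ≠ 0}, _ := fun d => hcon d.1 d.2
  choose K hK φ hφ P Q hP hQ he he' hPQ hPg hQg using hcon'
  exact BN_core hΩ f g h e e' K φ (fun d hd => ⟨⟨d, hd⟩, hφ ⟨d, hd⟩⟩) P Q hP hQ he he' hPQ hPg hQg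

theorem BN {n : ℕ} {D Ω : Type u} [CommRing D] [IsDomain D] [Field Ω] [Algebra D Ω] (hΩ : Function.Injective (algebraMap D Ω))
    (f g : (MvPolynomial (Fin n) D)[X])
    (h : ∀ (K : Type u) [Field K] [Algebra Ω K], NB f g ((algebraMap Ω K).comp (algebraMap D Ω))) :
    ∃ d : D, d ≠ 0 ∧ ∀ (K : Type u) [Field K] (φ : D →+* K), φ d ≠ 0 → NB f g φ := by
  choose d hd h2 using fun e e' => BN_e hΩ f g h e e'
  let m := f.natDegree
  refine ⟨∏ e ∈ Finset.range (m + 1), ∏ e' ∈ Finset.range (m + 1), d e e', ?_, ?_⟩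
  · simp only [Finset.prod_ne_zero_iff]
    intro e _ e' _; exact hd e e'
  · intro K _ φ hφ P Q hP hQ hPQ
    simp only [map_prod, Finset.prod_ne_zero_iff] at hφ
    have hdeg : P.natDegree + Q.natDegree ≤ m := by
      rw [← hP.natDegree_mul hQ, hPQ]
      exact Polynomial.natDegree_map_le
    exact h2 _ _ K φ (hφ P.natDegree (by simp; omega) Q.natDegree (by simp; omega)) P Q hP hQ rfl rfl hPQ

end RG

namespace RG
universe u
open TensorProduct Polynomial
theorem std_zero {R S : Type*} [CommRing R] [CommRing S] [Algebra R S] (P : StandardEtalePresentation R S)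
    (p : R[X]) (h : aeval P.x p = 0) : ∃ k : ℕ, P.f ∣ P.g ^ k * p := by
  have h1 : (P.equivRing.trans P.P.equivAwayAdjoinRoot) (aeval P.x p) = 0 := by rw [h, map_zero]
  have h2 : (P.equivRing.trans P.P.equivAwayAdjoinRoot) (aeval P.x p) =
      algebraMap (AdjoinRoot P.f) (Localization.Away (AdjoinRoot.mk P.f P.g)) (AdjoinRoot.mk P.f p) := by
    rw [← AlgEquiv.coe_toAlgHom, ← aeval_algHom_apply]
    have : (P.equivRing.trans P.P.equivAwayAdjoinRoot).toAlgHom P.x =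
      algebraMap (AdjoinRoot P.f) (Localization.Away (AdjoinRoot.mk P.f P.g)) (AdjoinRoot.root P.f) := by
      change P.P.equivAwayAdjoinRoot (P.equivRing P.x) = _
      rw [StandardEtalePresentation.equivRing_x]
      refine P.P.lift_X _ ⟨?_, ?_⟩
      · rw [aeval_algebraMap_apply, AdjoinRoot.aeval_eq, AdjoinRoot.mk_self, map_zero]
      · rw [aeval_algebraMap_apply, AdjoinRoot.aeval_eq]
        exact IsLocalization.Away.algebraMap_isUnit ..
    erw [this]
    rw [aeval_algebraMap_apply, AdjoinRoot.aeval_eq]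
  rw [h2] at h1
  obtain ⟨⟨_, k, rfl⟩, hk⟩ := (IsLocalization.map_eq_zero_iff (Submonoid.powers (AdjoinRoot.mk P.f P.g)) _ _).1 h1
  refine ⟨k, ?_⟩
  rw [← AdjoinRoot.mk_eq_zero]
  simpa using hk

structure CD {R : Type*} [CommRing R] (f g : R[X]) (C : Type*) [CommRing C] : Prop where
  ex : ∃ Φ : R[X] →+* C, (Φ f = 0) ∧ IsUnit (Φ g) ∧ (∀ p, Φ p = 0 → ∃ k : ℕ, f ∣ g ^ k * p) ∧
    ∀ s : C, ∃ p, ∃ k : ℕ, s * Φ g ^ k = Φ p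

theorem std_CD {R S : Type*} [CommRing R] [CommRing S] [Algebra R S] (P : StandardEtalePresentation R S) :
    CD P.f P.g S :=
  ⟨⟨(aeval P.x : R[X] →ₐ[R] S).toRingHom, P.hasMap.1, P.hasMap.2, fun p hp => std_zero P p hp,
    fun s => P.exists_mul_aeval_x_g_pow_eq_aeval_x s⟩⟩

theorem CD.of_equiv {R : Type*} [CommRing R] {f g : R[X]} {C C' : Type*} [CommRing C] [CommRing C']
    (h : CD f g C) (e : C ≃+* C') : CD f g C' := by
  obtain ⟨Φ, h1, h2, h3, h4⟩ := h.ex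
  refine ⟨⟨e.toRingHom.comp Φ, by simp [h1], h2.map e.toRingHom, fun p hp => h3 p (e.injective (by simpa using hp)), fun s => ?_⟩⟩
  obtain ⟨p, k, hp⟩ := h4 (e.symm s)
  refine ⟨p, k, ?_⟩
  have := congrArg e hp
  simpa using this

section
attribute [local instance] MvPolynomial.algebraMvPolynomial

theorem chart_CD {n : ℕ} {D C K : Type u} [CommRing D] [CommRing C] [Algebra D C] [Algebra (MvPolynomial (Fin n) D) C]
    [IsScalarTower D (MvPolynomial (Fin n) D) C] (P : StandardEtalePresentation (MvPolynomial (Fin n) D) C)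
    [Field K] [Algebra D K] : CD (pm n (algebraMap D K) P.f) (pm n (algebraMap D K) P.g) (K ⊗[D] C) := by
  have := std_CD (P.baseChange (T := MvPolynomial (Fin n) K))
  have e := Algebra.IsPushout.cancelBaseChangeAlg D K (MvPolynomial (Fin n) D) (MvPolynomial (Fin n) K) C
  exact this.of_equiv e.toRingEquiv
end

theorem NB_of_dom {n : ℕ} {D K C : Type*} [CommRing D] [Field K] [CommRing C] [NoZeroDivisors C] (φ : D →+* K)
    {f g : (MvPolynomial (Fin n) D)[X]} (h : CD (pm n φ f) (pm n φ g) C) : NB f g φ := by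
  obtain ⟨Φ, h1, h2, h3, h4⟩ := h.ex
  intro P Q hP hQ hPQ
  have : Φ P * Φ Q = 0 := by rw [← map_mul, hPQ, h1]
  rcases mul_eq_zero.1 this with h | h
  · right
    obtain ⟨k, hk⟩ := h3 _ h
    rw [← hPQ, mul_comm P] at hk
    exact ⟨k, (mul_dvd_mul_iff_right hP.ne_zero).1 hk⟩
  · left
    obtain ⟨k, hk⟩ := h3 _ h
    rw [← hPQ] at hk
    exact ⟨k, (mul_dvd_mul_iff_right hQ.ne_zero).1 hk⟩

theorem split_off {R : Type*} [CommRing R] [IsDomain R] [UniqueFactorizationMonoid R] (g f : R) (hf : f ≠ 0) :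
    ∃ f₁ f₂ : R, f = f₁ * f₂ ∧ (∃ N : ℕ, f₂ ∣ g ^ N) ∧ ∀ p, Prime p → p ∣ f₁ → ¬ p ∣ g := by
  induction f using UniqueFactorizationMonoid.induction_on_prime with
  | h₁ => exact absurd rfl hf
  | h₂ x hx =>
    refine ⟨x, 1, by simp, ⟨0, by simp⟩, fun p hp hpx => absurd (isUnit_of_dvd_unit hpx hx) hp.not_isUnit⟩
  | h₃ a p ha hp ih =>
    obtain ⟨f₁, f₂, h1, ⟨N, hN⟩, h3⟩ := ih ha
    by_cases hg : p ∣ g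
    · refine ⟨f₁, p * f₂, by rw [h1]; ring, ⟨N+1, ?_⟩, h3⟩
      rw [pow_succ']; exact mul_dvd_mul hg hN
    · refine ⟨p * f₁, f₂, by rw [h1]; ring, ⟨N, hN⟩, fun q hq hqf hqg => ?_⟩
      rcases hq.dvd_or_dvd hqf with h | h
      · exact hg (((hq.dvd_prime_iff_associated hp).1 h).dvd_iff_dvd_left.1 hqg)
      · exact h3 q hq h hqg

theorem unit_of_dvd_pow {R : Type*} [CommRing R] [IsDomain R] [UniqueFactorizationMonoid R] {g a : R} (ha : a ≠ 0)
    (h : ∀ p, Prime p → p ∣ a → ¬ p ∣ g) (N : ℕ) (hN : a ∣ g ^ N) : IsUnit a := by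
  by_contra hu
  obtain ⟨p, hp, hpa⟩ := WfDvdMonoid.exists_irreducible_factor hu ha
  have hp' := UniqueFactorizationMonoid.irreducible_iff_prime.1 hp
  exact h p hp' hpa (hp'.dvd_of_dvd_pow (hpa.trans hN))

theorem noZD_of_NB {n : ℕ} {D K W : Type*} [CommRing D] [Field K] [CommRing W] (φ : D →+* K)
    {f g : (MvPolynomial (Fin n) D)[X]} (hf : f.Monic) (h : CD (pm n φ f) (pm n φ g) W) (hN : NB f g φ) :
    NoZeroDivisors W := by
  obtain ⟨Φ, h1, h2, h3, h4⟩ := h.ex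
  have hfm : (pm n φ f).Monic := hf.map _
  obtain ⟨f₁, f₂, hff, ⟨N, hN2⟩, hpr⟩ := split_off (pm n φ g) (pm n φ f) hfm.ne_zero
  have hf1 : f₁ ≠ 0 := fun h => hfm.ne_zero (by rw [hff, h, zero_mul])
  have hf2 : f₂ ≠ 0 := fun h => hfm.ne_zero (by rw [hff, h, mul_zero])
  -- f₁ is a unit or irreducible
  have key : ∀ p q k, pm n φ f ∣ pm n φ g ^ k * (p * q) → f₁ ∣ p ∨ f₁ ∣ q := by
    intro p q k hk
    by_cases hu : IsUnit f₁
    · exact Or.inl hu.dvd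
    have hirr : Irreducible f₁ := by
      refine ⟨hu, fun a b hab => ?_⟩
      have hlc : a.leadingCoeff * (b * f₂).leadingCoeff = 1 := by
        rw [← Polynomial.leadingCoeff_mul, ← mul_assoc, ← hab, ← hff]; exact hfm
      have hc : C (a.leadingCoeff) * C ((b * f₂).leadingCoeff) = 1 := by
        rw [← C_mul, hlc, C_1]
      have ha0 : a ≠ 0 := fun h => hf1 (by rw [hab, h, zero_mul])
      have hb0 : b ≠ 0 := fun h => hf1 (by rw [hab, h, mul_zero])
      rcases hN (C (b * f₂).leadingCoeff * a) (C a.leadingCoeff * (b * f₂))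
        (by rw [Monic, Polynomial.leadingCoeff_mul, leadingCoeff_C, mul_comm]; exact hlc)
        (by rw [Monic, Polynomial.leadingCoeff_mul, leadingCoeff_C]; exact hlc)
        (by rw [hff, hab]; linear_combination (a * b * f₂) * hc) with ⟨M, hM⟩ | ⟨M, hM⟩
      · left
        exact unit_of_dvd_pow ha0 (fun p hp hpa => hpr p hp (hab ▸ hpa.mul_right _)) M ((Dvd.intro_left _ rfl).trans hM)
      · right
        refine unit_of_dvd_pow hb0 (fun p hp hpa => hpr p hp (hab ▸ hpa.mul_left _)) M
          (Dvd.dvd.trans ?_ hM)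
        exact ⟨C a.leadingCoeff * f₂, by ring⟩
    have hpf := UniqueFactorizationMonoid.irreducible_iff_prime.1 hirr
    have : f₁ ∣ pm n φ g ^ k * (p * q) := (Dvd.intro _ hff.symm).trans hk
    rcases hpf.dvd_or_dvd this with h | h
    · exact absurd (hpf.dvd_of_dvd_pow h) (hpr f₁ hpf dvd_rfl)
    · exact hpf.dvd_or_dvd h
  have key2 : ∀ p, f₁ ∣ p → Φ p = 0 := by
    intro p hp
    have : pm n φ f ∣ p * pm n φ g ^ N := by rw [hff]; exact mul_dvd_mul hp hN2
    obtain ⟨c, hc⟩ := this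
    have := congrArg Φ hc
    rw [map_mul, map_mul, h1, zero_mul, map_pow] at this
    exact ((h2.pow N).mul_left_eq_zero).1 this
  refine ⟨fun {a b} hab => ?_⟩
  obtain ⟨p, k, hp⟩ := h4 a
  obtain ⟨q, l, hq⟩ := h4 b
  have : Φ (p * q) = 0 := by
    rw [map_mul, ← hp, ← hq]; linear_combination (Φ (pm n φ g) ^ k * Φ (pm n φ g) ^ l) * hab
  obtain ⟨m, hm⟩ := h3 _ this
  rcases key p q m hm with h | h
  · left
    have := key2 _ h
    rw [← hp] at this
    exact ((h2.pow k).mul_left_eq_zero).1 this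
  · right
    have := key2 _ h
    rw [← hq] at this
    exact ((h2.pow l).mul_left_eq_zero).1 this

end RG

namespace RG
universe u
open TensorProduct
/-- "localization at g has no zero divisors" -/
def LocND {T : Type*} [CommRing T] (g : T) : Prop :=
  ∀ a b : T, a * b = 0 → (∃ k : ℕ, g ^ k * a = 0) ∨ (∃ k : ℕ, g ^ k * b = 0)

theorem glue {T : Type*} [CommRing T] (S : Set T) (hS : Ideal.span S = ⊤) (hl : ∀ g ∈ S, LocND g)
    (hn : ∀ g ∈ S, ∀ h ∈ S, ¬ IsNilpotent (g * h)) : NoZeroDivisors T := by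
  have key : ∀ a : T, (∃ g ∈ S, ∃ k : ℕ, g ^ k * a = 0) → a = 0 := by
    rintro a ⟨g, hg, k, hk⟩
    have hall : ∀ h : S, ∃ m : ℕ, (h : T) ^ m * a = 0 := by
      rintro ⟨h, hh⟩
      rcases hl h hh _ _ hk with ⟨m, hm⟩ | hm
      · exfalso
        refine hn g hg h hh ⟨k + m, ?_⟩
        rw [mul_pow, pow_add, pow_add h]
        linear_combination (g ^ m * h ^ k) * hm
      · exact hm
    choose m hm using hall
    have := Ideal.span_range_pow_eq_top S hS m
    have h1 : (⊤ : Ideal T) ≤ Submodule.annihilator (Ideal.span {a}) := by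
      rw [← this, Ideal.span_le]
      rintro _ ⟨s, rfl⟩
      rw [SetLike.mem_coe, Submodule.mem_annihilator_span_singleton]
      exact hm s
    have h2 := h1 (Submodule.mem_top (x := 1))
    rw [Submodule.mem_annihilator_span_singleton] at h2
    simpa using h2
  refine ⟨fun {a b} hab => ?_⟩
  by_cases hemp : S.Nonempty
  · obtain ⟨g, hg⟩ := hemp
    rcases hl g hg a b hab with h | h
    · exact Or.inl (key a ⟨g, hg, h⟩)
    · exact Or.inr (key b ⟨g, hg, h⟩)
  · rw [Set.not_nonempty_iff_eq_empty] at hemp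
    rw [hemp, Ideal.span_empty] at hS
    have : (1 : T) ∈ (⊥ : Ideal T) := hS ▸ Submodule.mem_top
    left
    rw [← one_mul a, (Submodule.mem_bot T).1 this, zero_mul]

theorem locND_of {D C K : Type u} [CommRing D] [CommRing C] [Algebra D C] [CommRing K] [Algebra D K] (g : C)
    [NoZeroDivisors (K ⊗[D] Localization.Away g)] : LocND ((1 : K) ⊗ₜ[D] g) := by
  intro a b hab
  let e := IsLocalization.Away.tensorProductEquivTMulRight D K g (Localization.Away g)
  have : NoZeroDivisors (Localization.Away ((1 : K) ⊗ₜ[D] g)) :=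
    e.symm.injective.noZeroDivisors e.symm (map_zero _) (map_mul _)
  have h : algebraMap _ (Localization.Away ((1 : K) ⊗ₜ[D] g)) a * algebraMap _ (Localization.Away ((1 : K) ⊗ₜ[D] g)) b = 0 := by
    rw [← map_mul, hab, map_zero]
  rcases mul_eq_zero.1 h with h | h
  · left
    obtain ⟨⟨_, k, rfl⟩, hk⟩ := (IsLocalization.map_eq_zero_iff (Submonoid.powers ((1 : K) ⊗ₜ[D] g)) _ _).1 h
    exact ⟨k, hk⟩
  · right
    obtain ⟨⟨_, k, rfl⟩, hk⟩ := (IsLocalization.map_eq_zero_iff (Submonoid.powers ((1 : K) ⊗ₜ[D] g)) _ _).1 h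
    exact ⟨k, hk⟩

theorem noZD_loc {T : Type*} [CommRing T] [IsDomain T] (g : T) : NoZeroDivisors (Localization.Away g) := by
  refine ⟨fun {a b} hab => ?_⟩
  obtain ⟨⟨p, s⟩, hp⟩ := IsLocalization.surj (Submonoid.powers g) a
  obtain ⟨⟨q, t⟩, hq⟩ := IsLocalization.surj (Submonoid.powers g) b
  have h : algebraMap T (Localization.Away g) (p * q) = 0 := by
    rw [map_mul]; simp only at hp hq; rw [← hp, ← hq]
    linear_combination (algebraMap T (Localization.Away g) s * algebraMap T (Localization.Away g) t) * hab
  obtain ⟨⟨c, hc⟩, h⟩ := (IsLocalization.map_eq_zero_iff (Submonoid.powers g) _ _).1 h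
  have hu : ∀ z : Submonoid.powers g, IsUnit (algebraMap T (Localization.Away g) z) := IsLocalization.map_units _
  simp only [mul_eq_zero] at h
  rcases h with h | h | h
  · have h1 := hu ⟨c, hc⟩
    simp only [h, map_zero] at h1
    left
    rw [isUnit_zero_iff] at h1
    rw [← one_mul a, ← h1, zero_mul]
  · left
    rw [h, map_zero] at hp
    exact ((hu s).mul_left_eq_zero).1 hp
  · right
    rw [h, map_zero] at hq
    exact ((hu t).mul_left_eq_zero).1 hq

theorem chart_gen {D C Ω : Type u} [CommRing D] [IsDomain D] [CommRing C] [Algebra D C] [Field Ω] [Algebra D Ω]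
    (hΩ : Function.Injective (algebraMap D Ω)) (g : C) {n : ℕ}
    [Algebra (MvPolynomial (Fin n) D) (Localization.Away g)] [IsScalarTower D (MvPolynomial (Fin n) D) (Localization.Away g)]
    (P : StandardEtalePresentation (MvPolynomial (Fin n) D) (Localization.Away g))
    (h : ∀ (K : Type u) [Field K] [Algebra D K] [Algebra Ω K] [IsScalarTower D Ω K], IsDomain (K ⊗[D] C)) :
    ∃ d : D, d ≠ 0 ∧ ∀ (K : Type u) [Field K] [Algebra D K], algebraMap D K d ≠ 0 →
      NoZeroDivisors (K ⊗[D] Localization.Away g) := by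
  obtain ⟨d, hd, H⟩ := BN hΩ P.f P.g (by
    intro K _ _
    let : Algebra D K := ((algebraMap Ω K).comp (algebraMap D Ω)).toAlgebra
    have : IsScalarTower D Ω K := IsScalarTower.of_algebraMap_eq' rfl
    have := h K
    let e := IsLocalization.Away.tensorProductEquivTMulRight D K g (Localization.Away g)
    have := noZD_loc ((1 : K) ⊗ₜ[D] g)
    have : NoZeroDivisors (K ⊗[D] Localization.Away g) :=
      e.injective.noZeroDivisors e (map_zero _) (map_mul _)
    exact NB_of_dom (algebraMap D K) (chart_CD P))
  refine ⟨d, hd, fun K _ _ hK => ?_⟩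
  exact noZD_of_NB (algebraMap D K) P.monic_f (chart_CD P) (H K (algebraMap D K) hK)

theorem tensor_nontriv {D K L : Type u} [CommRing D] [CommRing K] [CommRing L] [IsDomain K] [IsDomain L] [Algebra D K] [Algebra D L]
    (h : ∀ x, algebraMap D L x = 0 ↔ algebraMap D K x = 0) : Nontrivial (K ⊗[D] L) := by
  let D' := (algebraMap D K).range
  let φ : D' →+* L := (RingHom.liftOfSurjective (algebraMap D K).rangeRestrict (RingHom.rangeRestrict_surjective _))
    ⟨algebraMap D L, fun x hx => by
      rw [RingHom.mem_ker] at hx ⊢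
      have hx' : algebraMap D K x = 0 := congrArg Subtype.val hx
      exact (h x).2 hx'⟩
  let : Algebra D' L := φ.toAlgebra
  have hφ : ∀ x : D, φ ((algebraMap D K).rangeRestrict x) = algebraMap D L x := fun x =>
    RingHom.liftOfSurjective_comp_apply _ _ _ x
  have hφi : Function.Injective φ := by
    rw [injective_iff_map_eq_zero]
    intro x hx
    obtain ⟨x, rfl⟩ := (algebraMap D K).rangeRestrict_surjective x
    rw [hφ] at hx
    exact Subtype.ext ((h x).1 hx)
  have hnt : Nontrivial (K ⊗[D'] L) :=
    Algebra.TensorProduct.nontrivial_of_algebraMap_injective_of_isDomain D' K L Subtype.val_injective hφi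
  let ι : L →+* K ⊗[D'] L := (Algebra.TensorProduct.includeRight : L →ₐ[D'] K ⊗[D'] L).toRingHom
  let κ : K →ₐ[D] K ⊗[D'] L := Algebra.TensorProduct.includeLeft
  let ιa : L →ₐ[D] K ⊗[D'] L := { ι with
    commutes' := fun x => by
      have h1 : algebraMap D (K ⊗[D'] L) x = (algebraMap D K x) ⊗ₜ[D'] (1 : L) := rfl
      rw [h1]
      change (1 : K) ⊗ₜ[D'] (algebraMap D L x) = _
      rw [← hφ]
      have h2 : φ ((algebraMap D K).rangeRestrict x) = ((algebraMap D K).rangeRestrict x) • (1 : L) := by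
        rw [Algebra.smul_def, mul_one]; rfl
      rw [h2, ← TensorProduct.smul_tmul, Algebra.smul_def, mul_one]
      rfl }
  exact (Algebra.TensorProduct.lift κ ιa fun _ _ => mul_comm _ _).toRingHom.domain_nontrivial

theorem nonvanish {D C : Type u} [CommRing D] [IsDomain D] [CommRing C] [IsDomain C] [Algebra D C] [Algebra.Smooth D C]
    (g : C) (hg : g ≠ 0) :
    ∃ d : D, d ≠ 0 ∧ ∀ (K : Type u) [Field K] [Algebra D K], algebraMap D K d ≠ 0 →
      ¬ IsNilpotent ((1 : K) ⊗ₜ[D] g) := by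
  have : Module.Flat D C := Algebra.Smooth.flat D C
  have hinj : Function.Injective (algebraMap D C) := by
    exact FaithfulSMul.algebraMap_injective D C
  have hop : IsOpenMap (PrimeSpectrum.comap (algebraMap D C)) :=
    PrimeSpectrum.isOpenMap_comap_of_hasGoingDown_of_finitePresentation
  have h1 := hop _ (PrimeSpectrum.basicOpen g).2
  have h2 : (⟨⊥, Ideal.isPrime_bot⟩ : PrimeSpectrum D) ∈ PrimeSpectrum.comap (algebraMap D C) '' (PrimeSpectrum.basicOpen g : Set (PrimeSpectrum C)) := by
    refine ⟨⟨⊥, Ideal.isPrime_bot⟩, ?_, ?_⟩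
    · change g ∉ (⊥ : Ideal C)
      simpa using hg
    · ext x
      change algebraMap D C x ∈ (⊥ : Ideal C) ↔ x ∈ (⊥ : Ideal D)
      simp only [Ideal.mem_bot]
      exact map_eq_zero_iff _ hinj
  obtain ⟨_, ⟨d, rfl⟩, hd, hsub⟩ := PrimeSpectrum.isTopologicalBasis_basic_opens.isOpen_iff.1 h1 _ h2
  refine ⟨d, ?_, fun K _ _ hK hnil => ?_⟩
  · change d ∉ (⊥ : Ideal D) at hd
    simpa using hd
  obtain ⟨q, hq, hqp⟩ := hsub (a := ⟨RingHom.ker (algebraMap D K), RingHom.ker_isPrime _⟩) hK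
  have hqp' : ∀ x : D, algebraMap D C x ∈ q.asIdeal ↔ algebraMap D K x = 0 := by
    intro x
    have := congrArg (fun z => x ∈ z.asIdeal) hqp
    exact Iff.of_eq this
  have hnt : Nontrivial (K ⊗[D] (C ⧸ q.asIdeal)) := by
    refine tensor_nontriv fun x => ?_
    rw [← hqp']
    exact Ideal.Quotient.eq_zero_iff_mem
  have hd2 : IsDomain (C ⧸ q.asIdeal) := inferInstance
  let F := FractionRing (C ⧸ q.asIdeal)
  have hnt : Nontrivial (K ⊗[D] F) := by
    refine tensor_nontriv fun x => ?_
    rw [← hqp', IsScalarTower.algebraMap_apply D (C ⧸ q.asIdeal) F, map_eq_zero_iff _ (IsFractionRing.injective _ _)]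
    exact Ideal.Quotient.eq_zero_iff_mem
  have h3 := hnil.map (Algebra.TensorProduct.map (AlgHom.id D K) (IsScalarTower.toAlgHom D C F))
  rw [Algebra.TensorProduct.map_tmul] at h3
  have h4 : IsUnit ((1 : K) ⊗ₜ[D] (algebraMap C F g)) := by
    have hne : algebraMap C F g ≠ 0 := by
      rw [IsScalarTower.algebraMap_apply C (C ⧸ q.asIdeal) F, Ne, map_eq_zero_iff _ (IsFractionRing.injective _ _)]
      exact fun h => hq (Ideal.Quotient.eq_zero_iff_mem.1 h)
    exact (IsUnit.mk0 _ hne).map (Algebra.TensorProduct.includeRight (R := D) (A := K))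
  obtain ⟨k, hk⟩ := h3
  have h5 := h4.pow k
  have hk' : ((1 : K) ⊗ₜ[D] (algebraMap C F g)) ^ k = 0 := hk
  rw [hk'] at h5
  exact not_isUnit_zero h5

theorem chart_at {D C : Type u} [CommRing D] [CommRing C] [Algebra D C] [Algebra.Smooth D C] (q : Ideal C) [q.IsPrime] :
    ∃ f ∉ q, ∃ (n : ℕ) (_ : Algebra (MvPolynomial (Fin n) D) (Localization.Away f)),
      IsScalarTower D (MvPolynomial (Fin n) D) (Localization.Away f) ∧
      Algebra.IsStandardEtale (MvPolynomial (Fin n) D) (Localization.Away f) := by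
  have : Algebra.IsSmoothAt D q := by
    have : Algebra.FormallySmooth C (Localization.AtPrime q) := .of_isLocalization q.primeCompl
    exact Algebra.FormallySmooth.comp D C _
  exact Algebra.IsSmoothAt.exists_isStandardEtale_mvPolynomial

theorem gen_dom {D C Ω : Type u} [CommRing D] [IsDomain D] [CommRing C] [Algebra D C] [Algebra.Smooth D C] [Field Ω] [Algebra D Ω]
    (hΩ : Function.Injective (algebraMap D Ω))
    (h : ∀ (K : Type u) [Field K] [Algebra D K] [Algebra Ω K] [IsScalarTower D Ω K], IsDomain (K ⊗[D] C)) :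
    ∃ d : D, d ≠ 0 ∧ ∀ (K : Type u) [Field K] [Algebra D K], algebraMap D K d ≠ 0 →
      IsDomain (K ⊗[D] C) := by
  classical
  have hfl : Module.Flat D C := Algebra.Smooth.flat D C
  have hΩC := h Ω
  have hinj : Function.Injective (Algebra.TensorProduct.includeRight : C →ₐ[D] Ω ⊗[D] C) :=
    Algebra.TensorProduct.includeRight_injective hΩ
  have hC : IsDomain C := hinj.isDomain (Algebra.TensorProduct.includeRight : C →ₐ[D] Ω ⊗[D] C).toRingHom
  let G : Set C := {g | g ≠ 0 ∧ ∃ d : D, d ≠ 0 ∧ ∀ (K : Type u) [Field K] [Algebra D K], algebraMap D K d ≠ 0 →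
      NoZeroDivisors (K ⊗[D] Localization.Away g)}
  have hG : Ideal.span G = ⊤ := by
    by_contra H
    obtain ⟨m, hm, e⟩ := Ideal.exists_le_maximal _ H
    obtain ⟨f, hf, n, _, _, ⟨⟨P⟩⟩⟩ := chart_at (D := D) m
    refine hf (e (Ideal.subset_span ⟨?_, chart_gen hΩ f P h⟩))
    rintro rfl; exact hf m.zero_mem
  obtain ⟨S, hS, hS1⟩ := Submodule.mem_span_finite_of_mem_span (show (1 : C) ∈ Ideal.span G from hG ▸ Submodule.mem_top)
  have hS' : Ideal.span (S : Set C) = ⊤ := (Ideal.eq_top_iff_one _).2 hS1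
  choose d hd hdK using fun g : S => (hS g.2).2
  choose c hc hcK using fun g : S × S => nonvanish (D := D) (g.1.1 * g.2.1) (mul_ne_zero (hS g.1.2).1 (hS g.2.2).1)
  obtain ⟨c1, hc1, hc1K⟩ := nonvanish (D := D) (1 : C) one_ne_zero
  refine ⟨(∏ g, d g) * (∏ g, c g) * c1, ?_, fun K _ _ hK => ?_⟩
  · exact mul_ne_zero (mul_ne_zero (Finset.prod_ne_zero_iff.2 fun g _ => hd g) (Finset.prod_ne_zero_iff.2 fun g _ => hc g)) hc1
  rw [map_mul, map_mul, map_prod, map_prod] at hK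
  have hK1 := left_ne_zero_of_mul (left_ne_zero_of_mul hK)
  have hK2 := right_ne_zero_of_mul (left_ne_zero_of_mul hK)
  have hK3 := right_ne_zero_of_mul hK
  rw [Finset.prod_ne_zero_iff] at hK1 hK2
  have : NoZeroDivisors (K ⊗[D] C) := by
    refine glue ((Algebra.TensorProduct.includeRight : C →ₐ[D] K ⊗[D] C) '' S) ?_ ?_ ?_
    · have := congrArg (Ideal.map (Algebra.TensorProduct.includeRight : C →ₐ[D] K ⊗[D] C)) hS'
      rw [Ideal.map_span, Ideal.map_top] at this
      exact this
    · rintro _ ⟨g, hg, rfl⟩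
      have := hdK ⟨g, hg⟩ K (hK1 _ (Finset.mem_univ _))
      exact locND_of g
    · rintro _ ⟨g, hg, rfl⟩ _ ⟨g', hg', rfl⟩
      have := hcK (⟨g, hg⟩, ⟨g', hg'⟩) K (hK2 _ (Finset.mem_univ _))
      rw [← map_mul]
      exact this
  have : Nontrivial (K ⊗[D] C) := by
    by_contra hnt
    rw [not_nontrivial_iff_subsingleton] at hnt
    exact hc1K K hK3 ⟨1, Subsingleton.elim _ _⟩
  exact NoZeroDivisors.to_isDomain _

end RG

namespace RG
universe u
open TensorProduct
theorem red_etale {R S : Type u} [CommRing R] [IsDomain R] [CommRing S] [Algebra R S] [Algebra.Etale R S] : IsReduced S := by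
  have hfl : Module.Flat R S := Algebra.Smooth.flat R S
  have hinj : Function.Injective (Algebra.TensorProduct.includeRight : S →ₐ[R] FractionRing R ⊗[R] S) :=
    Algebra.TensorProduct.includeRight_injective (IsFractionRing.injective _ _)
  have : IsReduced (FractionRing R ⊗[R] S) := Algebra.FormallyUnramified.isReduced_of_field (FractionRing R) _
  exact isReduced_of_injective (Algebra.TensorProduct.includeRight : S →ₐ[R] FractionRing R ⊗[R] S) hinj

theorem red_smooth {k C : Type u} [Field k] [CommRing C] [Algebra k C] [Algebra.Smooth k C] : IsReduced C := by
  refine ⟨fun a ha => ?_⟩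
  by_contra h0
  have hne : Submodule.annihilator (Ideal.span {a}) ≠ ⊤ := by
    intro h
    have h2 : (1 : C) ∈ Submodule.annihilator (Ideal.span {a}) := h ▸ Submodule.mem_top
    rw [Submodule.mem_annihilator_span_singleton] at h2
    exact h0 (by simpa using h2)
  obtain ⟨m, hm, e⟩ := Ideal.exists_le_maximal _ hne
  obtain ⟨f, hf, n, _, _, _⟩ := chart_at (D := k) m
  have : IsReduced (Localization.Away f) := red_etale (R := MvPolynomial (Fin n) k)
  have h1 : algebraMap C (Localization.Away f) a = 0 := (ha.map (algebraMap C (Localization.Away f))).eq_zero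
  obtain ⟨⟨_, j, rfl⟩, hk⟩ := (IsLocalization.map_eq_zero_iff (Submonoid.powers f) _ _).1 h1
  have h3 : f ^ j ∈ Submodule.annihilator (Ideal.span {a}) := by
    rw [Submodule.mem_annihilator_span_singleton]; exact hk
  exact hf (hm.isPrime.mem_of_pow_mem j (e h3))

theorem dom_smooth {k C : Type u} [Field k] [CommRing C] [Algebra k C] [Algebra.Smooth k C] [IrreducibleSpace (PrimeSpectrum C)] :
    IsDomain C := by
  have := red_smooth (k := k) (C := C)
  have h : (nilradical C).IsPrime := PrimeSpectrum.irreducibleSpace_iff_isPrime_nilradical.1 inferInstance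
  rw [nilradical_eq_zero] at h
  exact IsDomain.of_bot_isPrime C

abbrev Gp (A B : Type u) [CommRing A] [CommRing B] [Algebra A B] : Prop :=
  ∀ (K : Type u) [Field K] [Algebra A K], IsDomain (K ⊗[A] B)

theorem G_of_irr {A B : Type u} [CommRing A] [CommRing B] [Algebra A B] [Algebra.Smooth A B]
    (hirr : ∀ (p : Ideal A) [p.IsPrime], ∀ (K : Type u) [Field K] [Algebra (IsLocalRing.ResidueField (Localization.AtPrime p)) K], IrreducibleSpace (PrimeSpectrum (K ⊗[IsLocalRing.ResidueField (Localization.AtPrime p)] ((IsLocalRing.ResidueField (Localization.AtPrime p)) ⊗[A] B)))) :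
    Gp A B := by
  intro K _ _
  let p := RingHom.ker (algebraMap A K)
  have hp : p.IsPrime := RingHom.ker_isPrime _
  let κ := IsLocalRing.ResidueField (Localization.AtPrime p)
  let φ : κ →ₐ[A] K := Ideal.ResidueField.liftₐ p (Algebra.ofId A K) le_rfl (fun x hx => IsUnit.mk0 _ hx)
  let : Algebra κ K := φ.toRingHom.toAlgebra
  have : IsScalarTower A κ K := IsScalarTower.of_algebraMap_eq' φ.comp_algebraMap.symm
  have := hirr p K
  let e := Algebra.TensorProduct.cancelBaseChange A κ κ K B
  have h1 : IsDomain (K ⊗[κ] (κ ⊗[A] B)) := dom_smooth (k := K)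
  exact e.symm.toMulEquiv.isDomain _

end RG

namespace RG
universe u
open TensorProduct
theorem gen_step {A₀ A B₀ : Type u} [CommRing A₀] [CommRing A] [CommRing B₀] [Algebra A₀ A]
    [Algebra A₀ B₀] [Algebra.Smooth A₀ B₀]
    (hG : ∀ (K : Type u) [Field K] [Algebra A₀ K] [Algebra A K] [IsScalarTower A₀ A K], IsDomain (K ⊗[A₀] B₀))
    (J : Ideal A₀) [J.IsPrime] (q : Ideal A) [q.IsPrime] (hq : q.comap (algebraMap A₀ A) = J) :
    ∃ d : A₀, d ∉ J ∧ ∀ (K : Type u) [Field K] [Algebra A₀ K], (∀ x ∈ J, algebraMap A₀ K x = 0) → algebraMap A₀ K d ≠ 0 →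
      IsDomain (K ⊗[A₀] B₀) := by
  let D := A₀ ⧸ J
  let Ω := q.ResidueField
  let ψ : D →ₐ[A₀] Ω := Ideal.Quotient.liftₐ J (Algebra.ofId A₀ Ω) (fun x hx => by
    change algebraMap A₀ Ω x = 0
    rw [IsScalarTower.algebraMap_apply A₀ A Ω, Ideal.algebraMap_residueField_eq_zero]
    rw [← hq] at hx; exact hx)
  let : Algebra D Ω := ψ.toRingHom.toAlgebra
  have : IsScalarTower A₀ D Ω := IsScalarTower.of_algebraMap_eq' ψ.comp_algebraMap.symm
  have hinj : Function.Injective (algebraMap D Ω) := by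
    rw [injective_iff_map_eq_zero]
    intro x hx
    obtain ⟨x, rfl⟩ := Ideal.Quotient.mk_surjective x
    have h1 : algebraMap A₀ Ω x = 0 := by
      rw [IsScalarTower.algebraMap_apply A₀ D Ω]; exact hx
    rw [IsScalarTower.algebraMap_apply A₀ A Ω, Ideal.algebraMap_residueField_eq_zero] at h1
    exact Ideal.Quotient.eq_zero_iff_mem.2 (by rw [← hq]; exact h1)
  obtain ⟨d, hd, H⟩ := gen_dom (D := D) (C := D ⊗[A₀] B₀) (Ω := Ω) hinj (by
    intro K _ _ _ _
    let : Algebra A₀ K := ((algebraMap D K).comp (algebraMap A₀ D)).toAlgebra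
    have : IsScalarTower A₀ D K := IsScalarTower.of_algebraMap_eq' rfl
    let : Algebra A K := ((algebraMap Ω K).comp (algebraMap A Ω)).toAlgebra
    have : IsScalarTower A₀ A K := by
      refine IsScalarTower.of_algebraMap_eq' ?_
      change (algebraMap D K).comp (algebraMap A₀ D) = ((algebraMap Ω K).comp (algebraMap A Ω)).comp (algebraMap A₀ A)
      rw [RingHom.comp_assoc, ← IsScalarTower.algebraMap_eq A₀ A Ω, IsScalarTower.algebraMap_eq D Ω K,
        RingHom.comp_assoc, ← IsScalarTower.algebraMap_eq A₀ D Ω]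
    have := hG K
    exact (Algebra.TensorProduct.cancelBaseChange A₀ D D K B₀).toMulEquiv.isDomain _)
  obtain ⟨d, rfl⟩ := Ideal.Quotient.mk_surjective d
  refine ⟨d, fun h => hd (Ideal.Quotient.eq_zero_iff_mem.2 h), fun K _ _ hJ hdK => ?_⟩
  let χ : D →ₐ[A₀] K := Ideal.Quotient.liftₐ J (Algebra.ofId A₀ K) hJ
  let : Algebra D K := χ.toRingHom.toAlgebra
  have : IsScalarTower A₀ D K := IsScalarTower.of_algebraMap_eq' χ.comp_algebraMap.symm
  have := H K (by
    change algebraMap D K (algebraMap A₀ D d) ≠ 0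
    rw [← IsScalarTower.algebraMap_apply]; exact hdK)
  exact (Algebra.TensorProduct.cancelBaseChange A₀ D D K B₀).symm.toMulEquiv.isDomain _

theorem noeth_ind {A₀ A B₀ : Type u} [CommRing A₀] [IsNoetherianRing A₀] [CommRing A] [CommRing B₀] [Algebra A₀ A]
    [Algebra A₀ B₀] [Algebra.Smooth A₀ B₀]
    (hG : ∀ (K : Type u) [Field K] [Algebra A₀ K] [Algebra A K] [IsScalarTower A₀ A K], IsDomain (K ⊗[A₀] B₀))
    (J : Ideal A₀) : ∃ s : Finset A, ∀ (K : Type u) [Field K] [Algebra A₀ K],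
      (Algebra.adjoin A₀ (s : Set A) →ₐ[A₀] K) → (∀ x ∈ J, algebraMap A₀ K x = 0) → IsDomain (K ⊗[A₀] B₀) := by
  classical
  induction J using WellFoundedGT.induction with
  | ind J ih =>
  have hmono : ∀ s t : Finset A, s ⊆ t → ∀ (K : Type u) [Field K] [Algebra A₀ K],
      (Algebra.adjoin A₀ (t : Set A) →ₐ[A₀] K) → (Algebra.adjoin A₀ (s : Set A) →ₐ[A₀] K) := by
    intro s t hst K _ _ φ
    exact φ.comp (Subalgebra.inclusion (Algebra.adjoin_mono (by exact_mod_cast hst)))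
  have hsup : ∀ (a : A₀) (K : Type u) [Field K] [Algebra A₀ K], (∀ x ∈ J, algebraMap A₀ K x = 0) → algebraMap A₀ K a = 0 →
      ∀ x ∈ J ⊔ Ideal.span {a}, algebraMap A₀ K x = 0 := by
    intro a K _ _ h1 h2 x hx
    have : J ⊔ Ideal.span {a} ≤ RingHom.ker (algebraMap A₀ K) :=
      sup_le (fun x hx => h1 x hx) ((Ideal.span_singleton_le_iff_mem _).2 h2)
    exact this hx
  have hlt : ∀ a ∉ J, J < J ⊔ Ideal.span {a} := by
    intro a ha
    refine lt_of_le_of_ne le_sup_left fun h => ha ?_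
    rw [h]; exact Ideal.mem_sup_right (Ideal.mem_span_singleton_self a)
  by_cases htop : J = ⊤
  · refine ⟨∅, fun K _ _ _ hJ => ?_⟩
    have := hJ 1 (htop ▸ Submodule.mem_top)
    simp at this
  by_cases hp : J.IsPrime
  · by_cases hc : (J.map (algebraMap A₀ A)).comap (algebraMap A₀ A) = J
    · obtain ⟨q, hqp, hq⟩ := (Ideal.comap_map_eq_self_iff_of_isPrime (f := algebraMap A₀ A) J).1 hc
      obtain ⟨d, hd, H⟩ := gen_step hG J q hq
      obtain ⟨s, hs⟩ := ih _ (hlt d hd)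
      refine ⟨s, fun K _ _ φ hJ => ?_⟩
      by_cases h0 : algebraMap A₀ K d = 0
      · exact hs K φ (hsup d K hJ h0)
      · exact H K hJ h0
    · have : ∃ d, d ∉ J ∧ algebraMap A₀ A d ∈ J.map (algebraMap A₀ A) := by
        by_contra! H
        refine hc (le_antisymm (fun x hx => ?_) Ideal.le_comap_map)
        by_contra hx'
        exact H x hx' hx
      obtain ⟨d, hd, hdm⟩ := this
      obtain ⟨m, f, g, hfg⟩ := Submodule.mem_span_set'.1 hdm
      have hg : ∀ i, ∃ p ∈ J, algebraMap A₀ A p = g i := fun i => (g i).2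
      choose p hp hpg using hg
      obtain ⟨s, hs⟩ := ih _ (hlt d hd)
      refine ⟨s ∪ Finset.univ.image f, fun K _ _ φ hJ => ?_⟩
      refine hs K (hmono _ _ Finset.subset_union_left K φ) (hsup d K hJ ?_)
      have hmem : ∀ i, f i ∈ Algebra.adjoin A₀ ((s ∪ Finset.univ.image f : Finset A) : Set A) := fun i =>
        Algebra.subset_adjoin (by simp)
      have : algebraMap A₀ (Algebra.adjoin A₀ ((s ∪ Finset.univ.image f : Finset A) : Set A)) d =
          ∑ i, ⟨f i, hmem i⟩ * algebraMap A₀ _ (p i) := by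
        apply Subtype.ext
        rw [AddSubmonoidClass.coe_finsetSum]
        change algebraMap A₀ A d = _
        rw [← hfg]
        refine Finset.sum_congr rfl fun i _ => ?_
        rw [← hpg i]; rfl
      have h2 := congrArg φ this
      rw [AlgHom.commutes, map_sum] at h2
      rw [h2]
      refine Finset.sum_eq_zero fun i _ => ?_
      rw [map_mul, AlgHom.commutes, hJ _ (hp i), mul_zero]
  · rw [Ideal.isPrime_iff] at hp
    push Not at hp
    obtain ⟨a, b, hab, ha, hb⟩ := hp htop
    obtain ⟨s, hs⟩ := ih _ (hlt a ha)
    obtain ⟨t, ht⟩ := ih _ (hlt b hb)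
    refine ⟨s ∪ t, fun K _ _ φ hJ => ?_⟩
    have := hJ _ hab
    rw [map_mul, mul_eq_zero] at this
    rcases this with h | h
    · exact hs K (hmono _ _ Finset.subset_union_left K φ) (hsup a K hJ h)
    · exact ht K (hmono _ _ Finset.subset_union_right K φ) (hsup b K hJ h)

theorem descent {A B : Type u} [CommRing A] [CommRing B] [Algebra A B] [Algebra.Smooth A B] (hG : Gp A B) :
    ∃ (A₁ B₁ : Type u) (_ : CommRing A₁) (_ : CommRing B₁) (_ : Algebra A₁ A) (_ : Algebra A₁ B₁),
      IsNoetherianRing A₁ ∧ Algebra.Smooth A₁ B₁ ∧ Gp A₁ B₁ ∧ Nonempty (B ≃ₐ[A] A ⊗[A₁] B₁) := by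
  obtain ⟨A₀, B₀, _, _, _, _, _, _, hft, hsm, ⟨e⟩⟩ := Algebra.Smooth.exists_finiteType ℤ A B
  have : IsNoetherianRing A₀ := Algebra.FiniteType.isNoetherianRing ℤ A₀
  have hG' : ∀ (K : Type u) [Field K] [Algebra A₀ K] [Algebra A K] [IsScalarTower A₀ A K], IsDomain (K ⊗[A₀] B₀) := by
    intro K _ _ _ _
    have := hG K
    have e1 : K ⊗[A] B ≃ₐ[A] K ⊗[A] (A ⊗[A₀] B₀) := Algebra.TensorProduct.congr AlgEquiv.refl e
    have e2 := Algebra.TensorProduct.cancelBaseChange A₀ A A K B₀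
    exact (e1.trans e2).symm.toMulEquiv.isDomain _
  obtain ⟨s, hs⟩ := noeth_ind hG' ⊥
  let A₁ := Algebra.adjoin A₀ (s : Set A)
  refine ⟨A₁, A₁ ⊗[A₀] B₀, inferInstance, inferInstance, inferInstance, inferInstance, ?_, inferInstance, ?_, ?_⟩
  · have : Algebra.FiniteType A₀ A₁ := A₁.fg_iff_finiteType.1 ⟨s, rfl⟩
    exact Algebra.FiniteType.isNoetherianRing A₀ A₁
  · intro K _ _
    let : Algebra A₀ K := ((algebraMap A₁ K).comp (algebraMap A₀ A₁)).toAlgebra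
    have : IsScalarTower A₀ A₁ K := IsScalarTower.of_algebraMap_eq' rfl
    have := hs K (IsScalarTower.toAlgHom A₀ A₁ K) (by
      intro x hx; rw [(Submodule.mem_bot _).1 hx, map_zero])
    exact (Algebra.TensorProduct.cancelBaseChange A₀ A₁ A₁ K B₀).toMulEquiv.isDomain _
  · exact ⟨e.trans (Algebra.TensorProduct.cancelBaseChange A₀ A₁ A A B₀).symm⟩

end RG

namespace RG
universe u
open TensorProduct
theorem rank1_free {A M : Type u} [CommRing A] [AddCommGroup M] [Module A M] [Module.Projective A M] (e : M)
    (h1 : ∀ m : Ideal A, m.IsMaximal → e ∉ (m • ⊤ : Submodule A M))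
    (h2 : ∀ m : Ideal A, m.IsMaximal → ∀ b : M, ∃ a : A, b - a • e ∈ (m • ⊤ : Submodule A M)) : Module.Free A M := by
  classical
  obtain ⟨s, hs⟩ := Module.projective_def'.1 (inferInstance : Module.Projective A M)
  have hs' : ∀ b, b = (s b).sum fun i a => a • i := fun b => (LinearMap.congr_fun hs b).symm
  have hf : ∀ (m : Ideal A) (f : M →ₗ[A] A) (b : M), b ∈ (m • ⊤ : Submodule A M) → f b ∈ m := by
    intro m f b hb
    refine Submodule.smul_induction_on hb ?_ ?_
    · intro r hr x _
      rw [map_smul, smul_eq_mul]; exact m.mul_mem_right _ hr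
    · intro x y hx hy; rw [map_add]; exact m.add_mem hx hy
  obtain ⟨φ, hφ⟩ : ∃ φ : M →ₗ[A] A, φ e = 1 := by
    let I : Ideal A := LinearMap.range (LinearMap.applyₗ (R := A) (M₂ := A) e)
    by_cases hI : I = ⊤
    · obtain ⟨φ, hφ⟩ : (1 : A) ∈ I := hI ▸ Submodule.mem_top
      exact ⟨φ, hφ⟩
    · obtain ⟨m, hm, hle⟩ := Ideal.exists_le_maximal I hI
      exfalso
      refine h1 m hm ?_
      rw [hs' e]
      refine Submodule.sum_mem _ fun i _ => Submodule.smul_mem_smul (hle ?_) trivial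
      exact ⟨Finsupp.lapply i ∘ₗ s, rfl⟩
  have hQ : ∀ b : M, φ b = 0 → ∀ m : Ideal A, m.IsMaximal → b ∈ (m • ⊤ : Submodule A M) := by
    intro b hb m hm
    obtain ⟨a, ha⟩ := h2 m hm b
    have h3 := hf m φ _ ha
    rw [map_sub, hb, map_smul, hφ, zero_sub, smul_eq_mul, mul_one, neg_mem_iff] at h3
    have : a • e ∈ (m • ⊤ : Submodule A M) := Submodule.smul_mem_smul h3 trivial
    simpa using Submodule.add_mem _ ha this
  have hJ : ∀ b : M, φ b = 0 → ∀ f : M →ₗ[A] A, f b ∈ Ideal.jacobson (⊥ : Ideal A) := by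
    intro b hb f
    rw [Ideal.jacobson, Ideal.mem_sInf]
    rintro m ⟨-, hm⟩
    exact hf m f b (hQ b hb m hm)
  have hQ0 : ∀ b : M, φ b = 0 → b = 0 := by
    intro b hb
    let N : Ideal A := Ideal.span (((s b).support.image (s b) : Finset A) : Set A)
    have hmem : ∀ i, s b i ∈ N := by
      intro i
      by_cases hi : i ∈ (s b).support
      · exact Ideal.subset_span (by simpa using ⟨i, by simpa using hi, rfl⟩)
      · rw [Finsupp.notMem_support_iff.1 hi]; exact N.zero_mem
    have hN : N = ⊥ := by
      refine Submodule.eq_bot_of_le_smul_of_le_jacobson_bot (Ideal.jacobson ⊥) N ⟨_, rfl⟩ ?_ le_rfl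
      refine Ideal.span_le.2 ?_
      intro x hx
      obtain ⟨j, -, rfl⟩ := Finset.mem_image.1 hx
      have hb2 : b = (s b).sum fun i a => a • (i - φ i • e) := by
        have h3 : φ ((s b).sum fun i a => a • i) = 0 := by rw [← hs' b]; exact hb
        simp only [Finsupp.sum, map_sum, map_smul, smul_eq_mul] at h3
        conv_lhs => rw [hs' b]
        simp only [Finsupp.sum, smul_sub, Finset.sum_sub_distrib, smul_smul, ← Finset.sum_smul]
        rw [h3, zero_smul, sub_zero]
      have h4 : s b j = (s b).sum fun i a => a * s (i - φ i • e) j := by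
        conv_lhs => rw [hb2]
        simp only [Finsupp.sum, map_sum, map_smul, Finsupp.finsetSum_apply, Finsupp.smul_apply, smul_eq_mul]
      rw [SetLike.mem_coe, h4]
      refine Submodule.sum_mem _ fun i _ => ?_
      dsimp only
      rw [mul_comm]
      refine Submodule.smul_mem_smul ?_ (hmem i)
      refine hJ (i - φ i • e) ?_ (Finsupp.lapply j ∘ₗ s)
      rw [map_sub, map_smul, hφ, smul_eq_mul, mul_one, sub_self]
    rw [hs' b]
    refine Finset.sum_eq_zero fun i _ => ?_
    have := hmem i
    rw [hN, Submodule.mem_bot] at this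
    rw [this]
    exact zero_smul _ _
  have hbij : Function.Bijective φ := by
    refine ⟨(injective_iff_map_eq_zero φ).2 hQ0, fun a => ⟨a • e, by rw [map_smul, hφ, smul_eq_mul, mul_one]⟩⟩
  exact Module.Free.of_equiv (LinearEquiv.ofBijective φ hbij).symm

theorem quot_zero {A M : Type u} [CommRing A] [AddCommGroup M] [Module A M] (m : Ideal A) (z : M)
    : (1 : A ⧸ m) ⊗ₜ[A] z = 0 ↔ z ∈ (m • ⊤ : Submodule A M) := by
  rw [← TensorProduct.quotTensorEquivQuotSMul_symm_mk, LinearEquiv.map_eq_zero_iff, Submodule.Quotient.mk_eq_zero]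

theorem count_gen {A B : Type u} [CommRing A] [CommRing B] [Algebra A B] [Algebra.FiniteType A B] :
    ∃ x : ℕ → B, Submodule.span A (Set.range x) = ⊤ := by
  obtain ⟨n, f, hf⟩ := Algebra.FiniteType.iff_quotient_mvPolynomial''.1 (inferInstance : Algebra.FiniteType A B)
  obtain ⟨e, he⟩ := exists_surjective_nat (Fin n →₀ ℕ)
  refine ⟨fun k => f (MvPolynomial.monomial (e k) 1), ?_⟩
  rw [eq_top_iff]
  rintro b -
  obtain ⟨p, rfl⟩ := hf b
  rw [p.as_sum, map_sum]
  refine Submodule.sum_mem _ fun v _ => ?_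
  obtain ⟨k, rfl⟩ := he v
  have : MvPolynomial.monomial (e k) (p.coeff (e k)) = (p.coeff (e k)) • MvPolynomial.monomial (e k) (1 : A) := by
    rw [MvPolynomial.smul_monomial, smul_eq_mul, mul_one]
  rw [this, map_smul]
  exact Submodule.smul_mem _ _ (Submodule.subset_span ⟨k, rfl⟩)

theorem fib_surj {k T : Type u} [Field k] [CommRing T] [Algebra k T] [Module.Finite k T]
    (h : IsDomain (AlgebraicClosure k ⊗[k] T)) : Nontrivial T ∧ ∀ t : T, ∃ c : k, c • (1 : T) = t := by
  have hb := IsAlgClosed.algebraMap_bijective_of_isIntegral (k := AlgebraicClosure k) (K := AlgebraicClosure k ⊗[k] T)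
  have h1 : Module.finrank (AlgebraicClosure k) (AlgebraicClosure k ⊗[k] T) = 1 := by
    have e : AlgebraicClosure k ≃ₗ[AlgebraicClosure k] AlgebraicClosure k ⊗[k] T :=
      (AlgEquiv.ofBijective (Algebra.ofId (AlgebraicClosure k) (AlgebraicClosure k ⊗[k] T)) hb).toLinearEquiv
    rw [← e.finrank_eq, Module.finrank_self]
  rw [Module.finrank_baseChange] at h1
  have hn : Nontrivial T := Module.nontrivial_of_finrank_eq_succ (n := 0) h1
  exact ⟨hn, (finrank_eq_one_iff_of_nonzero' (1 : T) one_ne_zero).1 h1⟩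

theorem main {A B : Type u} [CommRing A] [CommRing B] [Algebra A B] [Algebra.Smooth A B] (n : ℕ) (hG : Gp A B)
    (hdim : ∀ (p : Ideal A) [p.IsPrime], ringKrullDim ((IsLocalRing.ResidueField (Localization.AtPrime p)) ⊗[A] B) = n) :
    Module.Free A B := by
  obtain ⟨A₁, B₁, _, _, _, _, hN, hS, hG1, ⟨e⟩⟩ := descent hG
  obtain ⟨x, hx⟩ := count_gen (A := A₁) (B := B₁)
  have hP : Module.Projective A₁ B₁ := proj_of_G hG1 x hx
  have hPB : Module.Projective A B := Module.Projective.of_equiv e.symm.toLinearEquiv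
  have hdim' : ∀ (m : Ideal A), m.IsMaximal → ringKrullDim ((A ⧸ m) ⊗[A] B) = n := by
    intro m hm
    rw [← hdim m]
    let e1 : (A ⧸ m) ≃ₐ[A] m.ResidueField :=
      AlgEquiv.ofBijective (IsScalarTower.toAlgHom A (A ⧸ m) m.ResidueField) m.bijective_algebraMap_quotient_residueField
    exact ringKrullDim_eq_of_ringEquiv (Algebra.TensorProduct.congr e1 (AlgEquiv.refl (A₁ := B))).toRingEquiv
  have hfin : ∀ (m : Ideal A), m.IsMaximal → (Module.Finite (A ⧸ m) ((A ⧸ m) ⊗[A] B) ↔ n = 0) := by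
    intro m hm
    let : Field (A ⧸ m) := Ideal.Quotient.field m
    rw [Module.finite_iff_krullDimLE_zero, Ring.krullDimLE_iff, hdim' m hm]
    norm_cast
    exact Nat.le_zero
  rcases Nat.eq_zero_or_pos n with h0 | h0
  · refine rank1_free (1 : B) ?_ ?_ <;> intro m hm
    all_goals
      let : Field (A ⧸ m) := Ideal.Quotient.field m
      have := (hfin m hm).2 h0
      have hd : IsDomain (AlgebraicClosure (A ⧸ m) ⊗[A ⧸ m] ((A ⧸ m) ⊗[A] B)) := by
        have := hG (AlgebraicClosure (A ⧸ m))
        exact (Algebra.TensorProduct.cancelBaseChange A (A ⧸ m) (A ⧸ m) (AlgebraicClosure (A ⧸ m)) B).toMulEquiv.isDomain _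
      obtain ⟨hn, hs⟩ := fib_surj hd
    · rw [← quot_zero]
      exact one_ne_zero
    · intro b
      obtain ⟨c, hc⟩ := hs (1 ⊗ₜ b)
      obtain ⟨a, rfl⟩ := Ideal.Quotient.mk_surjective c
      refine ⟨a, ?_⟩
      rw [← quot_zero, tmul_sub, sub_eq_zero, ← hc, tmul_smul]
      rfl
  · obtain ⟨s, hs⟩ := bass_surj (A := A) x hx (by
      intro m hm hf
      refine h0.ne' ((hfin m hm).1 ?_)
      have e2 : (A ⧸ m) ⊗[A] B ≃ₐ[A ⧸ m] (A ⧸ m) ⊗[A] (A ⊗[A₁] B₁) := Algebra.TensorProduct.congr AlgEquiv.refl e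
      have e3 := Algebra.TensorProduct.cancelBaseChange A₁ A (A ⧸ m) (A ⧸ m) B₁
      exact Module.Finite.equiv (e2.trans e3).symm.toLinearEquiv)
    have hfree : Module.Free A (A ⊗[A₁] B₁) := by
      refine swindle (fun k => (1 : A) ⊗ₜ[A₁] x k) ?_ s hs
      have := Submodule.baseChange_span (R := A₁) (A := A) (M := B₁) (Set.range x)
      rw [hx, Submodule.baseChange_top] at this
      rw [this, ← Set.range_comp]
      rfl
    exact Module.Free.of_equiv e.symm.toLinearEquiv

end RG

open TensorProduct

/-- (Raynaud–Gruson) Let `A → B` be a smooth ring homomorphism all of whose fibers are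
geometrically irreducible of the same dimension `n`.  Then `B` is a free `A`-module. -/
theorem free_of_smooth_geometrically_irreducible_fibers
    {A B : Type u} [CommRing A] [CommRing B] [Algebra A B] [Algebra.Smooth A B] (n : ℕ)
    (hirr : ∀ (p : Ideal A) [p.IsPrime],
      ∀ (K : Type u) [Field K]
        [Algebra (IsLocalRing.ResidueField (Localization.AtPrime p)) K],
        IrreducibleSpace (PrimeSpectrum
          (K ⊗[IsLocalRing.ResidueField (Localization.AtPrime p)]
            ((IsLocalRing.ResidueField (Localization.AtPrime p)) ⊗[A] B))))
    (hdim : ∀ (p : Ideal A) [p.IsPrime],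
      ringKrullDim ((IsLocalRing.ResidueField (Localization.AtPrime p)) ⊗[A] B) = n) :
    Module.Free A B := by
  exact RG.main n (RG.G_of_irr hirr) hdim
end

section
/- Let $(A, \mathfrak m)$ be a Noetherian local ring, let $M$ be a finitely generated $A$-module, and let $r \geq 0$. Suppose the $r$-th Fitting ideal of $M$ is generated by a nonzerodivisor $f \in A$, and suppose that for every associated prime $\mathfrak p$ of $A$, the localization $M_\mathfrak p$ is a free $A_\mathfrak p$-module of rank $r$. Let $N \subseteq M$ be the submodule of elements annihilated by the $r$-th Fitting ideal of $M$. Then $M/N$ is a free $A$-module of rank $r$. -/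
/-- The `r`-th Fitting ideal attached to a presentation
`A^{(ι)} --u--> Aⁿ → M → 0`. -/
noncomputable def fittingIdealOfPresentation {A : Type*} [CommRing A] {ι : Type*} {n : ℕ}
    (u : (ι →₀ A) →ₗ[A] (Fin n → A)) (r : ℕ) : Ideal A :=
  if n ≤ r then ⊤ else
    Ideal.span {d | ∃ (rows : Fin (n - r) → Fin n) (cols : Fin (n - r) → ι),
      d = Matrix.det (Matrix.of fun i j => u (Finsupp.single (cols j) 1) (rows i))}

open Matrix

theorem aux1 {A : Type*} [CommRing A] [IsNoetherianRing A] [Nontrivial A]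
    {M : Type*} [AddCommGroup M] [Module A M] [Module.Finite A M] (C : Type*) [Fintype C] 
    (f : A) (hf : f ∈ nonZeroDivisors A)
    (hAss : ∀ p ∈ associatedPrimes A A, ∀ (_ : p.IsPrime),
      Module.Free (Localization p.primeCompl) (LocalizedModule p.primeCompl M) ∧
      Module.finrank (Localization p.primeCompl) (LocalizedModule p.primeCompl M) = Fintype.card C)
    (φ : (C → A) →ₗ[A] M) (hφ : ∀ m, ∃ y, f • m = f • φ y) (x : C → A) (hx : f • φ x = 0) :
    x = 0 := by
  have key : ∀ p ∈ associatedPrimes A A, ∃ s ∉ p, s • x = 0 := by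
    intro p hp
    have hpp : p.IsPrime := hp.1
    obtain ⟨hfree, hrk⟩ := hAss p hp hpp
    have hfp : f ∈ p.primeCompl := by
      intro h
      have h2 : f ∈ ⋃ p ∈ associatedPrimes A A, (p : Set A) := Set.mem_iUnion₂_of_mem hp h
      rw [biUnion_associatedPrimes_eq_compl_nonZeroDivisors] at h2
      exact h2 hf
    set S := p.primeCompl with hS
    let g := IsLocalizedModule.mapExtendScalars S (LocalizedModule.mkLinearMap S (C → A))
      (LocalizedModule.mkLinearMap S M) (Localization S) φ
    have hg : Function.Surjective g := by
      intro m
      induction m using LocalizedModule.induction_on with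
      | h m s =>
        obtain ⟨y, hy⟩ := hφ m
        refine ⟨LocalizedModule.mk y s, ?_⟩
        have : g (LocalizedModule.mk y s) = LocalizedModule.mk (φ y) s := by
          exact LocalizedModule.map_mk ..
        rw [this, LocalizedModule.mk_eq]
        refine ⟨⟨f, hfp⟩, ?_⟩
        simp only [Submonoid.smul_def]
        rw [smul_comm f, smul_comm f, hy]
    have : IsNoetherianRing (Localization S) := IsLocalization.isNoetherianRing S _ ‹_›
    have e1 : Module.Free (Localization S) (LocalizedModule S (C → A)) :=
      Module.free_of_isLocalizedModule S (LocalizedModule.mkLinearMap S (C → A))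
    have e2 : Module.finrank (Localization S) (LocalizedModule S (C → A)) = Fintype.card C := by
      have := Module.finrank_of_isLocalizedModule_of_free (Localization S) S (LocalizedModule.mkLinearMap S (C → A))
      simpa using this
    have hinj : Function.Injective g := by
      let e := LinearEquiv.ofFinrankEq _ _ (hrk.trans e2.symm)
      have := OrzechProperty.injective_of_surjective_endomorphism (e.toLinearMap ∘ₗ g) (e.surjective.comp hg)
      exact Function.Injective.of_comp this
    have h0 : g (LocalizedModule.mk x 1) = g 0 := by
      rw [map_zero]
      have : g (LocalizedModule.mk x 1) = LocalizedModule.mk (φ x) 1 := LocalizedModule.map_mk ..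
      rw [this]
      rw [← LocalizedModule.zero_mk (1 : S), LocalizedModule.mk_eq]
      exact ⟨⟨f, hfp⟩, by simpa [Submonoid.smul_def] using hx⟩
    have h1 := hinj h0
    rw [← LocalizedModule.zero_mk (1 : S), LocalizedModule.mk_eq] at h1
    obtain ⟨s, hs⟩ := h1
    exact ⟨s, s.2, by simpa [Submonoid.smul_def] using hs⟩
  ext i
  by_contra hne
  obtain ⟨p, hp, hle⟩ := exists_le_isAssociatedPrime_of_isNoetherianRing A (x i) hne
  obtain ⟨s, hs, h⟩ := key p hp
  apply hs
  apply hle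
  have := congrFun h i
  simpa [Submodule.mem_colon_singleton] using this

theorem aux2 {A : Type*} [CommRing A] [IsNoetherianRing A] [Nontrivial A]
    {M : Type*} [AddCommGroup M] [Module A M] [Module.Finite A M] (C : Type*) [Fintype C] 
    (f : A) (hf : f ∈ nonZeroDivisors A)
    (hAss : ∀ p ∈ associatedPrimes A A, ∀ (_ : p.IsPrime),
      Module.Free (Localization p.primeCompl) (LocalizedModule p.primeCompl M) ∧
      Module.finrank (Localization p.primeCompl) (LocalizedModule p.primeCompl M) = Fintype.card C)
    (φ : (C → A) →ₗ[A] M) (hφ : ∀ m, ∃ y, f • m = f • φ y) (I : Ideal A) (hI : I = Ideal.span {f}) :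
    Module.Free A (M ⧸ Submodule.torsionBySet A M (I : Set A)) ∧
      Module.finrank A (M ⧸ Submodule.torsionBySet A M (I : Set A)) = Fintype.card C := by
  have hmem : ∀ m, m ∈ Submodule.torsionBySet A M (I : Set A) ↔ f • m = 0 := by
    intro m
    rw [hI, ← Submodule.torsionBySet_eq_torsionBySet_span, Submodule.torsionBySet_singleton_eq,
      Submodule.mem_torsionBy_iff]
  let e := LinearEquiv.ofBijective ((Submodule.mkQ (Submodule.torsionBySet A M (I : Set A))) ∘ₗ φ) (by
    constructor
    · rw [← LinearMap.ker_eq_bot, LinearMap.ker_eq_bot']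
      intro x hx
      refine aux1 C f hf hAss φ hφ x ?_
      rw [← hmem]
      simpa using hx
    · intro m
      obtain ⟨m, rfl⟩ := Submodule.mkQ_surjective _ m
      obtain ⟨y, hy⟩ := hφ m
      refine ⟨y, ?_⟩
      simp only [LinearMap.comp_apply, Submodule.mkQ_apply]
      rw [Submodule.Quotient.eq, hmem, smul_sub, hy, sub_self])
  exact ⟨Module.Free.of_equiv e, by rw [← e.finrank_eq]; simp⟩

theorem aux3 {A : Type*} [CommRing A] {k n : ℕ} (V : Matrix (Fin n) (Fin k) A)
    (rows : Fin k → Fin n) (hd : (V.submatrix rows id).det ∈ nonZeroDivisors A)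
    (hdiv : ∀ rows' : Fin k → Fin n, (V.submatrix rows id).det ∣ (V.submatrix rows' id).det)
    (x : Fin n → A) : ∃ (z : Fin n → A) (y : Fin k → A), (∀ j, z (rows j) = 0) ∧
      (V.submatrix rows id).det • x = (V.submatrix rows id).det • z + V *ᵥ y := by
  classical
  set B := V.submatrix rows id with hB
  have hc : ∀ i j, (V * B.adjugate) i j = (V.submatrix (Function.update rows j i) id).det := by
    intro i j
    have h1 : V.submatrix (Function.update rows j i) id = B.updateRow j (V i) := by
      ext a b
      by_cases h : a = j
      · subst h; simp
      · simp [h, hB]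
    rw [h1, ← cramer_transpose_apply, cramer_eq_adjugate_mulVec, ← adjugate_transpose, mulVec_transpose]
    rfl
  choose c hc' using fun i j => hdiv (Function.update rows j i)
  let W : Matrix (Fin n) (Fin k) A := of c
  have hW : V * B.adjugate = B.det • W := by
    ext i j
    rw [hc, hc']; rfl
  let z := x - W *ᵥ (x ∘ rows)
  have hz : B.det • x = B.det • z + V *ᵥ (B.adjugate *ᵥ (x ∘ rows)) := by
    rw [mulVec_mulVec, hW, smul_mulVec]; simp [z, smul_sub]
  refine ⟨z, _, ?_, hz⟩
  intro j
  have h2 := congrFun hz (rows j)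
  have h3 : (V *ᵥ (B.adjugate *ᵥ (x ∘ rows))) (rows j) = B.det * x (rows j) := by
    change (B *ᵥ (B.adjugate *ᵥ (x ∘ rows))) j = _
    rw [mulVec_mulVec, mul_adjugate, smul_mulVec, one_mulVec]; rfl
  simp only [Pi.add_apply, Pi.smul_apply, h3, smul_eq_mul] at h2
  have h4 : z (rows j) * B.det = 0 := by linear_combination -h2
  exact (mul_right_mem_nonZeroDivisors_eq_zero_iff hd).1 h4

theorem aux4 {A : Type*} [CommRing A] [IsLocalRing A] (T : Set A) (f : A)
    (hf : f ∈ nonZeroDivisors A) (h : Ideal.span T = Ideal.span {f}) :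
    ∃ d ∈ T, Ideal.span {d} = Ideal.span {f} := by
  by_contra! hcon
  have hle : Ideal.span T ≤ Ideal.span {f} * IsLocalRing.maximalIdeal A := by
    rw [Ideal.span_le]
    intro d hd
    have h1 : d ∈ Ideal.span {f} := h ▸ Ideal.subset_span hd
    obtain ⟨c, rfl⟩ := Ideal.mem_span_singleton.1 h1
    refine Ideal.mem_span_singleton_mul.2 ⟨c, ?_, rfl⟩
    rw [IsLocalRing.mem_maximalIdeal, mem_nonunits_iff]
    intro hc
    exact hcon _ hd (Ideal.span_singleton_mul_right_unit hc f)
  have h1 : f ∈ Ideal.span T := h ▸ Ideal.mem_span_singleton_self f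
  obtain ⟨c, hc, hfc⟩ := Ideal.mem_span_singleton_mul.1 (hle h1)
  have h2 : (c - 1) * f = 0 := by linear_combination hfc
  have h3 := (mul_right_mem_nonZeroDivisors_eq_zero_iff hf).1 h2
  rw [sub_eq_zero.1 h3] at hc
  exact (IsLocalRing.mem_maximalIdeal _).1 hc isUnit_one


/-- (Raynaud–Gruson 5.4.3, local algebraic core.)  Let `A` be a Noetherian local ring
and `M` a finitely generated `A`-module whose `r`-th Fitting ideal is generated by a
nonzerodivisor `f`, and suppose that `M_𝔭` is free of rank `r` over `A_𝔭` for every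
associated prime `𝔭` of `A`.  Then, `N` denoting the submodule of elements of `M`
annihilated by the `r`-th Fitting ideal, `M ⧸ N` is free of rank `r`. -/
theorem quotient_torsion_free_of_fitting_principal
    {A : Type*} [CommRing A] [IsNoetherianRing A] [IsLocalRing A]
    (M : Type*) [AddCommGroup M] [Module A M] [Module.Finite A M] (r : ℕ)
    {ι : Type*} {n : ℕ}
    (u : (ι →₀ A) →ₗ[A] (Fin n → A)) (π : (Fin n → A) →ₗ[A] M)
    (hπ : Function.Surjective π) (huπ : Function.Exact u π)
    (f : A) (hf : f ∈ nonZeroDivisors A)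
    (hFitt : fittingIdealOfPresentation u r = Ideal.span {f})
    (hAss : ∀ p ∈ associatedPrimes A A, ∀ (_ : p.IsPrime),
      Module.Free (Localization p.primeCompl) (LocalizedModule p.primeCompl M) ∧
      Module.finrank (Localization p.primeCompl) (LocalizedModule p.primeCompl M) = r) :
    Module.Free A
        (M ⧸ Submodule.torsionBySet A M ((fittingIdealOfPresentation u r : Ideal A) : Set A)) ∧
      Module.finrank A
        (M ⧸ Submodule.torsionBySet A M ((fittingIdealOfPresentation u r : Ideal A) : Set A)) = r := by
  classical
  by_cases hn : n ≤ r
  · have := aux2 (Fin r) f hf (by simpa using hAss)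
      (π ∘ₗ LinearMap.funLeft A A (Fin.castLE hn)) (fun m => by
        obtain ⟨x, rfl⟩ := hπ m
        obtain ⟨y, rfl⟩ := LinearMap.funLeft_surjective_of_injective A A _ (Fin.castLE_injective hn) x
        exact ⟨y, rfl⟩) _ hFitt
    simpa using this
  · have hFitt' := hFitt
    rw [fittingIdealOfPresentation, if_neg hn] at hFitt'
    obtain ⟨d, ⟨rows, cols, hd⟩, hdf⟩ := aux4 _ f hf hFitt'
    let V : Matrix (Fin n) (Fin (n - r)) A := Matrix.of fun i j => u (Finsupp.single (cols j) 1) i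
    have hdV : d = (V.submatrix rows id).det := hd
    have hdn : d ∈ nonZeroDivisors A := by
      obtain ⟨c, hc⟩ := Ideal.mem_span_singleton.1 (hdf ▸ Ideal.mem_span_singleton_self f)
      rw [hc] at hf
      exact (mul_mem_nonZeroDivisors.1 hf).1
    have hinj : Function.Injective rows := by
      intro a b hab
      by_contra hne
      apply nonZeroDivisors.ne_zero hdn
      rw [hdV]
      exact Matrix.det_zero_of_row_eq hne (by ext j; simp [hab])
    have hcard : Fintype.card {i // i ∉ Set.range rows} = r := by
      rw [Fintype.card_subtype_compl]
      have : Fintype.card {i // i ∈ Set.range rows} = n - r := by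
        have h := Fintype.card_congr (Equiv.ofInjective rows hinj)
        rw [Fintype.card_fin] at h
        exact (Fintype.card_congr (Equiv.refl _)).trans h.symm
      rw [this, Fintype.card_fin]
      omega
    have := aux2 {i // i ∉ Set.range rows} d hdn (by simpa only [hcard] using hAss)
      (π ∘ₗ Function.ExtendByZero.linearMap A Subtype.val) (fun m => by
        obtain ⟨x, rfl⟩ := hπ m
        obtain ⟨z, y, hz, hxy⟩ := aux3 V rows (hdV ▸ hdn) (fun rows' => by
          rw [← hdV, ← Ideal.mem_span_singleton, hdf, ← hFitt']
          exact Ideal.subset_span ⟨rows', cols, rfl⟩) x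
        rw [← hdV] at hxy
        refine ⟨fun i => z i, ?_⟩
        have h1 : Function.ExtendByZero.linearMap A Subtype.val
            (fun i : {i // i ∉ Set.range rows} => z i) = z := by
          ext i
          change Function.extend Subtype.val (fun i : {i // i ∉ Set.range rows} => z i) 0 i = z i
          by_cases hi : i ∈ Set.range rows
          · obtain ⟨j, rfl⟩ := hi
            rw [hz]
            exact Function.extend_apply' _ _ _ (by rintro ⟨⟨a, ha⟩, rfl⟩; exact ha ⟨j, rfl⟩)
          · exact Subtype.val_injective.extend_apply _ _ (⟨i, hi⟩ : {i // i ∉ Set.range rows})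
        have h2 : V *ᵥ y = u (∑ j, Finsupp.single (cols j) (y j)) := by
          ext i
          have : ∀ j, Finsupp.single (cols j) (y j) = y j • Finsupp.single (cols j) (1 : A) := by
            intro j; simp
          simp only [this, map_sum, map_smul, Finset.sum_apply, Pi.smul_apply, smul_eq_mul]
          simp only [Matrix.mulVec, dotProduct]
          exact Finset.sum_congr rfl fun j _ => mul_comm _ _
        rw [LinearMap.comp_apply, h1, ← map_smul, hxy, map_add, h2, huπ.apply_apply_eq_zero,
          add_zero, map_smul]) _ (hFitt.trans hdf.symm)
    rwa [hcard] at this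
end

section
/- Let $A$ be a Noetherian ring, let $B$ be a flat Noetherian $A$-algebra whose fibers over all primes of $A$ satisfy $(S_1)$, and let $M$ be a finitely generated $A$-module. Then a prime $\mathfrak q$ of $B$ is an associated prime of $M \otimes_A B$ if and only if there is an associated prime $\mathfrak p$ of $M$ such that $\mathfrak q$ is a minimal prime over $\mathfrak p B$. -/
set_option synthInstance.maxHeartbeats 1000000
set_option maxHeartbeats 1000000
open TensorProduct

theorem aux_filtration {A : Type*} {B : Type*} [CommRing A] [CommRing B] [IsNoetherianRing A]
    [Algebra A B] [Module.Flat A B]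
    (M : Type*) [AddCommGroup M] [Module A M] [hM : Module.Finite A M] (q : Ideal B) :
    q ∈ associatedPrimes B (B ⊗[A] M) →
      ∃ p : Ideal A, p.IsPrime ∧ q ∈ associatedPrimes B (B ⊗[A] (A ⧸ p)) := by
  induction hM using
    IsNoetherianRing.induction_on_isQuotientEquivQuotientPrime A with
  | subsingleton N =>
    intro h
    exact absurd h not_isAssociatedPrime_of_subsingleton
  | quotient N p f =>
    intro h
    refine ⟨p.1, p.2, ?_⟩
    rwa [← LinearEquiv.AssociatedPrimes.eq (f.baseChange A B N (A ⧸ p.1))]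
  | exact N₁ N₂ N₃ f g hf hg hfg h1 h3 =>
    intro h
    have hf' : Function.Injective (f.baseChange B) :=
      Module.Flat.lTensor_preserves_injective_linearMap (M := B) f hf
    have hfg' : Function.Exact (f.baseChange B) (g.baseChange B) :=
      Module.Flat.lTensor_exact B hfg
    rcases associatedPrimes.subset_union_of_exact hf' hfg' h with h | h
    · exact h1 h
    · exact h3 h

theorem aux_comap {A : Type*} {B : Type*} [CommRing A] [CommRing B] 
    [IsNoetherianRing B]
    [Algebra A B] [Module.Flat A B] (p : Ideal A) [p.IsPrime] (q : Ideal B)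
    (h : q ∈ associatedPrimes B (B ⊗[A] (A ⧸ p))) : q.comap (algebraMap A B) = p := by
  obtain ⟨hq, y, hy⟩ := isAssociatedPrime_iff.1 h
  have hy0 : y ≠ 0 := by
    rintro rfl
    apply hq.ne_top
    rw [hy]; simp
  ext a
  rw [Ideal.mem_comap, hy, Submodule.mem_colon_singleton, Submodule.mem_bot, algebraMap_smul]
  constructor
  · intro h0
    by_contra ha
    have hinj : Function.Injective (LinearMap.lsmul A (A ⧸ p) a) := by
      rw [injective_iff_map_eq_zero]
      intro x hx
      obtain ⟨x, rfl⟩ := Ideal.Quotient.mk_surjective x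
      have : Ideal.Quotient.mk p (a * x) = 0 := hx
      rw [Ideal.Quotient.eq_zero_iff_mem] at this ⊢
      exact (Ideal.IsPrime.mem_or_mem ‹_› this).resolve_left ha
    have := Module.Flat.lTensor_preserves_injective_linearMap (M := B) _ hinj
    apply hy0
    apply this
    rw [map_zero, ← h0]
    exact congr($(LinearMap.lTensor_smul_action B (A ⧸ p) a) y)
  · intro ha
    have h2 : ∀ z : B ⊗[A] (A ⧸ p), a • z = 0 := by
      intro z
      induction z with
      | zero => simp
      | add u v hu hv => rw [smul_add, hu, hv, add_zero]
      | tmul b c =>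
        have : a • c = 0 := by
          rw [Algebra.smul_def, Ideal.Quotient.algebraMap_eq, Ideal.Quotient.eq_zero_iff_mem.2 ha,
            zero_mul]
        rw [← TensorProduct.tmul_smul, this, TensorProduct.tmul_zero]
    exact h2 y

theorem aux_mem {A : Type*} {B : Type*} [CommRing A] [CommRing B] [IsNoetherianRing A]
    [IsNoetherianRing B] [Algebra A B] [Module.Flat A B]
    (M : Type*) [AddCommGroup M] [Module A M] [hM : Module.Finite A M] (q : Ideal B) 
    (h : q ∈ associatedPrimes B (B ⊗[A] M)) :
    q.comap (algebraMap A B) ∈ associatedPrimes A M := by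
  obtain ⟨hq, x, hx⟩ := isAssociatedPrime_iff.1 h
  classical
  by_contra hp
  set p := q.comap (algebraMap A B) with hpdef
  have hpp : p.IsPrime := Ideal.IsPrime.comap _
  obtain ⟨S, hS⟩ := (isNoetherianRing_iff_ideal_fg A).mp ‹_› p
  let φ : M →ₗ[A] (S → M) := LinearMap.pi fun s => LinearMap.lsmul A M s.1
  have hex := Module.Flat.lTensor_exact B (LinearMap.exact_subtype_ker_map φ)
  have hx0 : φ.lTensor B x = 0 := by
    apply (TensorProduct.piRight A A B (fun _ : S => M)).injective
    rw [map_zero]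
    funext s
    have h1 : ∀ z : B ⊗[A] M, (TensorProduct.piRight A A B (fun _ : S => M)) (φ.lTensor B z) s
        = s.1 • z := by
      intro z
      induction z with
      | zero => simp
      | add a b ha hb => rw [map_add, map_add, Pi.add_apply, ha, hb, smul_add]
      | tmul b m => simp [φ]
    rw [h1]
    have : s.1 ∈ p := hS ▸ Ideal.subset_span s.2
    rw [hpdef, Ideal.mem_comap, hx, Submodule.mem_colon_singleton, Submodule.mem_bot,
      algebraMap_smul] at this
    exact this
  obtain ⟨z, hz⟩ := (hex x).1 hx0
  -- every element of the kernel is killed by some element outside `p`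
  have hker : ∀ n : M, φ n = 0 → p ≤ (⊥ : Submodule A M).colon {n} := by
    intro n hn
    rw [← hS]
    refine Ideal.span_le.2 fun s hs => ?_
    rw [SetLike.mem_coe, Submodule.mem_colon_singleton, Submodule.mem_bot]
    exact congrFun hn ⟨s, hs⟩
  have hkill : ∀ n : M, φ n = 0 → ∃ s ∉ p, s • n = 0 := by
    intro n hn
    by_contra! hc
    apply hp
    refine isAssociatedPrime_iff.2 ⟨hpp, n, le_antisymm (hker n hn) fun s hs => ?_⟩
    by_contra hsp
    refine hc s hsp ?_
    rwa [Submodule.mem_colon_singleton, Submodule.mem_bot] at hs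
  have hkz : ∀ z : B ⊗[A] (LinearMap.ker φ), ∃ s ∉ p, s • z = 0 := by
    intro z
    induction z with
    | zero => exact ⟨1, hpp.one_notMem, by simp⟩
    | tmul b n =>
      obtain ⟨s, hs, h⟩ := hkill n.1 n.2
      refine ⟨s, hs, ?_⟩
      have : s • n = 0 := Subtype.ext h
      rw [← TensorProduct.tmul_smul, this, TensorProduct.tmul_zero]
    | add a b ha hb =>
      obtain ⟨s, hs, h⟩ := ha
      obtain ⟨t, ht, h'⟩ := hb
      refine ⟨s * t, fun hst => (hpp.mem_or_mem hst).elim hs ht, ?_⟩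
      rw [smul_add, mul_comm, mul_smul, h, mul_comm, mul_smul, h']
      simp
  obtain ⟨s, hs, hsz⟩ := hkz z
  apply hs
  rw [hpdef, Ideal.mem_comap, hx, Submodule.mem_colon_singleton, Submodule.mem_bot,
      algebraMap_smul, ← hz, ← map_smul, hsz, map_zero]

theorem aux_fiber {A : Type*} {B : Type*} [CommRing A] [CommRing B] 
    [IsNoetherianRing B] [Algebra A B] [Module.Flat A B] (p : Ideal A) [p.IsPrime]
    (hfib : ∀ q ∈ associatedPrimes (p.ResidueField ⊗[A] B) (p.ResidueField ⊗[A] B),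
        q ∈ minimalPrimes (p.ResidueField ⊗[A] B)) (q : Ideal B)
    (h : q ∈ associatedPrimes B (B ⊗[A] (A ⧸ p))) :
    q ∈ (Ideal.map (algebraMap A B) p).minimalPrimes := by
  have hc := aux_comap p q h
  obtain ⟨hq, y, hy⟩ := isAssociatedPrime_iff.1 h
  let e := PrimeSpectrum.preimageOrderIsoFiber A B ⟨p, ‹_›⟩
  let Q := e ⟨⟨q, hq⟩, PrimeSpectrum.ext hc⟩
  have hQ : ∀ b : B, (1 ⊗ₜ b : p.ResidueField ⊗[A] B) ∈ Q.asIdeal ↔ b ∈ q := by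
    intro b
    have : e.symm Q = ⟨⟨q, hq⟩, PrimeSpectrum.ext hc⟩ := e.symm_apply_apply _
    have h2 := congr(b ∈ ($this).1.asIdeal)
    exact iff_of_eq h2
  let ι : (A ⧸ p) →ₗ[A] p.ResidueField := (IsScalarTower.toAlgHom A (A ⧸ p) p.ResidueField).toLinearMap
  have hι : Function.Injective ι := p.injective_algebraMap_quotient_residueField
  let ψ : B ⊗[A] (A ⧸ p) →ₗ[A] p.ResidueField ⊗[A] B :=
    (TensorProduct.comm A B p.ResidueField).toLinearMap ∘ₗ ι.lTensor B
  have hψ : Function.Injective ψ :=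
    (TensorProduct.comm A B p.ResidueField).injective.comp
      (Module.Flat.lTensor_preserves_injective_linearMap (M := B) ι hι)
  have hψb : ∀ b z, ψ (b • z) = (1 ⊗ₜ b) * ψ z := by
    intro b z
    induction z with
    | zero => simp
    | add a c ha hb => rw [smul_add, map_add, ha, hb, map_add, mul_add]
    | tmul c a => simp [ψ, TensorProduct.smul_tmul']
  have hsQ : ∀ s ∉ p, ∀ f : p.ResidueField ⊗[A] B, s • f ∈ Q.asIdeal → f ∈ Q.asIdeal := by
    intro s hs f hf
    rw [Algebra.smul_def] at hf
    refine (Q.2.mem_or_mem hf).resolve_left fun h => hs ?_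
    rw [← hc, Ideal.mem_comap, ← hQ]
    rwa [← Algebra.TensorProduct.tmul_one_eq_one_tmul]
  have hs0 : ∀ s ∉ p, ∀ f : p.ResidueField ⊗[A] B, s • f = 0 → f = 0 := by
    intro s hs f hf
    have hu : algebraMap A p.ResidueField s ≠ 0 := by
      rwa [Ne, Ideal.algebraMap_residueField_eq_zero]
    rw [← algebraMap_smul p.ResidueField] at hf
    exact (smul_eq_zero_iff_right hu).1 hf
  have hQass : Q.asIdeal ∈ associatedPrimes (p.ResidueField ⊗[A] B) (p.ResidueField ⊗[A] B) := by
    have key : Q.asIdeal = (⊥ : Submodule (p.ResidueField ⊗[A] B) _).colon {ψ y} := by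
      ext f
      rw [Submodule.mem_colon_singleton, Submodule.mem_bot, smul_eq_mul]
      obtain ⟨s, hs, b, hb⟩ := Ideal.Fiber.exists_smul_eq_one_tmul p f
      have hb1 : b ∈ q ↔ (s • f) * ψ y = 0 := by
        rw [hb, ← hψb, map_eq_zero_iff ψ hψ, hy, Submodule.mem_colon_singleton, Submodule.mem_bot]
      constructor
      · intro hf
        apply hs0 s hs
        rw [← smul_mul_assoc, ← hb1, ← hQ, ← hb, Algebra.smul_def]
        exact Ideal.mul_mem_left _ _ hf
      · intro hf
        apply hsQ s hs
        rw [hb, hQ, hb1, smul_mul_assoc, hf, smul_zero]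
    exact ⟨Q.2, ψ y, by rw [← key, Q.2.radical]⟩
  have hmin := hfib _ hQass
  refine ⟨⟨hq, ?_⟩, ?_⟩
  · rw [Ideal.map_le_iff_le_comap, hc]
  · rintro q' ⟨hq', hpq'⟩ hle
    have hc' : q'.comap (algebraMap A B) = p :=
      le_antisymm ((Ideal.comap_mono hle).trans hc.le) (Ideal.map_le_iff_le_comap.1 hpq')
    let x : (PrimeSpectrum.comap (algebraMap A B) ⁻¹' {⟨p, ‹_›⟩} : Set (PrimeSpectrum B)) :=
      ⟨⟨q', hq'⟩, PrimeSpectrum.ext hc'⟩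
    have h1 : e x ≤ Q := e.monotone (a := x) (b := ⟨⟨q, hq⟩, PrimeSpectrum.ext hc⟩) hle
    have h2 : Q ≤ e x := hmin.2 ⟨(e x).2, bot_le⟩ h1
    exact e.le_iff_le.1 h2

/-- Let `B` be a flat Noetherian algebra over a Noetherian ring `A` whose fibers
`κ(𝔭) ⊗[A] B` have no embedded primes (every associated prime of the fiber ring is a
minimal prime), and let `M` be a finitely generated `A`-module.  Then a prime `𝔮` of
`B` is associated to `B ⊗[A] M` iff it is minimal over `𝔭B` for some associated prime
`𝔭` of `M`. -/
theorem associatedPrimes_baseChange_of_s1_fibers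
    {A B : Type*} [CommRing A] [CommRing B] [IsNoetherianRing A] [IsNoetherianRing B]
    [Algebra A B] [Module.Flat A B]
    (hfib : ∀ (p : Ideal A) [p.IsPrime],
      ∀ q ∈ associatedPrimes
          ((IsLocalRing.ResidueField (Localization.AtPrime p)) ⊗[A] B)
          ((IsLocalRing.ResidueField (Localization.AtPrime p)) ⊗[A] B),
        q ∈ minimalPrimes
          ((IsLocalRing.ResidueField (Localization.AtPrime p)) ⊗[A] B))
    (M : Type*) [AddCommGroup M] [Module A M] [Module.Finite A M] (q : Ideal B) :
    q ∈ associatedPrimes B (B ⊗[A] M) ↔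
      ∃ p ∈ associatedPrimes A M, q ∈ (Ideal.map (algebraMap A B) p).minimalPrimes := by
  constructor
  · intro h
    obtain ⟨p, hp, hq⟩ := aux_filtration M q h
    have hc := aux_comap p q hq
    refine ⟨p, hc ▸ aux_mem M q h, aux_fiber p (hfib p) q hq⟩
  · rintro ⟨p, hp, hq⟩
    obtain ⟨hpp, f, hf⟩ := (isAssociatedPrime_iff_exists_injective_linearMap p M).1 hp
    have hf' : Function.Injective (f.baseChange B) :=
      Module.Flat.lTensor_preserves_injective_linearMap (M := B) f hf
    apply associatedPrimes.subset_of_injective hf'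
    let e := (Algebra.TensorProduct.quotIdealMapEquivTensorQuot B p).toLinearEquiv
    rw [← LinearEquiv.AssociatedPrimes.eq e]
    apply Module.associatedPrimes.minimalPrimes_annihilator_subset_associatedPrimes
    rwa [Ideal.annihilator_quotient]
end
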